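/- Fix an integer r ≥ 2 and set A_r := Σ_{m=0}^∞ W_r(m) (a convergent series). For every ε > 0 there exists N such that for every integer n ≥ N there exists Q such that for every finite field F_q with q > Q elements and every choice of r distinct polynomials a_1, …, a_r ∈ F_q[T], each of degree < n, one has | q^{−n} · #{ f monic of degree n in F_q[T] : φ(f + a_1) = … = φ(f + a_r) } − A_r / n^r | ≤ ε / n^r. -/

import Mathlib

open Polynomial

/-- The Euler totient function for `F_q[T]`: the number of invertible residues
modulo `f`. -/
noncomputable def phiPoly {F : Type*} [Field F] (f : F[X]) : ℕ :=
  Nat.card ((F[X] ⧸ Ideal.span {f})ˣ)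

/-- The cycle structure of a permutation of `n` letters: the multiset of the lengths
of its disjoint cycles, including fixed points. -/
def cycleStruct {n : ℕ} (σ : Equiv.Perm (Fin n)) : Multiset ℕ :=
  σ.cycleType + Multiset.replicate (n - σ.cycleType.sum) 1

/-- W_r(n): the probability that `r` independent uniformly random permutations of `n`
letters all have the same cycle structure (note `W r 0 = 1`). -/
noncomputable def W (r n : ℕ) : ℝ :=
  (Nat.card {v : Fin r → Equiv.Perm (Fin n) //
      ∀ i j, cycleStruct (v i) = cycleStruct (v j)} : ℝ) / (n.factorial : ℝ) ^ r

section
open Finset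

noncomputable def wf (r : ℕ) (c m : ℕ) : ℝ := (((c : ℝ) ^ m * (m.factorial : ℝ)) ^ r)⁻¹

lemma cycleStruct_eq_partition {n : ℕ} (σ : Equiv.Perm (Fin n)) :
    cycleStruct σ = σ.partition.parts := by
  rw [Equiv.Perm.parts_partition, cycleStruct, Equiv.Perm.sum_cycleType, Fintype.card_fin]

lemma cycleStruct_eq_iff {n : ℕ} (σ : Equiv.Perm (Fin n)) (p : n.Partition) :
    cycleStruct σ = p.parts ↔ σ.cycleType = p.parts.filter (2 ≤ ·) := by
  have key : ∀ q : Multiset ℕ, (∀ i ∈ q, 0 < i) → q.sum = n →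
      q = q.filter (2 ≤ ·) + Multiset.replicate (n - (q.filter (2 ≤ ·)).sum) 1 := by
    intro q hq hs
    have h2 : q.filter (fun x => ¬ 2 ≤ x) = Multiset.replicate (q.filter (fun x => ¬ 2 ≤ x)).card 1 := by
      rw [Multiset.eq_replicate_card]
      intro b hb
      have := Multiset.mem_filter.1 hb
      have := hq b this.1
      omega
    have h3 := Multiset.filter_add_not (2 ≤ ·) q
    have h4 : (q.filter (2 ≤ ·)).sum + (q.filter (fun x => ¬ 2 ≤ x)).card = n := by
      conv_rhs => rw [← hs, ← h3, Multiset.sum_add, h2]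
      simp
    conv_lhs => rw [← h3, h2]
    congr 2
    omega
  constructor
  · intro h
    rw [← h, cycleStruct_eq_partition, Equiv.Perm.filter_parts_partition_eq_cycleType]
  · intro h
    rw [cycleStruct, h]
    exact (key p.parts (fun i hi => p.parts_pos hi) p.parts_sum).symm

lemma card_cycleStruct {n : ℕ} (p : n.Partition) :
    (#({σ | cycleStruct σ = p.parts} : Finset (Equiv.Perm (Fin n))) : ℝ) =
      n.factorial * (p.parts.toFinsupp.prod (wf 1)) := by
  have h1 : ({σ | cycleStruct σ = p.parts} : Finset (Equiv.Perm (Fin n))) =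
     ({σ | σ.cycleType = p.parts.filter (2 ≤ ·)} : Finset (Equiv.Perm (Fin n))) := by
    ext σ; simp only [mem_filter, mem_univ, true_and]; exact cycleStruct_eq_iff σ p
  have h2 := Equiv.Perm.card_of_cycleType_mul_eq (Fin n) (p.parts.filter (2 ≤ ·))
  have h3 := Multiset.filter_add_not (2 ≤ ·) p.parts
  have h4 : p.parts.filter (fun x => ¬ 2 ≤ x) = Multiset.replicate (p.parts.count 1) 1 := by
    rw [← Multiset.filter_eq']
    apply Multiset.filter_congr
    intro x hx
    have := p.parts_pos hx
    omega
  have hs : (p.parts.filter (2 ≤ ·)).sum + p.parts.count 1 = n := by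
    conv_rhs => rw [← p.parts_sum, ← h3, Multiset.sum_add, h4]
    simp
  have hp : (p.parts.filter (2 ≤ ·)).prod = p.parts.prod := by
    conv_rhs => rw [← h3, Multiset.prod_add, h4]
    simp
  have hc : (p.parts.count 1).factorial * ∏ k ∈ (p.parts.filter (2 ≤ ·)).toFinset, ((p.parts.filter (2 ≤ ·)).count k).factorial
     = ∏ k ∈ p.parts.toFinset, (p.parts.count k).factorial := by
    rw [Multiset.toFinset_filter]
    rw [← Finset.prod_filter_mul_prod_filter_not p.parts.toFinset (2 ≤ ·), mul_comm]
    congr 1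
    · apply Finset.prod_congr rfl
      intro k hk
      rw [Multiset.count_filter_of_pos (Finset.mem_filter.1 hk).2]
    · by_cases h : 1 ∈ p.parts
      · rw [show (p.parts.toFinset.filter fun x => ¬ 2 ≤ x) = {1} from ?_, Finset.prod_singleton]
        ext x
        simp only [mem_filter, Multiset.mem_toFinset, mem_singleton]
        constructor
        · rintro ⟨hx, h2⟩
          have := p.parts_pos hx; omega
        · rintro rfl; exact ⟨h, by norm_num⟩
      · rw [show (p.parts.toFinset.filter fun x => ¬ 2 ≤ x) = ∅ from ?_, Finset.prod_empty,
          Multiset.count_eq_zero_of_notMem h, Nat.factorial_zero]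
        ext x
        simp only [mem_filter, Multiset.mem_toFinset, notMem_empty, iff_false]
        rintro ⟨hx, h2⟩
        have := p.parts_pos hx
        have : x = 1 := by omega
        exact h (this ▸ hx)
  rw [if_pos ⟨by rw [Fintype.card_fin]; omega, fun a ha => (Multiset.mem_filter.1 ha).2⟩, Fintype.card_fin,
    show n - (p.parts.filter (2 ≤ ·)).sum = p.parts.count 1 by omega, hp,
    mul_right_comm, hc, ← h1] at h2
  have hz : p.parts.toFinsupp.prod (wf 1) =
     (((∏ k ∈ p.parts.toFinset, (p.parts.count k).factorial) * p.parts.prod : ℕ) : ℝ)⁻¹ := by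
    rw [Finsupp.prod, Multiset.toFinsupp_support, Finset.prod_multiset_count p.parts]
    push_cast
    rw [← Finset.prod_mul_distrib, ← Finset.prod_inv_distrib]
    apply Finset.prod_congr rfl
    intro k hk
    rw [Multiset.toFinsupp_apply, wf, pow_one, mul_comm]
  have hne : ((∏ k ∈ p.parts.toFinset, (p.parts.count k).factorial) * p.parts.prod : ℕ) ≠ 0 := by
    apply mul_ne_zero
    · exact Finset.prod_ne_zero_iff.2 (fun k _ => Nat.factorial_ne_zero _)
    · exact Multiset.prod_ne_zero (fun h => (p.parts_pos h).ne rfl)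
  rw [hz, ← h2, Nat.cast_mul, mul_assoc, mul_inv_cancel₀ (Nat.cast_ne_zero.2 hne), mul_one]

lemma wf_pow (r c m : ℕ) : wf r c m = (wf 1 c m) ^ r := by
  simp only [wf, pow_one, inv_pow]

lemma W_eq_sum (r n : ℕ) (hr : 1 ≤ r) :
    W r n = ∑ p : n.Partition, p.parts.toFinsupp.prod (wf r) := by
  classical
  have h1 : Nat.card {v : Fin r → Equiv.Perm (Fin n) //
      ∀ i j, cycleStruct (v i) = cycleStruct (v j)} =
      ∑ p : n.Partition, (#({σ | cycleStruct σ = p.parts} : Finset (Equiv.Perm (Fin n)))) ^ r := by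
    rw [Nat.card_eq_fintype_card, Fintype.card_subtype]
    have : ∀ p : n.Partition, (#({σ | cycleStruct σ = p.parts} : Finset (Equiv.Perm (Fin n)))) ^ r
       = #(Fintype.piFinset fun _ : Fin r => ({σ | cycleStruct σ = p.parts} : Finset (Equiv.Perm (Fin n)))) := by
      intro p; simp
    simp_rw [this]
    rw [← Finset.card_biUnion]
    · congr 1
      ext v
      simp only [mem_filter, mem_univ, true_and, mem_biUnion, Fintype.mem_piFinset]
      constructor
      · intro h
        have e : Fintype.card (Fin n) = n := Fintype.card_fin n
        refine ⟨⟨(v ⟨0, hr⟩).partition.parts, (v ⟨0, hr⟩).partition.parts_pos, by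
          rw [(v ⟨0, hr⟩).partition.parts_sum, e]⟩, fun a => ?_⟩
        rw [h a ⟨0, hr⟩, cycleStruct_eq_partition]
      · rintro ⟨p, hp⟩ i j
        rw [hp i, hp j]
    · intro p _ p' _ hpp
      refine Finset.disjoint_left.2 ?_
      intro v hv hv'
      rw [Fintype.mem_piFinset] at hv hv'
      have a1 := (mem_filter.1 (hv ⟨0, hr⟩)).2
      have a2 := (mem_filter.1 (hv' ⟨0, hr⟩)).2
      exact hpp (Nat.Partition.ext (a1.symm.trans a2))
  rw [W, h1]
  push_cast
  rw [Finset.sum_div]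
  apply Finset.sum_congr rfl
  intro p _
  rw [card_cycleStruct, mul_pow, mul_div_cancel_left₀]
  · simp only [Finsupp.prod]
    rw [← Finset.prod_pow]
    apply Finset.prod_congr rfl
    intro k _
    rw [wf_pow r]
  · have := n.factorial_ne_zero
    positivity

/-- local factor -/
noncomputable def wg (r c : ℕ) : ℕ → ℝ := fun k => if c ∣ k then wf r c (k / c) else 0

noncomputable def wE (r c : ℕ) : PowerSeries ℝ := ∏ i ∈ range c, PowerSeries.mk (wg r (i+1))

noncomputable def we (r c n : ℕ) : ℝ := PowerSeries.coeff n (wE r c)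

open scoped PowerSeries.WithPiTopology in
lemma wg_eq (r i : ℕ) : (1 : PowerSeries ℝ) + ∑' j, wf r (i + 1) (j + 1) • (PowerSeries.X : PowerSeries ℝ) ^ ((i + 1) * (j + 1))
    = PowerSeries.mk (wg r (i+1)) := by
  ext k
  rw [map_add, (Nat.Partition.summable_genFun_term (wf r) i).map_tsum _ (PowerSeries.WithPiTopology.continuous_coeff _ _)]
  simp only [PowerSeries.coeff_smul, PowerSeries.coeff_X_pow, PowerSeries.coeff_one, PowerSeries.coeff_mk, wg]
  by_cases hk : k = 0
  · subst hk
    simp [wf]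
  · rw [if_neg hk, zero_add]
    by_cases hd : (i+1) ∣ k
    · obtain ⟨j, rfl⟩ := hd
      have hj : j ≠ 0 := by rintro rfl; simp at hk
      rw [if_pos (dvd_mul_right _ _), tsum_eq_single (j-1)]
      · have : j - 1 + 1 = j := by omega
        simp [this]
      · intro b hb
        have : (i+1) * j ≠ (i+1) * (b+1) := by
          intro h
          have := Nat.eq_of_mul_eq_mul_left (Nat.succ_pos i) h
          omega
        simp only [smul_eq_mul]
        rw [if_neg this, mul_zero]
    · rw [if_neg hd]
      convert! tsum_zero with j
      rw [if_neg, smul_zero]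
      rintro rfl
      exact hd (dvd_mul_right _ _)

lemma wg_nonneg (r c k : ℕ) : 0 ≤ wg r c k := by
  unfold wg wf; split_ifs <;> positivity

lemma wg_zero (r c : ℕ) : wg r c 0 = 1 := by simp [wg, wf]

lemma wg_small (r c k : ℕ) (h : k < c) (h0 : k ≠ 0) : wg r c k = 0 := by
  rw [wg, if_neg]
  intro hd
  exact absurd (Nat.le_of_dvd (by omega) hd) (by omega)

lemma we_succ (r c n : ℕ) : we r (c+1) n = ∑ x ∈ antidiagonal n, we r c x.1 * wg r (c+1) x.2 := by
  rw [we, wE, Finset.prod_range_succ, PowerSeries.coeff_mul]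
  simp [we, wE]

lemma we_nonneg (r c n : ℕ) : 0 ≤ we r c n := by
  induction c generalizing n with
  | zero => rw [we, wE]; simp [PowerSeries.coeff_one]; split_ifs <;> norm_num
  | succ c ih => rw [we_succ]; exact Finset.sum_nonneg fun x _ => mul_nonneg (ih _) (wg_nonneg _ _ _)

lemma we_succ_eq (r c n : ℕ) (h : n ≤ c) : we r (c+1) n = we r c n := by
  rw [we_succ, Finset.sum_eq_single (n, 0)]
  · simp [wg_zero]
  · rintro ⟨a, b⟩ hab hne
    have hab' : a + b = n := by simpa using hab
    rw [wg_small _ _ _ (by simp; omega), mul_zero]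
    rintro (rfl : b = 0)
    exact hne (by simp; omega)
  · simp

lemma we_stable (r c n : ℕ) (h : n ≤ c) : we r c n = we r n n := by
  induction c, h using Nat.le_induction with
  | base => rfl
  | succ c hc ih => rw [we_succ_eq _ _ _ hc, ih]

open scoped PowerSeries.WithPiTopology in
lemma W_eq_we (r n : ℕ) (hr : 1 ≤ r) : W r n = we r n n := by
  rw [W_eq_sum r n hr, ← Nat.Partition.coeff_genFun]
  have h := (Nat.Partition.hasProd_genFun (wf r)).tendsto_prod_nat
  rw [PowerSeries.WithPiTopology.tendsto_iff_coeff_tendsto] at h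
  refine tendsto_nhds_unique (h n) ?_
  refine tendsto_const_nhds.congr' ?_
  filter_upwards [Filter.eventually_ge_atTop n] with c hc
  rw [← we_stable r c n hc, we, wE]
  congr 1
  exact Finset.prod_congr rfl fun i _ => (wg_eq r i).symm

lemma we_mono (r c n : ℕ) : we r c n ≤ we r (c+1) n := by
  rw [we_succ]
  have := Finset.single_le_sum (f := fun x : ℕ × ℕ => we r c x.1 * wg r (c+1) x.2) (s := antidiagonal n)
    (fun x _ => mul_nonneg (we_nonneg _ _ _) (wg_nonneg _ _ _)) (a := (n,0)) (by simp)
  simpa [wg_zero] using this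

lemma we_mono' (r c c' n : ℕ) (h : c ≤ c') : we r c n ≤ we r c' n := by
  induction c', h using Nat.le_induction with
  | base => rfl
  | succ c hc ih => exact ih.trans (we_mono _ _ _)

lemma we_le (r c n : ℕ) : we r c n ≤ we r n n := by
  rcases le_total c n with h | h
  · exact we_mono' _ _ _ _ h
  · exact (we_stable r c n h).le

lemma wg_shift (r c j : ℕ) (hc : 0 < c) : wg r c (j + c) ≤ ((c:ℝ)^r)⁻¹ * wg r c j := by
  unfold wg
  by_cases h : c ∣ j
  · rw [if_pos h, if_pos (by simpa using h)]
    obtain ⟨m, rfl⟩ := h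
    rw [Nat.mul_div_cancel_left _ hc, show c * m + c = c * (m+1) by ring, Nat.mul_div_cancel_left _ hc]
    unfold wf
    rw [← mul_inv, ← mul_pow]
    apply inv_anti₀
    · have := m.factorial_pos
      positivity
    · apply pow_le_pow_left₀ (by positivity)
      rw [Nat.factorial_succ, pow_succ]
      push_cast
      have h1 : (0:ℝ) ≤ (c:ℝ)^m * c * m.factorial := by positivity
      nlinarith [mul_nonneg h1 (Nat.cast_nonneg m : (0:ℝ) ≤ m)]
  · rw [if_neg h, if_neg (by simpa using h), mul_zero]

lemma we_split (r c n : ℕ) (h : c + 1 ≤ n) :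
    we r (c+1) n = we r c n + ∑ x ∈ antidiagonal (n - (c+1)), we r c x.1 * wg r (c+1) (x.2 + (c+1)) := by
  rw [we_succ]
  have e : we r c n = ∑ x ∈ {((n:ℕ), (0:ℕ))}, we r c x.1 * wg r (c+1) x.2 := by simp [wg_zero]
  rw [e]
  have e2 : ∑ x ∈ antidiagonal (n - (c+1)), we r c x.1 * wg r (c+1) (x.2 + (c+1)) =
     ∑ x ∈ (antidiagonal (n - (c+1))).image (fun x => (x.1, x.2 + (c+1))), we r c x.1 * wg r (c+1) x.2 := by
    rw [Finset.sum_image]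
    rintro ⟨a, b⟩ _ ⟨a', b'⟩ _ h
    simpa using h
  rw [e2, ← Finset.sum_union]
  · symm
    apply Finset.sum_subset
    · intro x hx
      simp only [mem_union, mem_singleton, mem_image, Finset.HasAntidiagonal.mem_antidiagonal, Prod.exists] at hx ⊢
      rcases hx with rfl | ⟨a, b, hab, rfl⟩
      · simp
      · simp; omega
    · rintro ⟨a, b⟩ hab hx
      simp only [mem_union, mem_singleton, mem_image, Finset.HasAntidiagonal.mem_antidiagonal, Prod.exists, Prod.mk.injEq, not_or, not_exists, not_and] at hx hab ⊢
      have hb0 : b ≠ 0 := by rintro rfl; exact hx.1 (by omega) rfl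
      rw [wg_small _ _ _ ?_ hb0, mul_zero]
      by_contra hb
      exact hx.2 a (b - (c+1)) (by omega) rfl (by omega)
  · rw [Finset.disjoint_singleton_left]
    simp

lemma we_diff_le (r c n : ℕ) (h : c + 1 ≤ n) :
    we r (c+1) n ≤ we r c n + (((c + 1 : ℕ):ℝ)^r)⁻¹ * we r (n - (c+1)) (n - (c+1)) := by
  rw [we_split r c n h]
  gcongr
  calc _ ≤ ∑ x ∈ antidiagonal (n - (c+1)), (((c+1 : ℕ):ℝ)^r)⁻¹ * (we r c x.1 * wg r (c+1) x.2) := by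
        apply Finset.sum_le_sum
        intro x _
        have := mul_le_mul_of_nonneg_left (wg_shift r (c+1) x.2 (Nat.succ_pos c)) (we_nonneg r c x.1)
        linarith
    _ = (((c+1 : ℕ):ℝ)^r)⁻¹ * we r (c+1) (n - (c+1)) := by rw [we_succ, Finset.mul_sum]
    _ ≤ _ := by gcongr; exact we_le _ _ _

lemma we_diff_eq (r c n : ℕ) (h : c + 1 ≤ n) (h2 : n < 2 * (c+1)) :
    we r (c+1) n = we r c n + (((c + 1 : ℕ):ℝ)^r)⁻¹ * we r (n - (c+1)) (n - (c+1)) := by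
  rw [we_split r c n h, ← we_stable r c (n - (c+1)) (by omega)]
  congr 1
  rw [Finset.sum_eq_single (n - (c+1), 0)]
  · simp [wg, wf]; ring
  · rintro ⟨a, b⟩ hab hne
    have hab' : a + b = n - (c+1) := by simpa using hab
    have hb : b ≠ 0 := by
      rintro rfl
      exact hne (by simp; omega)
    rw [wg, if_neg, mul_zero]
    intro hd
    have : c + 1 ∣ b := by simpa using hd
    have := Nat.le_of_dvd (by omega) this
    omega
  · simp

lemma wg_sum_le (r c N : ℕ) (hc : 0 < c) (hr : 1 ≤ r) (z : ℝ) (hz : 0 ≤ z) :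
    ∑ j ∈ range N, wg r c j * z ^ j ≤ Real.exp (z ^ c / (c:ℝ) ^ r) := by
  calc ∑ j ∈ range N, wg r c j * z ^ j ≤ ∑ m ∈ range N, (z ^ c / (c:ℝ) ^ r) ^ m / m.factorial := by
        have : ∑ j ∈ range N, wg r c j * z ^ j ≤ ∑ j ∈ (range N).image (fun m => c * m), wg r c j * z ^ j := by
          have : ∑ j ∈ (range N).filter (c ∣ ·), wg r c j * z ^ j = ∑ j ∈ range N, wg r c j * z ^ j := by
            apply Finset.sum_subset (Finset.filter_subset _ _)
            intro x hx hx2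
            have : ¬ c ∣ x := by intro h; exact hx2 (by simp [h]; simpa using hx)
            rw [wg, if_neg this, zero_mul]
          rw [← this]
          apply Finset.sum_le_sum_of_subset_of_nonneg
          · intro x hx
            simp only [mem_filter, mem_range, mem_image] at hx ⊢
            obtain ⟨m, rfl⟩ := hx.2
            exact ⟨m, lt_of_le_of_lt (Nat.le_mul_of_pos_left m hc) hx.1, rfl⟩
          · intro i _ _
            exact mul_nonneg (wg_nonneg _ _ _) (by positivity)
        refine this.trans ?_
        rw [Finset.sum_image (fun a _ b _ h => Nat.eq_of_mul_eq_mul_left hc h)]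
        apply Finset.sum_le_sum
        intro m _
        rw [wg, if_pos (dvd_mul_right _ _), Nat.mul_div_cancel_left _ hc, wf, div_pow, ← pow_mul, pow_mul z,
          div_div, div_eq_mul_inv, mul_comm, ← pow_mul]
        have hm : (1:ℝ) ≤ m.factorial := by exact_mod_cast m.factorial_pos
        gcongr
        rw [mul_pow, ← pow_mul, ← pow_mul, mul_comm r m]
        gcongr
        exact le_self_pow₀ hm (by omega)
    _ ≤ _ := Real.sum_le_exp_of_nonneg (by positivity) N

lemma we_sum_le (r c N : ℕ) (hr : 1 ≤ r) (z : ℝ) (hz : 0 ≤ z) :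
    ∑ n ∈ range N, we r c n * z ^ n ≤ Real.exp (∑ i ∈ range c, z ^ (i+1) / ((i+1 : ℕ):ℝ) ^ r) := by
  induction c with
  | zero =>
    simp [we, wE, PowerSeries.coeff_one]
    split_ifs <;> simp
  | succ c ih =>
    rw [Finset.sum_range_succ, Real.exp_add]
    calc _ ≤ (∑ n ∈ range N, we r c n * z ^ n) * (∑ j ∈ range N, wg r (c+1) j * z ^ j) := by
          rw [Finset.sum_mul_sum]
          simp_rw [we_succ, Finset.sum_mul]
          rw [← Finset.sum_product', Finset.sum_sigma']
          have hI : Set.InjOn (fun x : (Σ _ : ℕ, ℕ × ℕ) => x.2) ((range N).sigma fun n => antidiagonal n) := by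
            rintro ⟨n, a, b⟩ h ⟨n', a', b'⟩ h' heq
            simp at h h' heq ⊢
            refine ⟨by omega, heq.1, heq.2⟩
          have h0 : ∑ x ∈ (range N).sigma fun n => antidiagonal n, we r c x.2.1 * wg r (c+1) x.2.2 * z ^ x.1
             = ∑ x ∈ (range N).sigma fun n => antidiagonal n, we r c x.2.1 * z ^ x.2.1 * (wg r (c+1) x.2.2 * z ^ x.2.2) := by
            apply Finset.sum_congr rfl
            rintro ⟨n, a, b⟩ h
            simp only [mem_sigma, mem_range, Finset.HasAntidiagonal.mem_antidiagonal] at h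
            obtain ⟨h, rfl⟩ := h
            simp only
            rw [pow_add]; ring
          rw [h0, ← Finset.sum_image (f := fun x : ℕ × ℕ => we r c x.1 * z ^ x.1 * (wg r (c+1) x.2 * z ^ x.2)) hI]
          apply Finset.sum_le_sum_of_subset_of_nonneg
          · rintro ⟨a, b⟩ h
            simp at h ⊢; omega
          · intro i _ _
            have := we_nonneg r c i.1
            have := wg_nonneg r (c+1) i.2
            positivity
      _ ≤ _ := mul_le_mul ih (wg_sum_le r (c+1) N (Nat.succ_pos c) hr z hz)
            (Finset.sum_nonneg fun i _ => mul_nonneg (wg_nonneg _ _ _) (by positivity)) (Real.exp_nonneg _)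

end

section
open Finset

lemma inv_sq_tail (r s c : ℕ) (hr : 2 ≤ r) (hs : 1 ≤ s) (hc : s ≤ c) :
    ∑ i ∈ Ico s c, (((i + 1 : ℕ):ℝ)^r)⁻¹ ≤ 1 / s - 1 / c := by
  induction c, hc using Nat.le_induction with
  | base => simp
  | succ c hc ih =>
    rw [Finset.sum_Ico_succ_top hc]
    have hc1 : (1:ℝ) ≤ c := by exact_mod_cast hs.trans hc
    have h1 : (((c + 1 : ℕ):ℝ)^r)⁻¹ ≤ (((c + 1 : ℕ):ℝ)^2)⁻¹ := by
      apply inv_anti₀ (by positivity)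
      apply pow_le_pow_right₀ (by push_cast; linarith) hr
    have h2 : (((c + 1 : ℕ):ℝ)^2)⁻¹ ≤ 1 / c - 1 / ((c+1:ℕ):ℝ) := by
      push_cast
      rw [div_sub_div _ _ (by positivity) (by positivity), inv_eq_one_div, div_le_div_iff₀ (by positivity) (by positivity)]
      nlinarith
    linarith

lemma inv_sq_tail' (r s c : ℕ) (hr : 2 ≤ r) (hs : 1 ≤ s) (hc : s ≤ c) :
    ∑ i ∈ Ico s c, (((i + 1 : ℕ):ℝ)^r)⁻¹ ≤ 1 / s := by
  have := inv_sq_tail r s c hr hs hc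
  have : (0:ℝ) ≤ 1 / c := by positivity
  linarith

lemma inv_sq_sum (r c : ℕ) (hr : 2 ≤ r) :
    ∑ i ∈ range c, (((i + 1 : ℕ):ℝ)^r)⁻¹ ≤ 2 := by
  rcases Nat.eq_zero_or_pos c with rfl | hc
  · simp
  rw [Finset.range_eq_Ico, Finset.sum_eq_sum_Ico_succ_bot hc]
  have := inv_sq_tail' r 1 c hr le_rfl hc
  norm_num at this ⊢
  linarith

lemma we_summable (r : ℕ) (hr : 2 ≤ r) : Summable (fun n => we r n n) := by
  apply summable_of_sum_range_le (c := Real.exp 2) (fun n => we_nonneg _ _ _)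
  intro N
  calc _ = ∑ n ∈ range N, we r N n * 1 ^ n := by
        apply Finset.sum_congr rfl
        intro n hn
        rw [we_stable r N n (by simp at hn; omega)]; simp
    _ ≤ _ := we_sum_le r N N (by omega) 1 zero_le_one
    _ ≤ _ := by
        apply Real.exp_le_exp.2
        simpa using inv_sq_sum r N hr

lemma we_rankin (r s n : ℕ) (hr : 2 ≤ r) (hs : 1 ≤ s) : we r s n ≤ Real.exp (6 - n / s) := by
  have hs' : (1:ℝ) ≤ s := by exact_mod_cast hs
  have h := we_sum_le r s (n+1) (by omega) (Real.exp (1 / s)) (Real.exp_nonneg _)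
  have h1 : we r s n * Real.exp (1/s) ^ n ≤ ∑ n ∈ range (n+1), we r s n * Real.exp (1/s) ^ n :=
    Finset.single_le_sum (f := fun n => we r s n * Real.exp (1/s) ^ n) (fun i _ => mul_nonneg (we_nonneg _ _ _) (by positivity)) (by simp)
  have h2 : ∑ i ∈ range s, Real.exp (1/s) ^ (i+1) / ((i+1 : ℕ):ℝ) ^ r ≤ 6 := by
    calc _ ≤ ∑ i ∈ range s, 3 * (((i+1 : ℕ):ℝ) ^ r)⁻¹ := by
          apply Finset.sum_le_sum
          intro i hi
          rw [div_eq_mul_inv]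
          gcongr
          rw [← Real.exp_nat_mul]
          refine (Real.exp_le_exp.2 (?_ : _ ≤ (1:ℝ))).trans (Real.exp_one_lt_d9.le.trans (by norm_num))
          rw [mul_one_div, div_le_one (by positivity)]
          have : i + 1 ≤ s := by simpa using hi
          exact_mod_cast this
      _ ≤ 6 := by
          rw [← Finset.mul_sum]
          have := inv_sq_sum r s hr
          linarith
  have h3 : we r s n * Real.exp (1/s) ^ n ≤ Real.exp 6 := h1.trans (h.trans (Real.exp_le_exp.2 h2))
  rw [Real.exp_sub, le_div_iff₀ (Real.exp_pos _)]
  rwa [← Real.exp_nat_mul, mul_one_div] at h3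

lemma we_T1 (r s c n : ℕ) (hs : s ≤ c) (hc : c ≤ n) :
    we r c n ≤ we r s n + ∑ i ∈ Ico s c, (((i + 1 : ℕ):ℝ)^r)⁻¹ * we r (n - (i+1)) (n - (i+1)) := by
  induction c, hs using Nat.le_induction with
  | base => simp
  | succ c hsc ih =>
    rw [Finset.sum_Ico_succ_top hsc]
    have := we_diff_le r c n hc
    have := ih (by omega)
    linarith

lemma we_T2 (r s c n : ℕ) (hs : s ≤ c) (hc : c ≤ n) (h2 : n < 2 * (s+1)) :
    we r c n = we r s n + ∑ i ∈ Ico s c, (((i + 1 : ℕ):ℝ)^r)⁻¹ * we r (n - (i+1)) (n - (i+1)) := by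
  induction c, hs using Nat.le_induction with
  | base => simp
  | succ c hsc ih =>
    rw [Finset.sum_Ico_succ_top hsc]
    have := we_diff_eq r c n hc (by omega)
    have := ih (by omega)
    linarith

lemma we_T3 (r n : ℕ) :
    we r n n = we r (n/2) n + ∑ m ∈ range (n - n/2), (((n - m : ℕ):ℝ)^r)⁻¹ * we r m m := by
  rw [we_T2 r (n/2) n n (by omega) le_rfl (by omega)]
  congr 1
  refine Finset.sum_nbij' (fun i => n - (i+1)) (fun m => n - (m+1)) ?_ ?_ ?_ ?_ ?_
  · intro a ha; simp at ha ⊢; omega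
  · intro a ha; simp at ha ⊢; omega
  · intro a ha; simp at ha ⊢; omega
  · intro a ha; simp at ha ⊢; omega
  · intro a ha
    simp only [mem_Ico] at ha
    rw [show n - (n - (a+1)) = a + 1 by omega]

lemma we_small_tendsto (r : ℕ) : Filter.Tendsto (fun n : ℕ => (n:ℝ)^r * Real.exp (6 - n / (Nat.sqrt n : ℝ)))
    Filter.atTop (nhds 0) := by
  have h0 : Filter.Tendsto (fun n : ℕ => ((Nat.sqrt n + 1 : ℕ) : ℝ)) Filter.atTop Filter.atTop := by
    refine tendsto_natCast_atTop_atTop.comp (Filter.tendsto_atTop_atTop.2 fun b => ⟨b*b, fun a ha => ?_⟩)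
    have := Nat.le_sqrt.2 ha
    omega
  have h1 := ((Real.tendsto_pow_mul_exp_neg_atTop_nhds_zero (2*r)).comp h0).const_mul (Real.exp 7)
  rw [mul_zero] at h1
  refine squeeze_zero' (Filter.Eventually.of_forall fun n => by positivity) ?_ h1
  filter_upwards [Filter.eventually_ge_atTop 1] with n hn
  simp only [Function.comp]
  have hs : 1 ≤ Nat.sqrt n := Nat.le_sqrt.2 (by simpa using hn)
  have a1 : (n:ℝ) ≤ ((Nat.sqrt n + 1 : ℕ) : ℝ)^2 := by
    have := Nat.lt_succ_sqrt n
    have : n ≤ (Nat.sqrt n + 1)^2 := by rw [pow_two]; exact this.le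
    exact_mod_cast this
  have a2 : (Nat.sqrt n : ℝ) ≤ n / (Nat.sqrt n : ℝ) := by
    rw [le_div_iff₀ (by positivity)]
    exact_mod_cast Nat.sqrt_le n
  have a3 : Real.exp (6 - n / (Nat.sqrt n : ℝ)) ≤ Real.exp 7 * Real.exp (-((Nat.sqrt n + 1 : ℕ) : ℝ)) := by
    rw [← Real.exp_add]
    apply Real.exp_le_exp.2
    push_cast
    linarith
  calc (n:ℝ)^r * Real.exp (6 - n / (Nat.sqrt n : ℝ)) ≤ (((Nat.sqrt n + 1 : ℕ) : ℝ)^2)^r * (Real.exp 7 * Real.exp (-((Nat.sqrt n + 1 : ℕ) : ℝ))) := by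
        gcongr
    _ = _ := by rw [← pow_mul]; ring

lemma we_half (r n : ℕ) (hr : 2 ≤ r) (hn : 4 ≤ n) (B : ℝ) (hB0 : 0 ≤ B) (hB : ∀ m < n, (m:ℝ)^r * we r m m ≤ B) :
    (n:ℝ)^r * we r (n/2) n ≤ (n:ℝ)^r * Real.exp (6 - n / (Nat.sqrt n : ℝ)) + B * 2^r / (Nat.sqrt n : ℝ) := by
  have hs : 2 ≤ Nat.sqrt n := Nat.le_sqrt.2 (by omega)
  have hsh : Nat.sqrt n ≤ n / 2 := by
    rw [Nat.le_div_iff_mul_le (by norm_num)]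
    calc _ ≤ Nat.sqrt n * Nat.sqrt n := by gcongr
      _ ≤ n := Nat.sqrt_le n
  have h1 := we_T1 r (Nat.sqrt n) (n/2) n hsh (by omega)
  have h2 := we_rankin r (Nat.sqrt n) n hr (by omega)
  have hn0 : (0:ℝ) < (n:ℝ)^r := by positivity
  have h3 : (n:ℝ)^r * ∑ i ∈ Ico (Nat.sqrt n) (n/2), (((i + 1 : ℕ):ℝ)^r)⁻¹ * we r (n - (i+1)) (n - (i+1)) ≤ B * 2^r / (Nat.sqrt n : ℝ) := by
    calc _ ≤ ∑ i ∈ Ico (Nat.sqrt n) (n/2), (B * 2^r) * (((i + 1 : ℕ):ℝ)^r)⁻¹ := by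
          rw [Finset.mul_sum]
          apply Finset.sum_le_sum
          intro i hi
          simp only [mem_Ico] at hi
          have b1 := hB (n - (i+1)) (by omega)
          have b2 : (n:ℝ) ≤ 2 * ((n - (i+1) : ℕ):ℝ) := by
            have : n ≤ 2 * (n - (i+1)) := by omega
            exact_mod_cast this
          have b3 : (n:ℝ)^r * we r (n - (i+1)) (n - (i+1)) ≤ B * 2^r := by
            calc _ ≤ (2 * ((n - (i+1) : ℕ):ℝ))^r * we r (n - (i+1)) (n - (i+1)) := by
                  gcongr
                  exact we_nonneg _ _ _
              _ = 2^r * ((((n - (i+1) : ℕ):ℝ))^r * we r (n - (i+1)) (n - (i+1))) := by rw [mul_pow]; ring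
              _ ≤ 2^r * B := by gcongr
              _ = _ := mul_comm _ _
          have b4 : (0:ℝ) ≤ (((i + 1 : ℕ):ℝ)^r)⁻¹ := by positivity
          nlinarith [mul_le_mul_of_nonneg_right b3 b4]
      _ ≤ (B * 2^r) * (1 / (Nat.sqrt n : ℝ)) := by
          rw [← Finset.mul_sum]
          gcongr
          exact inv_sq_tail' r _ _ hr (by omega) hsh
      _ = _ := by ring
  have h4 := mul_le_mul_of_nonneg_left (h1.trans (add_le_add_left h2 _)) hn0.le
  rw [mul_add] at h4
  linarith

/-- main term -/
noncomputable def wmain (r n m : ℕ) : ℝ := if m < n - n/2 then (n:ℝ)^r * ((((n - m : ℕ):ℝ)^r)⁻¹ * we r m m) else 0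

lemma wmain_nonneg (r n m : ℕ) : 0 ≤ wmain r n m := by
  unfold wmain
  have := we_nonneg r m m
  split_ifs <;> positivity

lemma wmain_le (r n m : ℕ) : wmain r n m ≤ 2^r * we r m m := by
  have hw := we_nonneg r m m
  unfold wmain
  split_ifs with h
  · have h1 : (n:ℝ) ≤ 2 * ((n - m : ℕ):ℝ) := by
      have : n ≤ 2 * (n - m) := by omega
      exact_mod_cast this
    have h2 : (0:ℝ) < ((n - m : ℕ):ℝ) := by
      have : 0 < n - m := by omega
      exact_mod_cast this
    rw [← mul_assoc]
    gcongr
    rw [← div_eq_mul_inv, div_le_iff₀ (by positivity), ← mul_pow]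
    gcongr
  · positivity

lemma we_main (r n : ℕ) : (n:ℝ)^r * we r n n = (n:ℝ)^r * we r (n/2) n + ∑' m, wmain r n m := by
  rw [tsum_eq_sum (s := range (n - n/2))]
  · conv_lhs => rw [we_T3, mul_add, Finset.mul_sum]
    congr 1
    apply Finset.sum_congr rfl
    intro m hm
    rw [wmain, if_pos (by simpa using hm)]
  · intro m hm
    rw [wmain, if_neg (by simpa using hm)]

lemma wmain_tsum_le (r n : ℕ) (hr : 2 ≤ r) : ∑' m, wmain r n m ≤ 2^r * ∑' m, we r m m := by
  rw [← tsum_mul_left]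
  exact Summable.tsum_le_tsum (fun m => wmain_le r n m)
    (Summable.of_nonneg_of_le (fun m => wmain_nonneg r n m) (fun m => wmain_le r n m) ((we_summable r hr).mul_left _))
    ((we_summable r hr).mul_left _)

lemma sqrt_inv_tendsto (K : ℝ) : Filter.Tendsto (fun n : ℕ => K / (Nat.sqrt n : ℝ)) Filter.atTop (nhds 0) := by
  refine Filter.Tendsto.div_atTop tendsto_const_nhds ?_
  refine tendsto_natCast_atTop_atTop.comp (Filter.tendsto_atTop_atTop.2 fun b => ⟨b*b, fun a ha => ?_⟩)
  exact Nat.le_sqrt.2 ha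

lemma we_bounded (r : ℕ) (hr : 2 ≤ r) : ∃ B : ℝ, 0 ≤ B ∧ ∀ n : ℕ, (n:ℝ)^r * we r n n ≤ B := by
  have e1 := (we_small_tendsto r).eventually (gt_mem_nhds (zero_lt_one))
  have e2 := (sqrt_inv_tendsto (2^r)).eventually (gt_mem_nhds (show (0:ℝ) < 1/2 by norm_num))
  obtain ⟨n0, hn0⟩ := Filter.eventually_atTop.1 (e1.and (e2.and (Filter.eventually_ge_atTop 4)))
  set A := ∑' m, we r m m with hA
  have hA0 : 0 ≤ A := tsum_nonneg fun m => we_nonneg _ _ _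
  have hS0 : ∀ n : ℕ, 0 ≤ (n:ℝ)^r * we r n n := fun n => mul_nonneg (by positivity) (we_nonneg _ _ _)
  have hS : 0 ≤ ∑ n ∈ range n0, (n:ℝ)^r * we r n n := Finset.sum_nonneg fun n _ => hS0 n
  refine ⟨∑ n ∈ range n0, (n:ℝ)^r * we r n n + 2 * (1 + 2^r * A), by positivity, ?_⟩
  intro n
  induction n using Nat.strong_induction_on with
  | _ n ih =>
    set B := ∑ n ∈ range n0, (n:ℝ)^r * we r n n + 2 * (1 + 2^r * A) with hB
    have hB0 : 0 ≤ B := by positivity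
    rcases lt_or_ge n n0 with h | h
    · have := Finset.single_le_sum (f := fun n : ℕ => (n:ℝ)^r * we r n n) (fun i _ => hS0 i) (mem_range.2 h)
      have : 0 ≤ 2 * (1 + 2^r * A) := by positivity
      linarith
    · obtain ⟨a1, a2, a3⟩ := hn0 n h
      have h1 := we_half r n hr a3 B hB0 ih
      have h2 := wmain_tsum_le r n hr
      rw [we_main]
      have h3 : B * 2^r / (Nat.sqrt n : ℝ) ≤ B * (1/2) := by
        rw [mul_div_assoc]; gcongr
      have h4 : B ≥ 2 * (1 + 2^r * A) := by rw [hB]; linarith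
      linarith

lemma we_tendsto (r : ℕ) (hr : 2 ≤ r) :
    Filter.Tendsto (fun n : ℕ => (n:ℝ)^r * we r n n) Filter.atTop (nhds (∑' m, we r m m)) := by
  obtain ⟨B, hB0, hB⟩ := we_bounded r hr
  have h1 : Filter.Tendsto (fun n : ℕ => (n:ℝ)^r * we r (n/2) n) Filter.atTop (nhds 0) := by
    have := (we_small_tendsto r).add (sqrt_inv_tendsto (B * 2^r))
    rw [add_zero] at this
    refine squeeze_zero' (Filter.Eventually.of_forall fun n => mul_nonneg (by positivity) (we_nonneg _ _ _)) ?_ this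
    filter_upwards [Filter.eventually_ge_atTop 4] with n hn
    exact we_half r n hr hn B hB0 (fun m _ => hB m)
  have h2 : Filter.Tendsto (fun n : ℕ => ∑' m, wmain r n m) Filter.atTop (nhds (∑' m, we r m m)) := by
    refine tendsto_tsum_of_dominated_convergence (bound := fun m => 2^r * we r m m) ((we_summable r hr).mul_left _) ?_ ?_
    · intro m
      have h3 : Filter.Tendsto (fun n : ℕ => ((n:ℝ) / ((n - m : ℕ):ℝ))^r * we r m m) Filter.atTop (nhds (1^r * we r m m)) := by
        refine Filter.Tendsto.mul_const _ (Filter.Tendsto.pow ?_ r)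
        rw [← Filter.tendsto_add_atTop_iff_nat m]
        have : Filter.Tendsto (fun n : ℕ => 1 + (m:ℝ) / (n:ℝ)) Filter.atTop (nhds (1 + 0)) :=
          (tendsto_const_nhds).add (tendsto_const_div_atTop_nhds_zero_nat _)
        rw [add_zero] at this
        refine this.congr' ?_
        filter_upwards [Filter.eventually_ge_atTop 1] with n hn
        have : (n:ℝ) ≠ 0 := by positivity
        rw [show n + m - m = n by omega]
        push_cast
        field_simp
      rw [one_pow, one_mul] at h3
      refine h3.congr' ?_
      filter_upwards [Filter.eventually_ge_atTop (2*m+2)] with n hn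
      rw [wmain, if_pos (by omega), div_pow, div_eq_mul_inv, mul_assoc]
    · refine Filter.Eventually.of_forall fun n m => ?_
      rw [Real.norm_eq_abs, abs_of_nonneg (wmain_nonneg _ _ _)]
      exact wmain_le r n m
  have := h1.add h2
  rw [zero_add] at this
  exact this.congr fun n => (we_main r n).symm

theorem W_tendsto (r : ℕ) (hr : 2 ≤ r) :
    Filter.Tendsto (fun n : ℕ => (n:ℝ)^r * W r n) Filter.atTop (nhds (∑' m, W r m)) := by
  have : ∀ n, W r n = we r n n := fun n => W_eq_we r n (by omega)
  simp_rw [this]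
  exact we_tendsto r hr

end

section
open Finset

/-- `Mc G q σ`: functions compatible with the permutation and trivial on fixed points -/
def McSet {α : Type*} (G : Type*) [CommGroup G] (q : ℕ) (σ : Equiv.Perm α) : Set (α → G) :=
  {u | (∀ x, u (σ x) = u x ^ q) ∧ ∀ x, σ x = x → u x = 1}

lemma u_pow {α : Type*} {G : Type*} [CommGroup G] {q : ℕ} {σ : Equiv.Perm α} {u : α → G}
    (h : ∀ x, u (σ x) = u x ^ q) (i : ℕ) (x : α) : u ((σ ^ i) x) = u x ^ (q ^ i) := by
  induction i with
  | zero => simp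
  | succ i ih => rw [pow_succ', Equiv.Perm.mul_apply, h, ih, ← pow_mul, pow_succ]

lemma Mc_cycle {α : Type*} [Fintype α] [DecidableEq α] {G : Type*} [CommGroup G] (q : ℕ)
    (hG : ∀ c : ℕ, 1 ≤ c → Nat.card {z : G // z ^ (q ^ c) = z} = q ^ c - 1)
    (σ : Equiv.Perm α) (hσ : σ.IsCycle) :
    Nat.card (McSet G q σ) = q ^ (#σ.support) - 1 := by
  obtain ⟨x, hx, hx'⟩ := id hσ
  have hc1 : 1 ≤ #σ.support := by
    have := hσ.two_le_card_support; omega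
  rw [← hG _ hc1]
  have hord : (σ ^ (#σ.support)) = 1 := by rw [← hσ.orderOf, pow_orderOf_eq_one]
  apply Nat.card_congr
  refine Equiv.ofBijective (fun u => ⟨u.1 x, ?_⟩) ⟨?_, ?_⟩
  · rw [← u_pow u.2.1, hord]; rfl
  · rintro ⟨u, hu⟩ ⟨v, hv⟩ huv
    have huv : u x = v x := by simpa using huv
    apply Subtype.ext
    funext y
    by_cases hy : σ y = y
    · change u y = v y
      rw [hu.2 y hy, hv.2 y hy]
    · obtain ⟨i, rfl⟩ := hσ.exists_pow_eq hx hy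
      change u _ = v _
      rw [u_pow hu.1, u_pow hv.1, huv]
  · rintro ⟨z, hz⟩
    have key : ∀ i j : ℕ, (σ ^ i) x = (σ ^ j) x → z ^ (q ^ i) = z ^ (q ^ j) := by
      have hmod : ∀ i, z ^ (q ^ i) = z ^ (q ^ (i % #σ.support)) := by
        intro i
        have hz' : ∀ m, z ^ (q ^ (#σ.support * m)) = z := by
          intro m
          induction m with
          | zero => simp
          | succ m ih => rw [Nat.mul_succ, pow_add, pow_mul, ih, hz]
        conv_lhs => rw [← Nat.div_add_mod i (#σ.support), pow_add, pow_mul, hz']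
      intro i j hij
      have : σ ^ i = σ ^ j := hσ.pow_eq_pow_iff.2 ⟨x, hx, hij⟩
      rw [pow_eq_pow_iff_modEq, hσ.orderOf] at this
      rw [hmod i, hmod j, this]
    have hex : ∀ y, σ y ≠ y → ∃ i : ℕ, (σ ^ i) x = y := fun y hy => hσ.exists_pow_eq hx hy
    classical
    let u : α → G := fun y => if h : σ y ≠ y then z ^ (q ^ (hex y h).choose) else 1
    have hu : ∀ i : ℕ, u ((σ ^ i) x) = z ^ (q ^ i) := by
      intro i
      have h : σ ((σ ^ i) x) ≠ (σ ^ i) x := by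
        rw [← Equiv.Perm.mul_apply, ← pow_succ', pow_succ, Equiv.Perm.mul_apply]
        intro h; exact hx ((σ ^ i).injective h)
      simp only [u]
      rw [dif_pos h]
      exact key _ _ (hex _ h).choose_spec
    refine ⟨⟨u, ⟨?_, ?_⟩⟩, ?_⟩
    · intro y
      by_cases hy : σ y = y
      · rw [hy]
        simp [u, hy]
      · obtain ⟨i, rfl⟩ := hex y hy
        rw [← Equiv.Perm.mul_apply, ← pow_succ', hu, hu, pow_succ, pow_mul]
    · intro y hy
      simp [u, hy]
    · apply Subtype.ext
      simpa using hu 0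

lemma Mc_mul {α : Type*} [Fintype α] [DecidableEq α] {G : Type*} [CommGroup G] (q : ℕ)
    (σ τ : Equiv.Perm α) (h : σ.Disjoint τ) :
    Nat.card (McSet G q (σ * τ)) = Nat.card (McSet G q σ) * Nat.card (McSet G q τ) := by
  rw [← Nat.card_prod]
  have hst : ∀ x, τ x ≠ x → σ x = x := fun x hx => (h x).resolve_right hx
  have hts : ∀ x, σ x ≠ x → τ x = x := fun x hx => (h x).resolve_left hx
  have hs2 : ∀ x, σ x ≠ x → σ (σ x) ≠ σ x := fun x hx h' => hx (σ.injective h')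
  have ht2 : ∀ x, τ x ≠ x → τ (τ x) ≠ τ x := fun x hx h' => hx (τ.injective h')
  apply Nat.card_congr
  refine
    { toFun := fun u => (⟨fun x => if σ x = x then 1 else u.1 x, ?_, ?_⟩, ⟨fun x => if τ x = x then 1 else u.1 x, ?_, ?_⟩)
      invFun := fun uv => ⟨fun x => uv.1.1 x * uv.2.1 x, ?_, ?_⟩
      left_inv := ?_
      right_inv := ?_ }
  · intro x
    by_cases hx : σ x = x
    · simp [hx]
    · simp only [hs2 x hx, hx, if_false]
      have := u.2.1 x
      rwa [Equiv.Perm.mul_apply, hts x hx] at this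
  · intro x hx; simp [hx]
  · intro x
    by_cases hx : τ x = x
    · simp [hx]
    · simp only [ht2 x hx, hx, if_false]
      have := u.2.1 x
      rwa [Equiv.Perm.mul_apply, hst _ (ht2 x hx)] at this
  · intro x hx; simp [hx]
  · intro x
    obtain ⟨⟨u, hu⟩, ⟨v, hv⟩⟩ := uv
    simp only [Equiv.Perm.mul_apply]
    by_cases hx : τ x = x
    · rw [hx, hu.1 x, hv.2 x hx, mul_one]
      by_cases hx2 : σ x = x
      · rw [hx2, hv.2 x hx, mul_one]
      · rw [hv.2 _ (hts _ (hs2 x hx2)), mul_one]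
    · rw [hst _ (ht2 x hx), hv.1 x, hu.2 x (hst x hx), hu.2 (τ x) (hst _ (ht2 x hx)), one_mul, one_mul]
  · intro x hx
    obtain ⟨⟨u, hu⟩, ⟨v, hv⟩⟩ := uv
    simp only [Equiv.Perm.mul_apply] at hx ⊢
    have h1 : τ x = x := by
      by_contra hne
      rw [hst _ (ht2 x hne)] at hx
      exact hne hx
    rw [h1] at hx
    rw [hu.2 x hx, hv.2 x h1, one_mul]
  · rintro ⟨u, hu⟩
    apply Subtype.ext
    funext x
    simp only
    by_cases h1 : σ x = x <;> by_cases h2 : τ x = x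
    · simp only [h1, h2, if_true]
      rw [hu.2 x (by rw [Equiv.Perm.mul_apply, h2, h1]), one_mul]
    · simp [h1, h2]
    · simp [h1, h2]
    · exact absurd (hst x h2) h1
  · rintro ⟨⟨u, hu⟩, ⟨v, hv⟩⟩
    refine Prod.ext (Subtype.ext ?_) (Subtype.ext ?_) <;> funext x <;> simp only
    · by_cases h1 : σ x = x
      · simp [h1, hu.2 x h1]
      · simp [h1, hv.2 x (hts x h1)]
    · by_cases h1 : τ x = x
      · simp [h1, hv.2 x h1]
      · simp [h1, hu.2 x (hst x h1)]

lemma Mc_card {α : Type*} [Fintype α] [DecidableEq α] {G : Type*} [CommGroup G] (q : ℕ)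
    (hG : ∀ c : ℕ, 1 ≤ c → Nat.card {z : G // z ^ (q ^ c) = z} = q ^ c - 1)
    (σ : Equiv.Perm α) :
    Nat.card (McSet G q σ) = (σ.cycleType.map fun c => q ^ c - 1).prod := by
  induction σ using Equiv.Perm.cycle_induction_on with
  | base_one =>
    simp only [Equiv.Perm.cycleType_one, Multiset.map_zero, Multiset.prod_zero]
    rw [Nat.card_eq_one_iff_unique]
    refine ⟨⟨?_⟩, ⟨⟨fun _ => 1, by simp, by simp⟩⟩⟩
    rintro ⟨u, hu⟩ ⟨v, hv⟩
    apply Subtype.ext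
    funext x
    change u x = v x
    rw [hu.2 x rfl, hv.2 x rfl]
  | base_cycles σ hσ =>
    rw [hσ.cycleType, Mc_cycle q hG σ hσ]; simp
  | induction_disjoint σ τ h hσ h1 h2 =>
    rw [Mc_mul q σ τ h, h.cycleType_mul, Multiset.map_add, Multiset.prod_add, h1, h2]

lemma Nc_card {n : ℕ} {G : Type*} [CommGroup G] (q : ℕ)
    (hG : ∀ c : ℕ, 1 ≤ c → Nat.card {z : G // z ^ (q ^ c) = z} = q ^ c - 1)
    (σ : Equiv.Perm (Fin n)) :
    Nat.card {u : Fin n → G // ∀ x, u (σ x) = u x ^ q} = ((cycleStruct σ).map fun c => q ^ c - 1).prod := by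
  classical
  rw [cycleStruct, Multiset.map_add, Multiset.prod_add, ← Mc_card q hG σ]
  have h1 : (Multiset.map (fun c => q ^ c - 1) (Multiset.replicate (n - σ.cycleType.sum) 1)).prod
     = Nat.card ({x // σ x = x} → {z : G // z ^ (q ^ 1) = z}) := by
    rw [Nat.card_fun, hG 1 le_rfl]
    simp only [Multiset.map_replicate, Multiset.prod_replicate]
    congr 1
    rw [Equiv.Perm.sum_cycleType, Nat.card_eq_fintype_card]
    have := Equiv.Perm.card_fixedPoints σ
    rw [Fintype.card_fin, Equiv.Perm.sum_cycleType] at this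
    rw [← this]
    exact Fintype.card_congr (Equiv.refl _)
  rw [h1, ← Nat.card_prod]
  apply Nat.card_congr
  refine
    { toFun := fun u => (⟨fun x => if σ x = x then 1 else u.1 x, ?_, ?_⟩, fun x => ⟨u.1 x.1, ?_⟩)
      invFun := fun uv => ⟨fun x => if h : σ x = x then uv.2 ⟨x, h⟩ else uv.1.1 x, ?_⟩
      left_inv := ?_
      right_inv := ?_ }
  · intro x
    by_cases hx : σ x = x
    · simp [hx]
    · have : σ (σ x) ≠ σ x := fun h' => hx (σ.injective h')
      simp only [this, hx, if_false]
      exact u.2 x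
  · intro x hx; simp [hx]
  · rw [pow_one]
    have := u.2 x.1
    rw [x.2] at this
    exact this.symm
  · intro x
    by_cases hx : σ x = x
    · simp only [hx, dif_pos]
      have h3 : ∀ w : {z : G // z ^ (q ^ 1) = z}, w.1 = w.1 ^ q := by
        rintro ⟨z, hz⟩
        rw [pow_one] at hz
        exact hz.symm
      exact h3 _
    · have : σ (σ x) ≠ σ x := fun h' => hx (σ.injective h')
      simp only [this, hx, dif_neg, not_false_eq_true]
      exact uv.1.2.1 x
  · rintro ⟨u, hu⟩
    apply Subtype.ext
    funext x
    by_cases hx : σ x = x <;> simp [hx]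
  · rintro ⟨⟨u, hu⟩, v⟩
    refine Prod.ext (Subtype.ext ?_) ?_
    · funext x
      by_cases hx : σ x = x
      · simp [hx, hu.2 x hx]
      · simp [hx]
    · funext x
      apply Subtype.ext
      simp [x.2]

end

section
open Finset Polynomial

/-- the roots of `g` are distinct and Frobenius permutes them according to `σ` -/
def FrobPerm {F : Type*} (k : Type*) [Field F] [Fintype F] [Field k] [Algebra F k] (g : F[X]) {n : ℕ}
    (σ : Equiv.Perm (Fin n)) : Prop :=
  ∃ ρ : Fin n → k, Function.Injective ρ ∧ g.map (algebraMap F k) = ∏ j, (X - C (ρ j)) ∧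
    ∀ j, ρ j ^ Fintype.card F = ρ (σ j)

section
variable {F k : Type*} [Field F] [Fintype F] [Field k] [Algebra F k]

lemma mem_range_of_pow_card (x : k) (hx : x ^ Fintype.card F = x) : ∃ y : F, algebraMap F k y = x := by
  have h := FiniteField.roots_X_pow_card_sub_X F
  have hs : (X ^ Fintype.card F - X : F[X]) ≠ 0 := FiniteField.X_pow_card_sub_X_ne_zero F Fintype.one_lt_card
  have hd : (X ^ Fintype.card F - X : F[X]).natDegree = Fintype.card F :=
    FiniteField.X_pow_card_sub_X_natDegree_eq F Fintype.one_lt_card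
  have hm : (X ^ Fintype.card F - X : F[X]).Monic := by
    apply Polynomial.monic_X_pow_sub
    rw [degree_X]
    exact_mod_cast Fintype.one_lt_card
  have hp : ∏ a : F, (X - C a) = X ^ Fintype.card F - X := by
    have := Polynomial.prod_multiset_X_sub_C_of_monic_of_roots_card_eq hm (by rw [h, hd]; rfl)
    rw [h] at this
    exact this
  have h2 : ∏ a : F, (x - algebraMap F k a) = 0 := by
    have := congrArg (fun p => aeval x p) hp
    simp only [map_prod, map_sub, aeval_X, aeval_C, map_pow] at this
    rw [this, hx, sub_self]
  obtain ⟨a, _, ha⟩ := Finset.prod_eq_zero_iff.1 h2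
  exact ⟨a, (sub_eq_zero.1 ha).symm⟩

lemma aeval_pow_card' (x : k) (f : F[X]) : aeval (x ^ Fintype.card F) f = (aeval x f) ^ Fintype.card F := by
  rw [← map_pow, ← FiniteField.expand_card, expand_aeval]

lemma charP_aux : ∃ p a : ℕ, p.Prime ∧ CharP k p ∧ CharP F p ∧ 0 < a ∧ Fintype.card F = p ^ a := by
  obtain ⟨p, hp⟩ := CharP.exists F
  obtain ⟨a, hp', hc⟩ := FiniteField.card F p
  exact ⟨p, a, hp', charP_of_injective_algebraMap (algebraMap F k).injective p, hp, a.2, hc⟩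

/-- Frobenius ring hom -/
noncomputable def frobq (F k : Type*) [Field F] [Fintype F] [Field k] [Algebra F k] : k →+* k :=
  (FiniteField.frobeniusAlgHom F k).toRingHom

lemma frobq_apply (x : k) : frobq F k x = x ^ Fintype.card F := rfl

/-- interpolation -/
lemma interp_exists {n : ℕ} (σ : Equiv.Perm (Fin n)) (ρ : Fin n → k) (hρ : Function.Injective ρ)
    (hσ : ∀ j, ρ j ^ Fintype.card F = ρ (σ j)) (u : Fin n → k) (hu : ∀ j, u (σ j) = u j ^ Fintype.card F) :
    ∃ f : F[X], ∀ j, aeval (ρ j) f = u j := by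
  classical
  set h := Lagrange.interpolate univ ρ u with hh
  have hev : ∀ j, h.eval (ρ j) = u j := fun j => Lagrange.eval_interpolate_at_node u hρ.injOn (mem_univ j)
  have hdeg : h.degree < #(univ : Finset (Fin n)) := Lagrange.degree_interpolate_lt u hρ.injOn
  have hfix : h.map (frobq F k) = h := by
    refine Polynomial.eq_of_degrees_lt_of_eval_index_eq univ hρ.injOn ((degree_map_le).trans_lt hdeg) hdeg ?_
    intro i _
    obtain ⟨j, rfl⟩ := σ.surjective i
    rw [hev, hu, ← hσ, ← frobq_apply (F := F), Polynomial.eval_map_apply, hev, frobq_apply]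
  have hc : ∀ i, ∃ y : F, algebraMap F k y = h.coeff i := by
    intro i
    apply mem_range_of_pow_card
    conv_rhs => rw [← hfix]
    rw [coeff_map, frobq_apply]
  have hl : h ∈ Polynomial.lifts (algebraMap F k) := by
    rw [Polynomial.lifts_iff_coeff_lifts]
    intro i
    obtain ⟨y, hy⟩ := hc i
    exact ⟨y, hy⟩
  obtain ⟨f, hf⟩ := (Polynomial.mem_lifts _).1 hl
  refine ⟨f, fun j => ?_⟩
  rw [← hev j, ← hf, eval_map_algebraMap]

lemma dvd_of_aeval {n : ℕ} (g : F[X]) (ρ : Fin n → k) (hρ : Function.Injective ρ)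
    (hg : g.map (algebraMap F k) = ∏ j, (X - C (ρ j))) (f : F[X]) (hf : ∀ j, aeval (ρ j) f = 0) : g ∣ f := by
  rw [← Polynomial.map_dvd_map' (algebraMap F k), hg]
  apply Finset.prod_dvd_of_coprime
  · intro i _ j _ hij
    exact pairwise_coprime_X_sub_C hρ hij
  · intro j _
    rw [dvd_iff_isRoot, IsRoot.def, eval_map_algebraMap, hf]

lemma phiPoly_eq_card {n : ℕ} (g : F[X]) (σ : Equiv.Perm (Fin n)) (h : FrobPerm k g σ) :
    phiPoly g = Nat.card {u : Fin n → kˣ // ∀ x, u (σ x) = u x ^ Fintype.card F} := by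
  obtain ⟨ρ, hρ, hg, hσ⟩ := h
  have hroot : ∀ j, aeval (ρ j) g = 0 := by
    intro j
    rw [← eval_map_algebraMap, hg, eval_prod]
    exact Finset.prod_eq_zero (mem_univ j) (by simp)
  let ev : Fin n → (F[X] ⧸ Ideal.span {g}) →+* k := fun j =>
    Ideal.Quotient.lift _ (aeval (ρ j)).toRingHom (by
      intro a ha
      obtain ⟨b, rfl⟩ := Ideal.mem_span_singleton'.1 ha
      simp [hroot])
  have hev : ∀ j f, ev j (Ideal.Quotient.mk _ f) = aeval (ρ j) f := fun j f => rfl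
  have hinj : ∀ a b, (∀ j, ev j a = ev j b) → a = b := by
    intro a b hab
    obtain ⟨a, rfl⟩ := Ideal.Quotient.mk_surjective a
    obtain ⟨b, rfl⟩ := Ideal.Quotient.mk_surjective b
    rw [Ideal.Quotient.eq, Ideal.mem_span_singleton]
    apply dvd_of_aeval g ρ hρ hg
    intro j
    rw [map_sub, sub_eq_zero]
    exact hab j
  have hfr : ∀ j a, ev (σ j) a = ev j a ^ Fintype.card F := by
    intro j a
    obtain ⟨a, rfl⟩ := Ideal.Quotient.mk_surjective a
    rw [hev, hev, ← hσ, aeval_pow_card']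
  rw [phiPoly]
  apply Nat.card_congr
  refine Equiv.ofBijective (fun U => ⟨fun j => Units.map (ev j).toMonoidHom U, ?_⟩) ⟨?_, ?_⟩
  · intro j
    ext
    simp [hfr]
  · intro U V hUV
    ext
    apply hinj
    intro j
    have := congrArg (fun w => ((w.1 j : kˣ) : k)) hUV
    simpa using this
  · rintro ⟨u, hu⟩
    obtain ⟨f, hf⟩ := interp_exists σ ρ hρ hσ (fun j => (u j : k)) (fun j => by simp [hu])
    obtain ⟨f', hf'⟩ := interp_exists σ ρ hρ hσ (fun j => ((u j)⁻¹ : kˣ)) (fun j => by simp [hu])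
    have h1 : (Ideal.Quotient.mk (Ideal.span {g}) f) * (Ideal.Quotient.mk _ f') = 1 := by
      apply hinj
      intro j
      rw [map_mul, hev, hev, hf, hf']
      simp
    refine ⟨⟨_, _, h1, by rw [mul_comm]; exact h1⟩, ?_⟩
    apply Subtype.ext
    funext j
    ext
    simp [hev, hf]

lemma card_units_pow [IsAlgClosed k] (c : ℕ) (hc : 1 ≤ c) :
    Nat.card {z : kˣ // z ^ (Fintype.card F ^ c) = z} = Fintype.card F ^ c - 1 := by
  obtain ⟨p, a, hp, hk, _, ha, hq⟩ := charP_aux (F := F) (k := k)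
  have h1 : 1 < Fintype.card F ^ c := Nat.one_lt_pow (by omega) Fintype.one_lt_card
  set m := Fintype.card F ^ c - 1 with hm
  have hm1 : m + 1 = Fintype.card F ^ c := by omega
  have : NeZero (m : k) := by
    constructor
    have h2 : ((m + 1 : ℕ) : k) = 0 := by
      rw [hm1, hq, ← pow_mul]
      push_cast
      rw [CharP.cast_eq_zero, zero_pow (by positivity)]
    intro h0
    push_cast at h2
    rw [h0, zero_add] at h2
    exact one_ne_zero h2
  have hz : NeZero m := ⟨by omega⟩
  rw [← HasEnoughRootsOfUnity.natCard_rootsOfUnity k m]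
  apply Nat.card_congr
  refine Equiv.subtypeEquivRight fun z => ?_
  rw [mem_rootsOfUnity, ← hm1, pow_succ, mul_eq_right]

theorem phiPoly_formula [IsAlgClosed k] {n : ℕ} (g : F[X]) (σ : Equiv.Perm (Fin n)) (h : FrobPerm k g σ) :
    phiPoly g = ((cycleStruct σ).map fun c => Fintype.card F ^ c - 1).prod := by
  rw [phiPoly_eq_card g σ h]
  exact Nc_card (G := kˣ) (Fintype.card F) (fun c hc => card_units_pow (F := F) c hc) σ

end

lemma prodXpow_inj (s t : Multiset ℕ) (hs : ∀ c ∈ s, 0 < c) (ht : ∀ c ∈ t, 0 < c)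
    (h : (s.map fun c => (X ^ c - 1 : ℤ[X])).prod = (t.map fun c => (X ^ c - 1 : ℤ[X])).prod) : s = t := by
  have key : ∀ s t : Multiset ℕ, (∀ c ∈ s, 0 < c) →
      (s.map fun c => (X ^ c - 1 : ℤ[X])).prod = (t.map fun c => (X ^ c - 1 : ℤ[X])).prod →
      ∀ d ∈ s, ∃ c ∈ t, d ∣ c := by
    intro s t hs h d hd
    have hd0 := hs d hd
    have hprim := Complex.isPrimitiveRoot_exp d hd0.ne'
    set ζ := Complex.exp (2 * Real.pi * Complex.I / d)
    have h1 := congrArg (fun p => aeval ζ p) h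
    simp only [map_multiset_prod, Multiset.map_map, Function.comp_def, map_sub, map_pow, aeval_X, map_one] at h1
    have h2 : (s.map fun c => ζ ^ c - 1).prod = 0 := by
      apply Multiset.prod_eq_zero
      rw [Multiset.mem_map]
      exact ⟨d, hd, by rw [hprim.pow_eq_one, sub_self]⟩
    rw [h2] at h1
    obtain ⟨c, hc, hc0⟩ := Multiset.mem_map.1 (Multiset.prod_eq_zero_iff.1 h1.symm)
    exact ⟨c, hc, hprim.dvd_of_pow_eq_one c (sub_eq_zero.1 hc0)⟩
  induction hcard : s.card generalizing s t with
  | zero =>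
    have : s = 0 := Multiset.card_eq_zero.1 hcard
    subst this
    by_contra hne
    obtain ⟨c, hc⟩ := Multiset.exists_mem_of_ne_zero (Ne.symm hne)
    obtain ⟨d, hd, _⟩ := key t 0 ht h.symm c hc
    simp at hd
  | succ m ih =>
    have hne : s ≠ 0 := by rintro rfl; simp at hcard
    obtain ⟨d, hd, hdmax⟩ : ∃ d ∈ s, ∀ c ∈ s, c ≤ d := by
      have hne' : s.toFinset.Nonempty := by
        rw [Multiset.toFinset_nonempty]; exact hne
      obtain ⟨d, hd, hm⟩ := s.toFinset.exists_max_image id hne'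
      exact ⟨d, Multiset.mem_toFinset.1 hd, fun c hc => hm c (Multiset.mem_toFinset.2 hc)⟩
    obtain ⟨c, hc, hdc⟩ := key s t hs h d hd
    obtain ⟨d', hd', hcd'⟩ := key t s ht h.symm c hc
    have h1 : d ≤ c := Nat.le_of_dvd (ht c hc) hdc
    have h2 : c ≤ d' := Nat.le_of_dvd (hs d' hd') hcd'
    have h3 := hdmax d' hd'
    have hcd : c = d := by omega
    subst hcd
    obtain ⟨s', rfl⟩ := Multiset.exists_cons_of_mem hd
    obtain ⟨t', rfl⟩ := Multiset.exists_cons_of_mem hc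
    rw [Multiset.map_cons, Multiset.map_cons, Multiset.prod_cons, Multiset.prod_cons] at h
    have hX : (X ^ c - 1 : ℤ[X]) ≠ 0 := (monic_X_pow_sub_C (1:ℤ) (hs c hd).ne').ne_zero
    have := mul_left_cancel₀ hX h
    rw [ih s' t' (fun x hx => hs x (Multiset.mem_cons_of_mem hx)) (fun x hx => ht x (Multiset.mem_cons_of_mem hx)) this
      (by simpa using hcard)]

lemma cycleStruct_mem_pos {n : ℕ} (σ : Equiv.Perm (Fin n)) : ∀ c ∈ cycleStruct σ, 0 < c := by
  intro c hc
  rw [cycleStruct, Multiset.mem_add] at hc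
  rcases hc with hc | hc
  · exact Nat.lt_of_lt_of_le (by norm_num) (Equiv.Perm.two_le_of_mem_cycleType hc)
  · rw [Multiset.eq_of_mem_replicate hc]; norm_num

/-- for large `q` the totient value determines the cycle structure -/
theorem cycleStruct_of_prod (n : ℕ) : ∃ Q : ℕ, ∀ q : ℕ, Q < q → ∀ σ τ : Equiv.Perm (Fin n),
    ((cycleStruct σ).map fun c => q ^ c - 1).prod = ((cycleStruct τ).map fun c => q ^ c - 1).prod →
    cycleStruct σ = cycleStruct τ := by
  classical
  let P : Equiv.Perm (Fin n) → ℤ[X] := fun σ => ((cycleStruct σ).map fun c => (X ^ c - 1 : ℤ[X])).prod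
  let S : Finset ℤ := univ.biUnion fun στ : Equiv.Perm (Fin n) × Equiv.Perm (Fin n) => (P στ.1 - P στ.2).roots.toFinset
  refine ⟨∑ z ∈ S, z.natAbs + 1, fun q hq σ τ h => ?_⟩
  by_contra hne
  have hP : P σ - P τ ≠ 0 := by
    intro h0
    exact hne (prodXpow_inj _ _ (cycleStruct_mem_pos σ) (cycleStruct_mem_pos τ) (sub_eq_zero.1 h0))
  have hev : ∀ σ, (P σ).eval (q:ℤ) = (((cycleStruct σ).map fun c => q ^ c - 1).prod : ℕ) := by
    intro σ
    simp only [P]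
    rw [eval_multiset_prod, Multiset.map_map, Nat.cast_multiset_prod, Multiset.map_map]
    congr 1
    apply Multiset.map_congr rfl
    intro c _
    have : 1 ≤ q ^ c := Nat.one_le_pow _ _ (by omega)
    simp [Nat.cast_sub this]
  have hr : (P σ - P τ).IsRoot (q:ℤ) := by
    rw [IsRoot.def, eval_sub, hev, hev, h, sub_self]
  have hmem : (q:ℤ) ∈ S := by
    simp only [S, mem_biUnion, mem_univ, true_and, Multiset.mem_toFinset]
    exact ⟨(σ, τ), (mem_roots hP).2 hr⟩
  have := Finset.single_le_sum (f := fun z : ℤ => z.natAbs) (fun i _ => Nat.zero_le _) hmem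
  simp only [Int.natAbs_natCast] at this
  omega

end

section
open Finset

/-- data for the Stepanov argument -/
structure StepData (k R : Type) [Field k] [CommRing R] [Algebra k R] (d C c : ℕ) where
  Mon : ℕ → Set R
  mono : Monotone Mon
  one_mem : (1 : R) ∈ Mon 0
  mul_mem : ∀ i j a b, a ∈ Mon i → b ∈ Mon j → a * b ∈ Mon (i + j)
  exh : ∀ a : R, ∃ i, a ∈ Submodule.span k (Mon i)
  iota : R →ₐ[k] PowerSeries k
  iota_order : ∀ i a, a ∈ Submodule.span k (Mon i) → a ≠ 0 → ∃ o ≤ d * i, PowerSeries.coeff o (iota a) ≠ 0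
  lower : ∀ i, d * i ≤ Module.finrank k (Submodule.span k (Mon (i + C)))
  D : Derivation k R R
  D_mem : ∀ i a, a ∈ Mon i → D a ∈ Submodule.span k (Mon (i + c))
  t : R

namespace StepData
variable {k R : Type} [Field k] [CommRing R] [Algebra k R] {d C c : ℕ} (A : StepData k R d C c)

/-- the filtration -/
def V (i : ℕ) : Submodule k R := Submodule.span k (A.Mon i)

lemma V_mono : Monotone A.V := fun _ _ h => Submodule.span_mono (A.mono h)

lemma one_mem_V (i : ℕ) : (1 : R) ∈ A.V i := A.V_mono (Nat.zero_le i) (Submodule.subset_span A.one_mem)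

lemma V_mul {i j : ℕ} {a b : R} (ha : a ∈ A.V i) (hb : b ∈ A.V j) : a * b ∈ A.V (i + j) := by
  have h : A.V i * A.V j ≤ A.V (i + j) := by
    rw [V, V, Submodule.span_mul_span]
    apply Submodule.span_mono
    rintro x ⟨a, ha, b, hb, rfl⟩
    exact A.mul_mem i j a b ha hb
  exact h (Submodule.mul_mem_mul ha hb)

lemma V_pow {i : ℕ} {a : R} (ha : a ∈ A.V i) (n : ℕ) : a ^ n ∈ A.V (n * i) := by
  induction n with
  | zero => simpa using A.one_mem_V _
  | succ n ih => rw [pow_succ, Nat.succ_mul]; exact A.V_mul ih ha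

lemma D_mem_V {i : ℕ} {a : R} (ha : a ∈ A.V i) : A.D a ∈ A.V (i + c) := by
  have h : A.V i ≤ (A.V (i + c)).comap A.D.toLinearMap := by
    rw [V, Submodule.span_le]
    intro a ha
    exact A.D_mem i a ha
  exact h ha

lemma Diter_mem {i : ℕ} {a : R} (ha : a ∈ A.V i) (n : ℕ) : (A.D^[n]) a ∈ A.V (i + n * c) := by
  induction n with
  | zero => simpa using ha
  | succ n ih =>
    rw [Function.iterate_succ_apply', Nat.succ_mul, ← add_assoc]
    exact A.D_mem_V ih

/-- the linear map taking the first coefficients of the expansion -/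
noncomputable def jet (n : ℕ) : R →ₗ[k] (Fin n → k) :=
  LinearMap.pi fun o => (PowerSeries.coeff (R := k) o.1).comp A.iota.toLinearMap

lemma jet_inj (i : ℕ) : Function.Injective ((A.jet (d * i + 1)).comp (A.V i).subtype) := by
  rw [← LinearMap.ker_eq_bot, LinearMap.ker_eq_bot']
  rintro ⟨a, ha⟩ h
  by_contra hne
  have hne' : a ≠ 0 := fun h0 => hne (Subtype.ext h0)
  obtain ⟨o, ho, hc⟩ := A.iota_order i a ha hne'
  exact hc (congrFun h ⟨o, by omega⟩)

instance finV (i : ℕ) : FiniteDimensional k (A.V i) := FiniteDimensional.of_injective _ (A.jet_inj i)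

lemma finrank_le (i : ℕ) : Module.finrank k (A.V i) ≤ d * i + 1 := by
  have := LinearMap.finrank_le_finrank_of_injective (A.jet_inj i)
  simpa using this

lemma le_finrank (i : ℕ) : d * i ≤ Module.finrank k (A.V (i + C)) := A.lower i

/-- vanishing to order `n` along the derivation -/
def Zv (y : R →ₐ[k] k) : ℕ → Set R
  | 0 => Set.univ
  | n+1 => {g | y g = 0 ∧ A.D g ∈ Zv y n}

lemma Zv_anti (y : R →ₐ[k] k) (n : ℕ) : A.Zv y (n+1) ⊆ A.Zv y n := by
  induction n with
  | zero => intro g _; trivial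
  | succ n ih => rintro g ⟨h1, h2⟩; exact ⟨h1, ih h2⟩

lemma Zv_add (y : R →ₐ[k] k) (n : ℕ) (g h : R) (hg : g ∈ A.Zv y n) (hh : h ∈ A.Zv y n) : g + h ∈ A.Zv y n := by
  induction n generalizing g h with
  | zero => trivial
  | succ n ih => exact ⟨by rw [map_add, hg.1, hh.1, add_zero], by rw [map_add]; exact ih _ _ hg.2 hh.2⟩

lemma Zv_mul_left (y : R →ₐ[k] k) (n : ℕ) (g h : R) (hh : h ∈ A.Zv y n) : g * h ∈ A.Zv y n := by
  induction n generalizing g h with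
  | zero => trivial
  | succ n ih =>
    refine ⟨by rw [map_mul, hh.1, mul_zero], ?_⟩
    rw [Derivation.leibniz, smul_eq_mul, smul_eq_mul]
    refine A.Zv_add _ _ _ _ (ih _ _ hh.2) ?_
    rw [mul_comm]
    exact ih _ _ (A.Zv_anti y n hh)

lemma Zv_mul (y : R →ₐ[k] k) (a b : ℕ) (g h : R) (hg : g ∈ A.Zv y a) (hh : h ∈ A.Zv y b) : g * h ∈ A.Zv y (a + b) := by
  induction hn : a + b generalizing a b g h with
  | zero => trivial
  | succ n ih =>
    rcases a with _ | a
    · have : b = n + 1 := by omega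
      subst this
      exact A.Zv_mul_left y _ g h hh
    rcases b with _ | b
    · have : a = n := by omega
      subst this
      rw [mul_comm]
      exact A.Zv_mul_left y _ h g hg
    refine ⟨by rw [map_mul, hh.1, mul_zero], ?_⟩
    rw [Derivation.leibniz, smul_eq_mul, smul_eq_mul]
    refine A.Zv_add _ _ _ _ (ih (a+1) b _ _ hg hh.2 (by omega)) (ih (b+1) a _ _ hh hg.2 (by omega))

lemma Zv_pow (y : R →ₐ[k] k) (g : R) (hg : y g = 0) (n : ℕ) : g ^ n ∈ A.Zv y n := by
  induction n with
  | zero => trivial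
  | succ n ih => rw [pow_succ]; exact A.Zv_mul y n 1 _ _ ih ⟨hg, trivial⟩

lemma Zv_iff (y : R →ₐ[k] k) (n : ℕ) (g : R) : g ∈ A.Zv y n ↔ ∀ i < n, y (A.D^[i] g) = 0 := by
  induction n generalizing g with
  | zero => simp [Zv]
  | succ n ih =>
    change (y g = 0 ∧ A.D g ∈ A.Zv y n) ↔ _
    rw [ih]
    constructor
    · rintro ⟨h1, h2⟩ i hi
      rcases i with _ | i
      · exact h1
      · exact h2 i (by omega)
    · intro h
      exact ⟨h 0 (by omega), fun i hi => h (i+1) (by omega)⟩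

/-- leading coefficient computation -/
lemma D_test (y : R →ₐ[k] k) (i : ℕ) (h : R) :
    y (A.D^[i] (h * (A.t - algebraMap k R (y A.t)) ^ i)) = y h * (i.factorial : k) * y (A.D A.t) ^ i := by
  set u := A.t - algebraMap k R (y A.t) with hu
  have hu0 : y u = 0 := by rw [hu, map_sub, AlgHom.commutes]; simp
  have hDu : A.D u = A.D A.t := by rw [hu, map_sub, Derivation.map_algebraMap, sub_zero]
  -- general version modulo terms of higher order
  induction i generalizing h with
  | zero => simp
  | succ i ih =>
    rw [Function.iterate_succ_apply]
    have e : A.D (h * u ^ (i+1)) = (((i + 1 : ℕ) : R) * h * A.D A.t) * u ^ i + A.D h * u ^ (i+1) := by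
      rw [Derivation.leibniz, Derivation.leibniz_pow, hDu]
      simp only [smul_eq_mul, nsmul_eq_mul, Nat.add_sub_cancel]
      ring
    have hadd : ∀ n (a b : R), A.D^[n] (a + b) = A.D^[n] a + A.D^[n] b := by
      intro n a b
      exact iterate_map_add A.D n a b
    rw [e, hadd, map_add, ih]
    have hz : A.D h * u ^ (i+1) ∈ A.Zv y (i+1) := A.Zv_mul_left y _ _ _ (A.Zv_pow y u hu0 _)
    rw [(A.Zv_iff y (i+1) _).1 hz i (by omega), add_zero, map_mul, map_mul, map_natCast, Nat.factorial_succ]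
    push_cast
    ring

/-- separating element -/
lemma sep_elt (S : Finset (R →ₐ[k] k)) (y0 : R →ₐ[k] k) : ∃ h : R, y0 h = 1 ∧ ∀ y ∈ S, y ≠ y0 → y h = 0 := by
  classical
  have h1 : ∀ y : R →ₐ[k] k, y ≠ y0 → ∃ a : R, y a = 0 ∧ y0 a = 1 := by
    intro y hy
    obtain ⟨b, hb⟩ := DFunLike.exists_ne hy
    have hb' : y0 b - y b ≠ 0 := sub_ne_zero.2 (Ne.symm hb)
    refine ⟨algebraMap k R (y0 b - y b)⁻¹ * (b - algebraMap k R (y b)), ?_, ?_⟩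
    · simp
    · simp [hb']
  choose! a ha using h1
  refine ⟨∏ y ∈ S.filter (· ≠ y0), a y, ?_, ?_⟩
  · rw [map_prod]
    exact Finset.prod_eq_one fun y hy => (ha y (mem_filter.1 hy).2).2
  · intro y hy hne
    rw [map_prod]
    exact Finset.prod_eq_zero (mem_filter.2 ⟨hy, hne⟩) (ha y hne).1

theorem zero_count [IsDomain R] (S : Finset (R →ₐ[k] k)) (hS : ∀ y ∈ S, y (A.D A.t) ≠ 0) (M : ℕ)
    (hM : ∀ i < M, (i.factorial : k) ≠ 0) (F : R) (hF0 : F ≠ 0) (D0 : ℕ) (hF : F ∈ A.V D0)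
    (hv : ∀ y ∈ S, ∀ i < M, y (A.D^[i] F) = 0) : #S * M ≤ d * D0 + d * C + 1 := by
  classical
  -- test elements
  choose h hh using fun y0 : R →ₐ[k] k => sep_elt S y0
  let T : (R →ₐ[k] k) → ℕ → R := fun y0 i => h y0 ^ M * (A.t - algebraMap k R (y0 A.t)) ^ i
  have hT1 : ∀ y ∈ S, ∀ y0, y ≠ y0 → ∀ i j, j < M → y (A.D^[j] (T y0 i)) = 0 := by
    intro y hy y0 hne i j hj
    have : T y0 i ∈ A.Zv y M := by
      simp only [T]
      rw [mul_comm]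
      exact A.Zv_mul_left y _ _ _ (A.Zv_pow y _ ((hh y0).2 y hy hne) _)
    exact (A.Zv_iff y M _).1 this j hj
  have hT2 : ∀ (y : R →ₐ[k] k) (i j : ℕ), j < i → y (A.D^[j] (T y i)) = 0 := by
    intro y i j hj
    have : T y i ∈ A.Zv y i := A.Zv_mul_left y _ _ _ (A.Zv_pow y _ (by simp) _)
    exact (A.Zv_iff y i _).1 this j hj
  have hT3 : ∀ y ∈ S, ∀ i < M, y (A.D^[i] (T y i)) ≠ 0 := by
    intro y hy i hi
    simp only [T]
    rw [A.D_test, map_pow, (hh y).1, one_pow, one_mul]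
    exact mul_ne_zero (hM i hi) (pow_ne_zero _ (hS y hy))
  -- large degree
  obtain ⟨H, hHD, hH⟩ : ∃ H, D0 + C ≤ H ∧ ∀ y ∈ S, ∀ i < M, T y i ∈ A.V H := by
    choose e he using A.exh
    refine ⟨D0 + C + ∑ y ∈ S, ∑ i ∈ range M, e (T y i), by omega, fun y hy i hi => ?_⟩
    refine A.V_mono ?_ (he (T y i))
    have h1 := Finset.single_le_sum (f := fun i => e (T y i)) (fun _ _ => Nat.zero_le _) (mem_range.2 hi)
    have h2 := Finset.single_le_sum (f := fun y => ∑ i ∈ range M, e (T y i)) (fun _ _ => Nat.zero_le _) hy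
    omega
  -- functionals
  let Dl : ℕ → (R →ₗ[k] R) := fun i => (A.D.toLinearMap) ^ i
  have hDl : ∀ i g, Dl i g = A.D^[i] g := by
    intro i g
    simp only [Dl]
    rw [Module.End.pow_apply]
    rfl
  let φ : S × Fin M → Module.Dual k (A.V H) := fun yi =>
    (yi.1.1.toLinearMap.comp (Dl yi.2.1)).comp (A.V H).subtype
  have hφ : ∀ yi (g : A.V H), φ yi g = yi.1.1 (A.D^[yi.2.1] g.1) := by
    intro yi g
    simp only [φ, LinearMap.comp_apply, Submodule.subtype_apply, hDl]
    rfl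
  have hli : LinearIndependent k φ := by
    rw [Fintype.linearIndependent_iff]
    intro co hco
    by_contra! hne
    obtain ⟨⟨y0, i1⟩, hyi⟩ := hne
    let s : Finset (Fin M) := univ.filter fun i => co (y0, i) ≠ 0
    have hs : s.Nonempty := ⟨i1, by simp [s, hyi]⟩
    obtain ⟨i0, hi0, hmax⟩ := s.exists_max_image id hs
    have hc0 : co (y0, i0) ≠ 0 := (mem_filter.1 hi0).2
    have h1 := congrArg (fun f => f ⟨T y0.1 i0.1, hH y0.1 y0.2 i0.1 i0.2⟩) hco
    simp only [LinearMap.sum_apply, LinearMap.smul_apply, LinearMap.zero_apply, hφ, smul_eq_mul] at h1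
    rw [Finset.sum_eq_single (y0, i0)] at h1
    · exact mul_ne_zero hc0 (hT3 y0.1 y0.2 i0.1 i0.2) h1
    · rintro ⟨y, i⟩ _ hne
      by_cases hy : y = y0
      · subst hy
        have hii : i ≠ i0 := fun h => hne (by rw [h])
        rcases lt_or_gt_of_ne hii with hlt | hgt
        · rw [hT2 _ _ _ hlt, mul_zero]
        · have : co (y, i) = 0 := by
            by_contra hc
            have := hmax i (mem_filter.2 ⟨mem_univ _, hc⟩)
            exact absurd this (not_le.2 hgt)
          rw [this, zero_mul]
      · rw [hT1 y.1 y.2 y0.1 (fun h => hy (Subtype.ext h)) _ _ i.2, mul_zero]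
    · simp
  -- the subspace of multiples of F
  have hmF : ∀ g ∈ A.V (H - D0), F * g ∈ A.V H := by
    intro g hg
    have := A.V_mul hF hg
    rwa [show D0 + (H - D0) = H by omega] at this
  let μ : A.V (H - D0) →ₗ[k] A.V H := LinearMap.restrict (LinearMap.mulLeft k F) hmF
  have hμ : Function.Injective μ := by
    intro a b hab
    apply Subtype.ext
    have := congrArg Subtype.val hab
    exact mul_left_cancel₀ hF0 this
  have hrank : d * (H - D0 - C) ≤ Module.finrank k (LinearMap.range μ) := by
    rw [LinearMap.finrank_range_of_inj hμ]
    have := A.le_finrank (H - D0 - C)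
    rwa [show H - D0 - C + C = H - D0 by omega] at this
  have hann : ∀ yi, φ yi ∈ (LinearMap.range μ).dualAnnihilator := by
    intro yi
    rw [Submodule.mem_dualAnnihilator]
    rintro _ ⟨g, rfl⟩
    rw [hφ]
    have hz : F * g.1 ∈ A.Zv yi.1.1 M := by
      rw [mul_comm]
      apply A.Zv_mul_left
      rw [A.Zv_iff]
      exact hv yi.1.1 yi.1.2
    exact (A.Zv_iff _ M _).1 hz yi.2.1 yi.2.2
  have hli' : LinearIndependent k (fun yi => (⟨φ yi, hann yi⟩ : (LinearMap.range μ).dualAnnihilator)) := by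
    apply LinearIndependent.of_comp (LinearMap.range μ).dualAnnihilator.subtype
    exact hli
  have hcard := hli'.fintype_card_le_finrank
  have hfin := Subspace.finrank_add_finrank_dualAnnihilator_eq (LinearMap.range μ)
  have hup := A.finrank_le H
  simp only [Fintype.card_prod, Fintype.card_coe, Fintype.card_fin] at hcard
  have : d * H = d * (H - D0 - C) + d * D0 + d * C := by
    rw [← Nat.mul_add, ← Nat.mul_add]; congr 1; omega
  omega
end StepData

end

section
open Finset

section
variable {k : Type} [Field k]

lemma ps_frob (p : ℕ) [Fact p.Prime] [CharP k p] {J : Type} [Fintype J] (b : ℕ) (G : J → PowerSeries k)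
    (hG : ∀ e : J → k, (∀ o < p ^ b, PowerSeries.coeff o (∑ j, e j • G j) = 0) → ∑ j, e j • G j = 0) (ν : ℕ) :
    ∀ B : J → PowerSeries k, ∑ j, G j * B j ^ (p ^ b) = 0 →
      ∑ j, (PowerSeries.coeff ν (B j)) ^ (p ^ b) • G j = 0 := by
  have : CharP (PowerSeries k) p :=
    charP_of_injective_algebraMap (algebraMap k (PowerSeries k)).injective p
  have key : ∀ B : J → PowerSeries k, ∑ j, G j * B j ^ (p ^ b) = 0 →
      ∑ j, (PowerSeries.constantCoeff (B j)) ^ (p ^ b) • G j = 0 ∧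
      ∑ j, G j * (PowerSeries.mk fun i => PowerSeries.coeff (i + 1) (B j)) ^ (p ^ b) = 0 := by
    intro B hB
    have e : ∑ j, G j * B j ^ (p ^ b) =
        (∑ j, G j * (PowerSeries.mk fun i => PowerSeries.coeff (i + 1) (B j)) ^ (p ^ b)) * PowerSeries.X ^ (p ^ b) +
        ∑ j, (PowerSeries.constantCoeff (B j)) ^ (p ^ b) • G j := by
      rw [Finset.sum_mul, ← Finset.sum_add_distrib]
      refine Finset.sum_congr rfl fun j _ => ?_
      conv_lhs => rw [PowerSeries.eq_shift_mul_X_add_const (B j), add_pow_char_pow, mul_pow, ← map_pow]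
      rw [PowerSeries.smul_eq_C_mul]
      ring
    have h1 : ∑ j, (PowerSeries.constantCoeff (B j)) ^ (p ^ b) • G j = 0 := by
      apply hG
      intro o ho
      have := congrArg (PowerSeries.coeff o) (e.symm.trans hB)
      rw [map_add, PowerSeries.coeff_mul_X_pow', if_neg (not_le.2 ho), zero_add, map_zero] at this
      exact this
    refine ⟨h1, ?_⟩
    rw [hB, h1, add_zero] at e
    exact (mul_eq_zero.1 e.symm).resolve_right (pow_ne_zero _ PowerSeries.X_ne_zero)
  induction ν with
  | zero => intro B hB; simpa using (key B hB).1
  | succ ν ih =>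
    intro B hB
    have := ih _ (key B hB).2
    simpa using this

namespace StepData
variable {R : Type} [CommRing R] [Algebra k R] {d C c : ℕ} (A : StepData k R d C c)

lemma iota_inj : Function.Injective A.iota := by
  rw [injective_iff_map_eq_zero]
  intro a ha
  by_contra hne
  obtain ⟨i, hi⟩ := A.exh a
  obtain ⟨o, _, ho⟩ := A.iota_order i a hi hne
  rw [ha] at ho
  simp at ho

lemma nonvan [IsAlgClosed k] (p : ℕ) [Fact p.Prime] [CharP k p] {J : Type} [Fintype J] (b m : ℕ)
    (hm : d * m < p ^ b) (g : J → R) (hg : ∀ j, g j ∈ A.V m) (s : J → R) (hs : LinearIndependent k s)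
    (h0 : ∑ j, g j * s j ^ (p ^ b) = 0) : g = 0 := by
  have hpb : 0 < p ^ b := by omega
  have h1 := fun ν => ps_frob p b (fun j => A.iota (g j)) (by
    intro e he
    have e1 : ∑ j, e j • A.iota (g j) = A.iota (∑ j, e j • g j) := by simp
    rw [e1] at he ⊢
    have hmem : ∑ j, e j • g j ∈ A.V m := Submodule.sum_mem _ fun j _ => Submodule.smul_mem _ _ (hg j)
    by_contra hne
    have hne' : ∑ j, e j • g j ≠ 0 := fun h => hne (by rw [h, map_zero])
    obtain ⟨o, ho, hc⟩ := A.iota_order m _ hmem hne'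
    exact hc (he o (by omega))) ν (fun j => A.iota (s j)) (by
      have := congrArg A.iota h0
      simpa using this)
  have h2 : ∀ o j, PowerSeries.coeff o (A.iota (g j)) = 0 := by
    intro o
    choose z hz using fun j => IsAlgClosed.exists_pow_nat_eq (PowerSeries.coeff o (A.iota (g j))) hpb
    have h3 : ∑ j, z j • s j = 0 := by
      apply A.iota_inj
      rw [map_zero]
      ext ν
      have h4 := congrArg (PowerSeries.coeff o) (h1 ν)
      simp only [map_sum, map_smul, smul_eq_mul, map_zero] at h4 ⊢
      apply eq_zero_of_pow_eq_zero (n := p ^ b)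
      rw [sum_pow_char_pow, ← h4]
      refine Finset.sum_congr rfl fun j _ => ?_
      rw [mul_pow, hz, mul_comm]
    intro j
    have := Fintype.linearIndependent_iff.1 hs z h3 j
    rw [← hz, this, zero_pow hpb.ne']
  funext j
  apply A.iota_inj
  ext o
  rw [h2]; simp

lemma exists_basis_mon (i n : ℕ) (hn : n ≤ d * i) : ∃ s : Fin n → R, (∀ j, s j ∈ A.Mon (i + C)) ∧ LinearIndependent k s := by
  have : Module.Finite k (Submodule.span k (A.Mon (i + C))) := A.finV _
  obtain ⟨f, h1, _, h3⟩ := Submodule.exists_fun_fin_finrank_span_eq k (A.Mon (i + C))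
  have hle := hn.trans (A.lower i)
  exact ⟨fun j => f (Fin.castLE hle j), fun j => h1 _, h3.comp _ (Fin.castLE_injective hle)⟩

/-- Case of large characteristic -/
lemma count_large [IsAlgClosed k] [IsDomain R] (p a : ℕ) [Fact p.Prime] [CharP k p] (ha : 0 < a)
    (σ : R ≃ₐ[k] R) (hσ : ∀ i s, s ∈ A.Mon i → σ s ∈ A.V i)
    (S : Finset (R →ₐ[k] k)) (hS : ∀ y ∈ S, y (A.D A.t) ≠ 0)
    (hy : ∀ y ∈ S, ∀ i s, s ∈ A.Mon i → y (σ s) ^ (p ^ a) = y s)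
    (L m : ℕ) (hp : d * L ≤ p) (hdm : d * m < p ^ a)
    (hm : (d * L - 1) * (d * (m + d * L * c + (L + C)) + 1) < d * L * (d * (m - C))) (hmC : C ≤ m) :
    #S * (d * L - 1) ≤ d * (m + p ^ a * (L + C)) + d * C + 1 := by
  classical
  obtain ⟨s, hs1, hs2⟩ := A.exists_basis_mon L (d * L) le_rfl
  -- the linear system
  set H := m + d * L * c + (L + C) with hH
  have hmem : ∀ (i : Fin (d * L - 1)) (j : Fin (d*L)) (g : A.V m), (A.D.toLinearMap ^ i.1) g.1 * s j ∈ A.V H := by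
    intro i j g
    have h1 : (A.D.toLinearMap ^ i.1) g.1 ∈ A.V (m + i.1 * c) := by
      rw [Module.End.pow_apply]
      exact A.Diter_mem g.2 i.1
    refine A.V_mono ?_ (A.V_mul h1 (Submodule.subset_span (hs1 j)))
    have : i.1 * c ≤ d * L * c := Nat.mul_le_mul_right _ (by have := i.2; omega)
    omega
  let Φ : (Fin (d * L) → A.V m) →ₗ[k] (Fin (d * L - 1) → A.V H) :=
    LinearMap.pi fun i => ∑ j, (LinearMap.codRestrict (A.V H)
      ((LinearMap.mulRight k (s j)).comp ((A.D.toLinearMap ^ i.1).comp (A.V m).subtype)) (hmem i j)).comp (LinearMap.proj j)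
  have hker : LinearMap.ker Φ ≠ ⊥ := by
    apply LinearMap.ker_ne_bot_of_finrank_lt
    rw [Module.finrank_pi_fintype, Module.finrank_pi_fintype]
    simp only [sum_const, card_univ, Fintype.card_fin, smul_eq_mul]
    have h1 := A.finrank_le H
    have h2 := A.le_finrank (m - C)
    rw [Nat.sub_add_cancel hmC] at h2
    calc _ ≤ (d * L - 1) * (d * H + 1) := Nat.mul_le_mul_left _ h1
      _ < _ := hm
      _ ≤ _ := Nat.mul_le_mul_left _ h2
  obtain ⟨g, hg0, hgne⟩ := (Submodule.ne_bot_iff _).1 hker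
  rw [LinearMap.mem_ker] at hg0
  have hg1 : ∀ i < d * L - 1, ∑ j, A.D^[i] (g j).1 * s j = 0 := by
    intro i hi
    have := congrArg (fun f => (f ⟨i, hi⟩).1) hg0
    simp only [Φ, LinearMap.pi_apply, LinearMap.sum_apply, LinearMap.comp_apply, LinearMap.proj_apply] at this
    rw [AddSubmonoidClass.coe_finsetSum] at this
    refine Eq.trans (Finset.sum_congr rfl fun j _ => ?_) this
    change _ = ((A.D.toLinearMap ^ i) (g j).1) * s j
    rw [Module.End.pow_apply]
    rfl
  have : CharP R p := charP_of_injective_algebraMap (algebraMap k R).injective p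
  have hDp : ∀ x : R, A.D (x ^ (p ^ a)) = 0 := by
    intro x
    rw [Derivation.leibniz_pow]
    have : ((p ^ a : ℕ) : R) = 0 := by
      rw [Nat.cast_pow, CharP.cast_eq_zero, zero_pow ha.ne']
    rw [← Nat.cast_smul_eq_nsmul R, this, zero_smul]
  have hDF : ∀ i, A.D^[i] (∑ j, (g j).1 * σ (s j) ^ (p ^ a)) = ∑ j, A.D^[i] (g j).1 * σ (s j) ^ (p ^ a) := by
    intro i
    induction i with
    | zero => rfl
    | succ i ih =>
      rw [Function.iterate_succ_apply', ih, map_sum]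
      refine Finset.sum_congr rfl fun j _ => ?_
      rw [Derivation.leibniz, hDp, smul_zero, zero_add, Function.iterate_succ_apply', smul_eq_mul, mul_comm]
  refine A.zero_count S hS (d * L - 1) ?_ (∑ j, (g j).1 * σ (s j) ^ (p ^ a)) ?_ _ ?_ ?_
  · intro i hi h
    rw [CharP.cast_eq_zero_iff k p, Nat.Prime.dvd_factorial Fact.out] at h
    omega
  · intro h0
    have := A.nonvan p a m hdm (fun j => (g j).1) (fun j => (g j).2) (fun j => σ (s j))
      (hs2.map' σ.toLinearMap (LinearMap.ker_eq_bot.2 σ.injective)) h0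
    exact hgne (funext fun j => Subtype.ext (congrFun this j))
  · refine Submodule.sum_mem _ fun j _ => A.V_mul (g j).2 (A.V_pow (hσ _ _ (hs1 j)) _)
  · intro y hyS i hi
    rw [hDF, map_sum]
    have := congrArg y (hg1 i hi)
    rw [map_sum, map_zero] at this
    rw [← this]
    refine Finset.sum_congr rfl fun j _ => ?_
    rw [map_mul, map_mul, map_pow, hy y hyS _ _ (hs1 j)]

/-- Case of small characteristic -/
lemma count_small [IsAlgClosed k] [IsDomain R] (p b μ : ℕ) [Fact p.Prime] [CharP k p]
    (σ : R ≃ₐ[k] R) (hσ : ∀ i s, s ∈ A.Mon i → σ s ∈ A.V i)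
    (S : Finset (R →ₐ[k] k)) (hS : ∀ y ∈ S, y (A.D A.t) ≠ 0)
    (hy : ∀ y ∈ S, ∀ i s, s ∈ A.Mon i → y (σ s) ^ (p ^ b * p ^ μ) = y s)
    (L m : ℕ) (hdm : d * m < p ^ b)
    (hm : d * (p ^ μ * m + (L + C)) + 1 < d * L * (d * (m - C))) (hmC : C ≤ m) :
    #S ≤ d * (m + p ^ b * (L + C)) + d * C + 1 := by
  classical
  have hpμ : 0 < p ^ μ := pow_pos (Fact.out (p := p.Prime)).pos _
  obtain ⟨s, hs1, hs2⟩ := A.exists_basis_mon L (d * L) le_rfl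
  let v := Module.finBasis k (A.V m)
  set H := p ^ μ * m + (L + C) with hH
  have hmem : ∀ j l, (v l).1 ^ (p ^ μ) * s j ∈ A.V H := fun j l =>
    A.V_mul (A.V_pow (v l).2 _) (Submodule.subset_span (hs1 j))
  let Φ := Fintype.linearCombination k
    (fun x : Fin (d * L) × Fin (Module.finrank k (A.V m)) => (⟨_, hmem x.1 x.2⟩ : A.V H))
  have hker : LinearMap.ker Φ ≠ ⊥ := by
    apply LinearMap.ker_ne_bot_of_finrank_lt
    rw [Module.finrank_fintype_fun_eq_card, Fintype.card_prod, Fintype.card_fin, Fintype.card_fin]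
    have h1 := A.finrank_le H
    have h2 := A.le_finrank (m - C)
    rw [Nat.sub_add_cancel hmC] at h2
    calc _ ≤ (d * H + 1) := h1
      _ < _ := hm
      _ ≤ _ := Nat.mul_le_mul_left _ h2
  obtain ⟨e, he0, hene⟩ := (Submodule.ne_bot_iff _).1 hker
  rw [LinearMap.mem_ker, Fintype.linearCombination_apply] at he0
  have he1 : ∑ x : Fin (d * L) × Fin (Module.finrank k (A.V m)), e x • ((v x.2).1 ^ (p ^ μ) * s x.1) = 0 := by
    have := congrArg Subtype.val he0
    rw [AddSubmonoidClass.coe_finsetSum] at this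
    simpa using this
  choose z hz using fun x => IsAlgClosed.exists_pow_nat_eq (e x) hpμ
  have : CharP R p := charP_of_injective_algebraMap (algebraMap k R).injective p
  let g : Fin (d * L) → A.V m := fun j => ∑ l, z (j, l) • v l
  have hgp : ∀ j, (g j).1 ^ (p ^ μ) = ∑ l, e (j, l) • (v l).1 ^ (p ^ μ) := by
    intro j
    simp only [g]
    rw [AddSubmonoidClass.coe_finsetSum, sum_pow_char_pow]
    refine Finset.sum_congr rfl fun l _ => ?_
    rw [Submodule.coe_smul, _root_.smul_pow, hz]
  have hg1 : ∑ j, (g j).1 ^ (p ^ μ) * s j = 0 := by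
    rw [← he1, Fintype.sum_prod_type]
    refine Finset.sum_congr rfl fun j _ => ?_
    rw [hgp, Finset.sum_mul]
    refine Finset.sum_congr rfl fun l _ => ?_
    rw [smul_mul_assoc]
  have hfin := A.zero_count S hS 1 ?_ (∑ j, (g j).1 * σ (s j) ^ (p ^ b)) ?_ (m + p ^ b * (L + C)) ?_ ?_
  · simpa using hfin
  · intro i hi
    have : i = 0 := by omega
    subst this; simp
  · intro h0
    have := A.nonvan p b m hdm (fun j => (g j).1) (fun j => (g j).2) (fun j => σ (s j))
      (hs2.map' σ.toLinearMap (LinearMap.ker_eq_bot.2 σ.injective)) h0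
    apply hene
    funext ⟨j, l⟩
    have h1 : g j = 0 := Subtype.ext (congrFun this j)
    have h2 := Fintype.linearIndependent_iff.1 v.linearIndependent (fun l => z (j, l)) h1 l
    rw [← hz, h2, zero_pow hpμ.ne']; rfl
  · refine Submodule.sum_mem _ fun j _ => A.V_mul (g j).2 (A.V_pow (hσ _ _ (hs1 j)) _)
  · intro y hyS i hi
    have : i = 0 := by omega
    subst this
    have : CharP k p := inferInstance
    apply eq_zero_of_pow_eq_zero (n := p ^ μ)
    have h3 := congrArg y hg1
    rw [map_sum, map_zero] at h3
    rw [Function.iterate_zero_apply, map_sum, sum_pow_char_pow, ← h3]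
    refine Finset.sum_congr rfl fun j _ => ?_
    rw [map_mul, map_mul, map_pow, map_pow, mul_pow, ← pow_mul, hy y hyS _ _ (hs1 j)]

end StepData
end

end

section
open Finset

theorem step_bound (d C c : ℕ) (hd : 1 ≤ d) (δ : ℝ) (hδ : 0 < δ) : ∃ Q : ℕ,
    ∀ (k R : Type) [Field k] [IsAlgClosed k] [CommRing R] [IsDomain R] [Algebra k R]
      (A : StepData k R d C c) (p a : ℕ) [Fact p.Prime] [CharP k p], 0 < a → Q < p ^ a →
      ∀ (σ : R ≃ₐ[k] R), (∀ i s, s ∈ A.Mon i → σ s ∈ A.V i) →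
      ∀ (S : Finset (R →ₐ[k] k)), (∀ y ∈ S, y (A.D A.t) ≠ 0) →
      (∀ y ∈ S, ∀ i s, s ∈ A.Mon i → y (σ s) ^ (p ^ a) = y s) →
      (#S : ℝ) ≤ (1 + δ) * (p : ℝ) ^ a := by
  obtain ⟨L', hL'⟩ := exists_nat_gt ((d * C + 1) * (2 / δ) + 1 : ℝ)
  set L := L' + 2 with hL
  have hdL : 2 ≤ d * L := by nlinarith
  have hL1 : (d : ℝ) * (L + C) ≤ (1 + δ / 2) * (d * L - 1) := by
    have hd1 : (1 : ℝ) ≤ d := by exact_mod_cast hd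
    have h1 : ((d * C + 1) * (2 / δ) + 1 : ℝ) ≤ d * L := by
      rw [hL]; push_cast
      nlinarith [show (0:ℝ) ≤ (L':ℝ) from Nat.cast_nonneg _]
    have h2 : (d * C + 1 : ℝ) ≤ δ / 2 * (d * L - 1) := by
      have : (d * C + 1 : ℝ) = δ / 2 * ((d * C + 1) * (2 / δ)) := by field_simp
      rw [this]
      apply mul_le_mul_of_nonneg_left _ (by positivity)
      linarith
    nlinarith
  set M1 := d * L with hM1
  set m1 := C + (M1 * (d * (2 * C + M1 * c + L) + 1) + 1) with hm1
  obtain ⟨Q0', hQ0'⟩ := exists_nat_gt ((d * (C + 1)) * (2 / δ) : ℝ)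
  set Q0 := Q0' + 1 with hQ0
  have hQ01 : (d * (C + 1) : ℝ) ≤ δ / 2 * Q0 := by
    have : (d * (C + 1) : ℝ) = δ / 2 * ((d * (C + 1)) * (2 / δ)) := by field_simp
    rw [this]
    apply mul_le_mul_of_nonneg_left _ (by positivity)
    rw [hQ0]; push_cast; linarith
  set B := Q0 * M1 with hB
  set m2 := C + (B * C + B + 1 + C + 2) with hm2
  obtain ⟨Q1, hQ1⟩ := exists_nat_gt ((d * m1 + d * C + 1 + d * m2) * (2 / δ) : ℝ)
  refine ⟨Q1 + d * m1 + B * (d * m2 + 1), ?_⟩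
  intro k R _ _ _ _ _ A p a _ _ ha hq σ hσ S hS hy
  have hp2 := (Fact.out (p := p.Prime)).two_le
  have hqR : ((p ^ a : ℕ) : ℝ) = (p : ℝ) ^ a := by push_cast; rfl
  have hK : (d * m1 + d * C + 1 + d * m2 : ℝ) ≤ δ / 2 * (p : ℝ) ^ a := by
    have : (d * m1 + d * C + 1 + d * m2 : ℝ) = δ / 2 * ((d * m1 + d * C + 1 + d * m2) * (2 / δ)) := by field_simp
    rw [this]
    apply mul_le_mul_of_nonneg_left _ (by positivity)
    rw [← hqR]
    have : (Q1 : ℝ) ≤ ((p ^ a : ℕ) : ℝ) := by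
      exact_mod_cast (by omega : Q1 ≤ p ^ a)
    linarith
  by_cases hp : M1 ≤ p
  · have h1 := A.count_large p a ha σ hσ S hS hy L m1 hp (by omega) (by
      rw [← hM1, show m1 - C = M1 * (d * (2 * C + M1 * c + L) + 1) + 1 by omega]
      obtain ⟨M', hM'⟩ : ∃ M', M1 = M' + 1 := ⟨M1 - 1, by omega⟩
      set x := M1 * (d * (2 * C + M1 * c + L) + 1) + 1 with hx
      rw [hm1, show C + x + M1 * c + (L + C) = x + (2 * C + M1 * c + L) by ring]
      have hx2 : (M1 - 1) * (d * (2 * C + M1 * c + L) + 1) < x := by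
        rw [hx]
        have := Nat.mul_le_mul_right (d * (2 * C + M1 * c + L) + 1) (Nat.sub_le M1 1)
        omega
      set Y := 2 * C + M1 * c + L
      rw [hM', Nat.add_sub_cancel] at *
      have : x ≤ d * x := Nat.le_mul_of_pos_left _ hd
      nlinarith) (by omega)
    rw [← hM1] at h1
    have h2 : (#S : ℝ) * (M1 - 1) ≤ d * (m1 + (p:ℝ) ^ a * (L + C)) + d * C + 1 := by
      have := (Nat.cast_le (α := ℝ)).2 h1
      push_cast [Nat.cast_sub (show 1 ≤ M1 by omega)] at this
      exact this
    have hM1R : (1 : ℝ) ≤ (M1 : ℝ) - 1 := by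
      have : (2 : ℝ) ≤ M1 := by exact_mod_cast hdL
      linarith
    have hM1e : (M1 : ℝ) = d * L := by rw [hM1]; push_cast; rfl
    rw [← hM1e] at hL1
    have hpa : (0:ℝ) ≤ (p : ℝ) ^ a := by positivity
    have h3 : (#S : ℝ) * (M1 - 1) ≤ ((1 + δ) * (p:ℝ) ^ a) * (M1 - 1) := by
      have e1 : (p:ℝ) ^ a * (d * (L + C)) ≤ (p:ℝ)^a * ((1 + δ / 2) * (M1 - 1)) :=
        mul_le_mul_of_nonneg_left hL1 hpa
      have e2 : δ / 2 * (p:ℝ) ^ a ≤ δ / 2 * (p:ℝ) ^ a * (M1 - 1) :=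
        le_mul_of_one_le_right (by positivity) hM1R
      have e3 : (0:ℝ) ≤ d * m2 := by positivity
      linarith
    exact le_of_mul_le_mul_right h3 (by linarith)
  · push Not at hp
    have hex : ∃ μ, Q0 ≤ p ^ μ := ⟨Q0, (Nat.lt_pow_self (by omega)).le⟩
    classical
    set μ := Nat.find hex with hμ
    have hμ1 : Q0 ≤ p ^ μ := Nat.find_spec hex
    have hμ2 : p ^ μ ≤ B := by
      rcases Nat.eq_zero_or_pos μ with h0 | h0
      · rw [h0, pow_zero, hB]
        exact Nat.mul_pos (by omega) (by omega)
      · have := Nat.find_min hex (m := μ - 1) (by omega)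
        push Not at this
        rw [show μ = (μ - 1) + 1 by omega, pow_succ, hB]
        exact Nat.mul_le_mul this.le hp.le
    have hB1 : B * (d * m2 + 1) < p ^ a := by omega
    have hμa : μ ≤ a := by
      by_contra h
      push Not at h
      have : p ^ a ≤ p ^ μ := Nat.pow_le_pow_right (by omega) h.le
      have : B ≤ B * (d * m2 + 1) := Nat.le_mul_of_pos_right _ (by omega)
      omega
    have hpa : p ^ a = p ^ (a - μ) * p ^ μ := by rw [← pow_add]; congr 1; omega
    set q' := p ^ (a - μ) with hq'
    set QQ := p ^ μ with hQQ
    have hq'1 : d * m2 < q' := by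
      by_contra h
      push Not at h
      rw [hpa] at hB1
      have : q' * QQ ≤ (d * m2 + 1) * B := Nat.mul_le_mul (by omega) hμ2
      rw [mul_comm (d * m2 + 1) B] at this
      omega
    set L2 := QQ / d + 1 with hL2
    have hd0 : 0 < d := hd
    have hdl1 : QQ + 1 ≤ d * L2 := by
      rw [hL2, mul_add, mul_one]
      have := Nat.div_add_mod QQ d
      have := Nat.mod_lt QQ hd0
      omega
    have hdl2 : d * L2 ≤ QQ + d := by
      rw [hL2, mul_add, mul_one]
      have := Nat.mul_div_le QQ d
      omega
    have hL2B : L2 ≤ B + 1 := by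
      have := Nat.div_le_self QQ d
      omega
    have h1 := A.count_small p (a - μ) μ σ hσ S hS (by rw [← hq', ← hQQ, ← hpa]; exact hy) L2 m2 hq'1 (by
      rw [← hQQ, show m2 - C = B * C + B + 1 + C + 2 by omega]
      set x := B * C + B + 1 + C + 2 with hx
      rw [hm2]
      have h3 : QQ * C ≤ B * C := Nat.mul_le_mul_right _ hμ2
      have h2 : QQ * C + L2 + C + 1 < x := by omega
      calc d * (QQ * (C + x) + (L2 + C)) + 1 ≤ d * (QQ * (C + x) + (L2 + C)) + d := by omega
        _ = d * (QQ * x + (QQ * C + L2 + C + 1)) := by ring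
        _ < d * (QQ * x + x) := by
          apply Nat.mul_lt_mul_of_pos_left _ hd0
          omega
        _ = (QQ + 1) * (d * x) := by ring
        _ ≤ _ := Nat.mul_le_mul_right _ hdl1) (by omega)
    have h2 : (#S : ℝ) ≤ d * (m2 + q' * (L2 + C)) + d * C + 1 := by
      have := (Nat.cast_le (α := ℝ)).2 h1
      push_cast at this
      rw [hq']; push_cast
      exact this
    have e0 : (p : ℝ) ^ a = q' * QQ := by rw [← hqR, hpa]; push_cast; rfl
    have e1 : (d : ℝ) * L2 ≤ QQ + d := by exact_mod_cast hdl2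
    have e2 : (Q0 : ℝ) ≤ QQ := by exact_mod_cast hμ1
    have e3 : (d * (C + 1) : ℝ) ≤ δ / 2 * QQ := hQ01.trans (mul_le_mul_of_nonneg_left e2 (by positivity))
    have hq0 : (0 : ℝ) ≤ q' := Nat.cast_nonneg _
    have e4 : (q' : ℝ) * (d * L2 + d * C) ≤ q' * (QQ + δ / 2 * QQ) :=
      mul_le_mul_of_nonneg_left (by linarith) hq0
    have e5 : (0:ℝ) ≤ d * m1 := by positivity
    rw [e0] at hK ⊢
    linarith

end

section
open Finset Polynomial

section
variable {k : Type} [Field k]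

/-- expansion of a polynomial at a point as a power series -/
noncomputable def psExp (t0 : k) : k[X] →ₐ[k] PowerSeries k := aeval (PowerSeries.C t0 + PowerSeries.X)

lemma psExp_const (t0 : k) (p : k[X]) : PowerSeries.constantCoeff (psExp t0 p) = p.eval t0 := by
  have : (PowerSeries.constantCoeff (R := k)).comp (psExp t0).toRingHom = evalRingHom t0 := by
    apply Polynomial.ringHom_ext
    · intro a; simp [psExp]
    · simp [psExp]
  exact congrArg (fun f => f p) this

lemma psExp_coeff_ne (t0 : k) (p : k[X]) (hp : p ≠ 0) : ∃ o ≤ p.natDegree, PowerSeries.coeff o (psExp t0 p) ≠ 0 := by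
  have h1 : psExp t0 p = ((p.comp (C t0 + X) : k[X]) : PowerSeries k) := by
    have : psExp t0 = (Polynomial.coeToPowerSeries.algHom k (R := k)).comp (aeval (C t0 + X)) := by
      apply Polynomial.algHom_ext
      simp [psExp, Polynomial.coeToPowerSeries.algHom_apply]
    rw [this, AlgHom.comp_apply, Polynomial.coeToPowerSeries.algHom_apply]
    simp [Polynomial.aeval_def, Polynomial.comp]
  have h2 : (C t0 + X : k[X]).natDegree = 1 := by rw [add_comm]; exact natDegree_X_add_C t0
  have h3 : (p.comp (C t0 + X)).natDegree = p.natDegree := by rw [natDegree_comp, h2, mul_one]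
  refine ⟨p.natDegree, le_rfl, ?_⟩
  rw [h1, coeff_coe]
  have h5 : (p.comp (C t0 + X)) ≠ 0 := by
    intro h0
    rw [Polynomial.comp_eq_zero_iff] at h0
    rcases h0 with h0 | h0
    · exact hp h0
    · have := congrArg natDegree h0.2
      rw [h2, natDegree_C] at this
      omega
  rw [← h3]
  exact leadingCoeff_ne_zero.2 h5

lemma psExp_inj (t0 : k) : Function.Injective (psExp t0) := by
  rw [injective_iff_map_eq_zero]
  intro p hp
  by_contra hne
  obtain ⟨o, _, ho⟩ := psExp_coeff_ne t0 p hne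
  rw [hp] at ho
  simp at ho

lemma prod_of_roots {A : Type} [CommRing A] [IsDomain A] {n : ℕ} (f : A[X]) (hf : f.Monic) (hn : f.natDegree = n) (ξ : Fin n → A)
    (hinj : Function.Injective ξ) (hr : ∀ j, f.IsRoot (ξ j)) : f = ∏ j, (X - C (ξ j)) := by
  classical
  have h1 : (univ.val.map ξ) ≤ f.roots := by
    rw [Multiset.le_iff_subset ((Multiset.nodup_map_iff_of_injective hinj).2 univ.nodup)]
    intro a ha
    obtain ⟨j, _, rfl⟩ := Multiset.mem_map.1 ha
    exact (mem_roots hf.ne_zero).2 (hr j)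
  have h2 : (univ.val.map ξ) = f.roots := by
    apply Multiset.eq_of_le_of_card_le h1
    rw [Multiset.card_map]
    simpa [hn] using f.card_roots'
  have h3 := prod_multiset_X_sub_C_of_monic_of_roots_card_eq hf (by rw [← h2]; simp [hn])
  rw [← h3, ← h2, Multiset.map_map]
  rfl

lemma fiber_roots [IsAlgClosed k] {n : ℕ} (f : k[X]) (hf : f.Monic) (hn : f.natDegree = n) (hs : f.Separable) :
    ∃ ρ : Fin n → k, Function.Injective ρ ∧ f = ∏ j, (X - C (ρ j)) := by
  classical
  have hc : Fintype.card f.roots.toFinset = n := by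
    rw [Fintype.card_coe, Multiset.toFinset_card_of_nodup (nodup_roots hs), ← hn]
    exact (splits_iff_card_roots.1 (IsAlgClosed.splits f))
  let ε := (Fintype.equivFinOfCardEq hc).symm
  have hi : Function.Injective (fun j => (ε j).1) := fun a b h => ε.injective (Subtype.ext h)
  refine ⟨fun j => (ε j).1, hi, prod_of_roots f hf hn _ hi fun j => ?_⟩
  have := (ε j).2
  rw [Multiset.mem_toFinset, mem_roots hf.ne_zero] at this
  exact this

lemma hensel_roots [IsAlgClosed k] {n : ℕ} (P : k[X][X]) (hP : P.Monic) (hn : P.natDegree = n) (t0 : k)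
    (hs : (P.map (evalRingHom t0)).Separable) :
    ∃ ξ : Fin n → PowerSeries k, Function.Injective ξ ∧ P.map (psExp t0).toRingHom = ∏ j, (X - C (ξ j)) := by
  have hm : (P.map (evalRingHom t0)).Monic := hP.map _
  have hd : (P.map (evalRingHom t0)).natDegree = n := by rw [hP.natDegree_map, hn]
  obtain ⟨ρ, hρ, hfac⟩ := fiber_roots _ hm hd hs
  have hcomp : (P.map (psExp t0).toRingHom).map (PowerSeries.constantCoeff (R := k)) = P.map (evalRingHom t0) := by
    rw [Polynomial.map_map]
    congr 1
    ext p
    · simp [psExp]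
    · simp [psExp]
  have key : ∀ j, ∃ ξ : PowerSeries k, (P.map (psExp t0).toRingHom).IsRoot ξ ∧ PowerSeries.constantCoeff ξ = ρ j := by
    intro j
    have hroot : (P.map (evalRingHom t0)).eval (ρ j) = 0 := by
      rw [hfac, eval_prod]
      exact Finset.prod_eq_zero (mem_univ j) (by simp)
    have hder : (P.map (evalRingHom t0)).derivative.eval (ρ j) ≠ 0 := by
      have := hs.eval₂_derivative_ne_zero (RingHom.id k) (x := ρ j) (by simpa [eval₂_id] using hroot)
      simpa [eval₂_id] using this
    have hev : ∀ f : (PowerSeries k)[X], PowerSeries.constantCoeff (f.eval (PowerSeries.C (ρ j))) =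
        (f.map (PowerSeries.constantCoeff (R := k))).eval (ρ j) := by
      intro f
      rw [Polynomial.eval_map, ← Polynomial.eval₂_at_apply]
      simp
    have hz : ∀ a : PowerSeries k, a ∈ Ideal.span {(PowerSeries.X : PowerSeries k)} ↔ PowerSeries.constantCoeff a = 0 := by
      intro a
      rw [Ideal.mem_span_singleton, PowerSeries.X_dvd_iff]
    obtain ⟨ξ, h1, h2⟩ := HenselianRing.is_henselian (I := Ideal.span {(PowerSeries.X : PowerSeries k)})
      (P.map (psExp t0).toRingHom) (hP.map _) (PowerSeries.C (ρ j)) (by rw [hz, hev, hcomp, hroot]) (by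
        apply IsUnit.map
        rw [PowerSeries.isUnit_iff_constantCoeff, hev, ← derivative_map (P.map (psExp t0).toRingHom) PowerSeries.constantCoeff, hcomp]
        exact hder.isUnit)
    refine ⟨ξ, h1, ?_⟩
    rw [hz, map_sub, sub_eq_zero] at h2
    simpa using h2
  choose ξ h1 h2 using key
  have hinj : Function.Injective ξ := by
    intro a b hab
    apply hρ
    rw [← h2, ← h2, hab]
  exact ⟨ξ, hinj, prod_of_roots _ (hP.map _) (by rw [hP.natDegree_map, hn]) ξ hinj h1⟩
end

end

section
open Finset Polynomial

/-- weighted monomials in `t` and the `x i j` -/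
inductive WMon {R : Type} [CommRing R] {r n : ℕ} (t : R) (x : Fin r → Fin n → R) (e : ℕ) : ℕ → R → Prop
  | one : WMon t x e 0 1
  | tmul (D : ℕ) (a : R) : WMon t x e D a → WMon t x e (D + 1) (t * a)
  | xmul (D : ℕ) (a : R) (i : Fin r) (j : Fin n) : WMon t x e D a → WMon t x e (D + e) (x i j * a)
  | mono (D D' : ℕ) (a : R) : D ≤ D' → WMon t x e D a → WMon t x e D' a

section
variable {R : Type} [CommRing R] {r n : ℕ} {t : R} {x : Fin r → Fin n → R} {e : ℕ}

lemma WMon.mul {D D' : ℕ} {a b : R} (ha : WMon t x e D a) (hb : WMon t x e D' b) : WMon t x e (D + D') (a * b) := by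
  induction ha with
  | one => simpa using hb
  | tmul D a _ ih => rw [mul_assoc, show D + 1 + D' = D + D' + 1 by omega]; exact .tmul _ _ ih
  | xmul D a i j _ ih => rw [mul_assoc, show D + e + D' = D + D' + e by omega]; exact .xmul _ _ _ _ ih
  | mono D D1 a h _ ih => exact .mono _ _ _ (by omega) ih

lemma WMon.pow {D : ℕ} {a : R} (ha : WMon t x e D a) (m : ℕ) : WMon t x e (m * D) (a ^ m) := by
  induction m with
  | zero => simpa using WMon.one
  | succ m ih => rw [pow_succ, Nat.succ_mul]; exact ih.mul ha

lemma WMon.prod {ι : Type} (s : Finset ι) (f : ι → R) (D : ι → ℕ) (h : ∀ i ∈ s, WMon t x e (D i) (f i)) :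
    WMon t x e (∑ i ∈ s, D i) (∏ i ∈ s, f i) := by
  classical
  induction s using Finset.induction_on with
  | empty => simpa using WMon.one
  | insert a s ha ih =>
    rw [sum_insert ha, prod_insert ha]
    exact (h a (mem_insert_self _ _)).mul (ih fun i hi => h i (mem_insert_of_mem hi))

lemma WMon.x_mem (i : Fin r) (j : Fin n) : WMon t x e e (x i j) := by
  simpa using WMon.xmul 0 1 i j (WMon.one (t := t) (x := x) (e := e))

lemma WMon.t_mem : WMon t x e 1 t := by
  simpa using WMon.tmul 0 1 (WMon.one (t := t) (x := x) (e := e))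

lemma WMon.map {R' : Type} [CommRing R'] (f : R →+* R') {D : ℕ} {a : R} (ha : WMon t x e D a) :
    WMon (f t) (fun i j => f (x i j)) e D (f a) := by
  induction ha with
  | one => rw [map_one]; exact .one
  | tmul D a _ ih => rw [map_mul]; exact .tmul _ _ ih
  | xmul D a i j _ ih => rw [map_mul]; exact .xmul _ _ i j ih
  | mono D D1 a h _ ih => exact .mono _ _ _ h ih
end

/-- A geometric Galois covering of the line attached to polynomials `P i`. -/
structure Cover {k : Type} [Field k] {r n : ℕ} (e : ℕ) (P : Fin r → k[X][X]) (R : Type) [CommRing R] [Algebra k R] where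
  t : R
  x : Fin r → Fin n → R
  G : Subgroup (R ≃ₐ[k] R)
  fin : Finite G
  fix : ∀ g ∈ G, g t = t
  gen : Algebra.adjoin k ({t} ∪ {a | ∃ i j, a = x i j}) = ⊤
  factor : ∀ i, (P i).map (aeval t : k[X] →ₐ[k] R).toRingHom = ∏ j, (X - C (x i j))
  inv : ∀ a, (∀ g ∈ G, g a = a) → ∃ p : k[X], a = aeval t p
  deg : ∀ (p : k[X]) (j : ℕ), aeval t p ∈ Submodule.span k {a | WMon t x e j a} → p.natDegree ≤ j
  t0 : k
  iota : R →ₐ[k] PowerSeries k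
  iota_inj : Function.Injective iota
  iota_t : iota t = PowerSeries.C t0 + PowerSeries.X
  basis : ∃ b : Fin (Nat.card G) → R, (∀ j, WMon t x e ((r * n) * (n * e)) (b j)) ∧
    ∀ p : Fin (Nat.card G) → k[X], ∑ j, aeval t (p j) * b j = 0 → p = 0

section
variable {k : Type} [Field k] {L : Type} [Field L] [Algebra (RatFunc k) L] [Algebra k[X] L]
  [IsScalarTower k[X] (RatFunc k) L] [Algebra k L] [IsScalarTower k k[X] L]

open Classical in
/-- the valuation ring at infinity -/
noncomputable def inftyO (k : Type) [Field k] : ValuationSubring (RatFunc k) := (RatFunc.inftyValuation k).valuationSubring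

lemma infty_mem (p : k[X]) (j : ℕ) :
    algebraMap k[X] (RatFunc k) p * ((algebraMap k[X] (RatFunc k) X)⁻¹) ^ j ∈ inftyO k ↔ p.natDegree ≤ j := by
  classical
  rw [inftyO]
  rw [Valuation.mem_valuationSubring_iff]
  by_cases hp : p = 0
  · simp [hp]
  rw [map_mul, map_pow, map_inv₀, RatFunc.inftyValuation_apply, RatFunc.inftyValuation_apply, RatFunc.inftyValuation.polynomial _ hp, RatFunc.inftyValuation.polynomial _ X_ne_zero]
  rw [natDegree_X, ← WithZero.exp_neg, ← WithZero.exp_nsmul, ← WithZero.exp_add, ← WithZero.exp_zero, WithZero.exp_le_exp]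
  simp

lemma cover_deg {r n e : ℕ} (P : Fin r → k[X][X]) (hP : ∀ i, (P i).Monic) (hn : ∀ i, (P i).natDegree = n)
    (he : ∀ i l, ((P i).coeff l).natDegree ≤ e) (x : Fin r → Fin n → L)
    (hx : ∀ i, (P i).map (algebraMap k[X] L) = ∏ j, (X - C (x i j))) (p : k[X]) (j : ℕ)
    (hp : algebraMap k[X] L p ∈ Submodule.span k {a | WMon (algebraMap k[X] L X) x e j a}) : p.natDegree ≤ j := by
  set t := algebraMap k[X] L X with ht
  set τ := algebraMap k[X] (RatFunc k) X with hτ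
  have hτ0 : τ ≠ 0 := by
    rw [hτ]; exact (map_ne_zero_iff _ (IsFractionRing.injective k[X] (RatFunc k))).2 X_ne_zero
  have htτ : algebraMap (RatFunc k) L τ = t := (IsScalarTower.algebraMap_apply k[X] (RatFunc k) L X).symm
  have ht0 : t ≠ 0 := by rw [← htτ]; exact (map_ne_zero_iff _ (algebraMap (RatFunc k) L).injective).2 hτ0
  let O := inftyO k
  have hO : ∀ z ∈ O, IsIntegral O (algebraMap (RatFunc k) L z) := by
    intro z hz
    have : algebraMap (RatFunc k) L z = algebraMap O L ⟨z, hz⟩ := rfl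
    rw [this]
    exact isIntegral_algebraMap
  have htinv : IsIntegral O (t⁻¹) := by
    rw [← htτ, ← map_inv₀]
    apply hO
    have := (infty_mem (1 : k[X]) 1).2 (by simp)
    rwa [map_one, one_mul, pow_one] at this
  have hxi : ∀ i j, IsIntegral O (x i j * (t⁻¹) ^ e) := by
    intro i j
    set Q := ((P i).map (algebraMap k[X] (RatFunc k))).scaleRoots ((τ⁻¹) ^ e) with hQ
    have hQm : Q.Monic := (monic_scaleRoots_iff _).2 ((hP i).map _)
    have hcoe : ∀ l, Q.coeff l ∈ O.toSubring := by
      intro l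
      rw [hQ, coeff_scaleRoots, coeff_map, (hP i).natDegree_map, hn i, ← pow_mul]
      apply (infty_mem _ _).2
      by_cases hl : l < n
      · exact (he i l).trans (Nat.le_mul_of_pos_right _ (by omega))
      · push Not at hl
        rcases hl.eq_or_lt with h | h
        · have : (P i).coeff l = 1 := by rw [← h, ← hn i]; exact hP i
          rw [this]; simp
        · have : (P i).coeff l = 0 := coeff_eq_zero_of_natDegree_lt (by rw [hn i]; exact h)
          rw [this]; simp
    have hroot : (aeval (x i j)) ((P i).map (algebraMap k[X] (RatFunc k))) = 0 := by
      rw [aeval_map_algebraMap, aeval_def, ← eval_map, hx i, eval_prod]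
      exact Finset.prod_eq_zero (mem_univ j) (by simp)
    have hroot2 := scaleRoots_aeval_eq_zero (r := (τ⁻¹) ^ e) hroot
    rw [← hQ, map_pow, map_inv₀, htτ, mul_comm] at hroot2
    refine ⟨Q.toSubring O.toSubring ?_, ?_, ?_⟩
    · intro a ha
      obtain ⟨l, _, rfl⟩ := mem_coeffs_iff.1 ha
      exact hcoe l
    · exact (monic_toSubring _ _ _).2 hQm
    · rw [aeval_def] at hroot2
      have e1 : (Q.toSubring O.toSubring (by
        intro a ha
        obtain ⟨l, _, rfl⟩ := mem_coeffs_iff.1 ha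
        exact hcoe l)).map O.toSubring.subtype = Q := map_toSubring _ _ _
      rw [← hroot2]
      conv_rhs => rw [← e1, eval₂_map]
      rfl
  have hW : ∀ a j, WMon t x e j a → IsIntegral O (a * (t⁻¹) ^ j) := by
    intro a j h
    induction h with
    | one => simpa using isIntegral_one
    | tmul D a _ ih =>
      rw [show t * a * t⁻¹ ^ (D + 1) = a * t⁻¹ ^ D by
        rw [pow_succ, show t * a * (t⁻¹ ^ D * t⁻¹) = a * t⁻¹ ^ D * (t * t⁻¹) by ring, mul_inv_cancel₀ ht0, mul_one]]
      exact ih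
    | xmul D a i j _ ih =>
      rw [show x i j * a * t⁻¹ ^ (D + e) = (x i j * t⁻¹ ^ e) * (a * t⁻¹ ^ D) by ring]
      exact (hxi i j).mul ih
    | mono D D' a h _ ih =>
      rw [show t⁻¹ ^ D' = t⁻¹ ^ D * t⁻¹ ^ (D' - D) by rw [← pow_add]; congr 1; omega, ← mul_assoc]
      exact ih.mul (htinv.pow _)
  have hspan : ∀ a ∈ Submodule.span k {a | WMon t x e j a}, IsIntegral O (a * (t⁻¹) ^ j) := by
    intro a ha
    induction ha using Submodule.span_induction with
    | mem a h => exact hW a j h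
    | zero => simpa using isIntegral_zero
    | add a b _ _ iha ihb => rw [add_mul]; exact iha.add ihb
    | smul c a _ ih =>
      rw [Algebra.smul_def, mul_assoc]
      refine IsIntegral.mul ?_ ih
      rw [IsScalarTower.algebraMap_apply k k[X] L, IsScalarTower.algebraMap_apply k[X] (RatFunc k) L]
      apply hO
      have := (infty_mem (C c) 0).2 (by simp)
      simpa using this
  have h1 := hspan _ hp
  rw [IsScalarTower.algebraMap_apply k[X] (RatFunc k) L, ← htτ, ← map_inv₀, ← map_pow, ← map_mul] at h1
  have h2 : IsIntegral O (algebraMap k[X] (RatFunc k) p * (τ⁻¹) ^ j) :=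
    (isIntegral_algebraMap_iff (algebraMap (RatFunc k) L).injective).1 h1
  obtain ⟨z, hz⟩ := IsIntegrallyClosed.isIntegral_iff.1 h2
  rw [← infty_mem (k := k), ← hτ, ← hz]
  exact z.2

lemma cover_span {r n e : ℕ} (P : Fin r → k[X][X]) (hP : ∀ i, (P i).Monic) (hn : ∀ i, (P i).natDegree = n)
    (x : Fin r → Fin n → L)
    (hx : ∀ i, (P i).map (algebraMap k[X] L) = ∏ j, (X - C (x i j)))
    (hgen : Algebra.adjoin (RatFunc k) {a | ∃ i j, a = x i j} = ⊤) :
    Submodule.span (RatFunc k) {a : L | WMon (algebraMap k[X] L X) x e ((r * n) * (n * e)) a} = ⊤ := by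
  classical
  let S : Submodule (RatFunc k) L := Submodule.span _ {a | ∃ β : Fin r × Fin n → ℕ, (∀ l, β l < n) ∧ a = ∏ l, x l.1 l.2 ^ β l}
  have hS : S ≤ Submodule.span (RatFunc k) {a : L | WMon (algebraMap k[X] L X) x e ((r * n) * (n * e)) a} := by
    apply Submodule.span_mono
    rintro a ⟨β, hβ, rfl⟩
    have h1 := WMon.prod (t := algebraMap k[X] L X) (x := x) (e := e) univ (fun l => x l.1 l.2 ^ β l) (fun l => β l * e)
      (fun l _ => (WMon.x_mem l.1 l.2).pow _)
    refine WMon.mono _ _ _ ?_ h1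
    calc ∑ l, β l * e ≤ ∑ l : Fin r × Fin n, n * e := sum_le_sum fun l _ => Nat.mul_le_mul_right _ (hβ l).le
      _ = _ := by simp
  rw [eq_top_iff]
  refine le_trans ?_ hS
  have hone : (1 : L) ∈ S := by
    apply Submodule.subset_span
    exact ⟨0, fun l => l.2.pos, by simp⟩
  have hmul : ∀ i j, ∀ a ∈ S, x i j * a ∈ S := by
    intro i j a ha
    induction ha using Submodule.span_induction with
    | zero => simp
    | add a b _ _ iha ihb => rw [mul_add]; exact S.add_mem iha ihb
    | smul c a _ ih => rw [mul_smul_comm]; exact S.smul_mem c ih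
    | mem a h =>
      obtain ⟨β, hβ, rfl⟩ := h
      have hupd : ∀ m, (∏ l, x l.1 l.2 ^ (Function.update β (i, j) m) l) = x i j ^ m * ∏ l ∈ univ.erase (i, j), x l.1 l.2 ^ β l := by
        intro m
        rw [← Finset.mul_prod_erase univ _ (mem_univ (i, j)), Function.update_self]
        congr 1
        refine Finset.prod_congr rfl fun l hl => ?_
        rw [Function.update_of_ne (Finset.ne_of_mem_erase hl)]
      have hred : ∀ m < n, x i j ^ m * ∏ l ∈ univ.erase (i, j), x l.1 l.2 ^ β l ∈ S := by
        intro m hm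
        apply Submodule.subset_span
        refine ⟨Function.update β (i, j) m, ?_, (hupd m).symm⟩
        intro l
        by_cases hl : l = (i, j)
        · subst hl; simpa using hm
        · rw [Function.update_of_ne hl]; exact hβ l
      have e1 : x i j * ∏ l, x l.1 l.2 ^ β l = x i j ^ (β (i, j) + 1) * ∏ l ∈ univ.erase (i, j), x l.1 l.2 ^ β l := by
        rw [← Finset.mul_prod_erase univ _ (mem_univ (i, j)), pow_succ']
        ring
      rw [e1]
      by_cases hlt : β (i, j) + 1 < n
      · exact hred _ hlt
      · have hb : β (i, j) + 1 = n := by have := hβ (i, j); omega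
        have hroot : (P i).eval₂ (algebraMap k[X] L) (x i j) = 0 := by
          rw [← eval_map, hx i, eval_prod]
          exact Finset.prod_eq_zero (mem_univ j) (by simp)
        rw [eval₂_eq_sum_range, hn i, Finset.sum_range_succ] at hroot
        have hlc : (P i).coeff n = 1 := by rw [← hn i]; exact hP i
        rw [hlc, map_one, one_mul] at hroot
        rw [hb, eq_neg_of_add_eq_zero_right hroot, neg_mul, Finset.sum_mul]
        refine S.neg_mem (S.sum_mem fun l hl => ?_)
        rw [mul_assoc, IsScalarTower.algebraMap_apply k[X] (RatFunc k) L, ← Algebra.smul_def]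
        exact S.smul_mem _ (hred l (mem_range.1 hl))
  have hall : ∀ a : L, ∀ b ∈ S, a * b ∈ S := by
    intro a
    have ha : a ∈ Algebra.adjoin (RatFunc k) {a | ∃ i j, a = x i j} := by rw [hgen]; trivial
    induction ha using Algebra.adjoin_induction with
    | mem a h => obtain ⟨i, j, rfl⟩ := h; exact hmul i j
    | algebraMap c => intro b hb; rw [← Algebra.smul_def]; exact S.smul_mem c hb
    | add a b _ _ iha ihb => intro c hc; rw [add_mul]; exact S.add_mem (iha c hc) (ihb c hc)
    | mul a b _ _ iha ihb => intro c hc; rw [mul_assoc]; exact iha _ (ihb c hc)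
  intro a _
  simpa using hall a 1 hone

end

end

section
open Finset Polynomial

section
variable {k : Type} [Field k] {L : Type} [Field L] [Algebra (RatFunc k) L] [Algebra k[X] L]
  [IsScalarTower k[X] (RatFunc k) L] [Algebra k L] [IsScalarTower k k[X] L]

/-- restricting a field automorphism to a stable subalgebra -/
lemma restrict_aut (R : Subalgebra k L) (s : L ≃ₐ[k] L) (h1 : ∀ a ∈ R, s a ∈ R) (h2 : ∀ a ∈ R, s.symm a ∈ R) :
    ∃ g : R ≃ₐ[k] R, ∀ a : R, ((g a : R) : L) = s a := by
  refine ⟨AlgEquiv.ofAlgHom ((s.toAlgHom.comp R.val).codRestrict R (fun a => h1 a a.2))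
    ((s.symm.toAlgHom.comp R.val).codRestrict R (fun a => h2 a a.2)) ?_ ?_, fun a => rfl⟩
  · ext a; exact s.apply_symm_apply a
  · ext a; exact s.symm_apply_apply a

lemma cover_of_field [FiniteDimensional (RatFunc k) L] [IsGalois (RatFunc k) L]
    {r n e : ℕ} (P : Fin r → k[X][X]) (hP : ∀ i, (P i).Monic) (hn : ∀ i, (P i).natDegree = n)
    (he : ∀ i l, ((P i).coeff l).natDegree ≤ e) (x : Fin r → Fin n → L)
    (hx : ∀ i, (P i).map (algebraMap k[X] L) = ∏ j, (X - C (x i j)))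
    (hgen : Algebra.adjoin (RatFunc k) {a | ∃ i j, a = x i j} = ⊤) (t0 : k)
    {Ω : Type} [Field Ω] [Algebra k Ω] (Λ : L →ₐ[k] Ω) (J : PowerSeries k →ₐ[k] Ω) (hJ : Function.Injective J)
    (ht : Λ (algebraMap k[X] L X) = J (PowerSeries.C t0 + PowerSeries.X))
    (hξ : ∀ i j, Λ (x i j) ∈ J.range) :
    ∃ (R : Type) (_ : CommRing R) (_ : IsDomain R) (_ : Algebra k R), Nonempty (Cover (n := n) e P R) := by
  classical
  have : IsScalarTower k (RatFunc k) L := by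
    apply IsScalarTower.of_algebraMap_eq
    intro c
    rw [IsScalarTower.algebraMap_apply k k[X] L, IsScalarTower.algebraMap_apply k[X] (RatFunc k) L,
      IsScalarTower.algebraMap_apply k k[X] (RatFunc k)]
  set τ := algebraMap k[X] L X with hτ
  let S : Set L := {τ} ∪ {a | ∃ i j, a = x i j}
  let R : Subalgebra k L := Algebra.adjoin k S
  have hτR : τ ∈ R := Algebra.subset_adjoin (Or.inl rfl)
  have hxR : ∀ i j, x i j ∈ R := fun i j => Algebra.subset_adjoin (Or.inr ⟨i, j, rfl⟩)
  have hae : ∀ p : k[X], aeval τ p = algebraMap k[X] L p := by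
    intro p
    have : (aeval τ : k[X] →ₐ[k] L) = IsScalarTower.toAlgHom k k[X] L := by
      apply Polynomial.algHom_ext; simp [hτ]
    rw [this]; rfl
  -- automorphisms permute the roots
  have hperm : ∀ (s : L ≃ₐ[RatFunc k] L) i j, ∃ j', s (x i j) = x i j' := by
    intro s i j
    have h0 : (P i).eval₂ (algebraMap k[X] L) (x i j) = 0 := by
      rw [← eval_map, hx i, eval_prod]
      exact Finset.prod_eq_zero (mem_univ j) (by simp)
    have hc : s.toRingEquiv.toRingHom.comp (algebraMap k[X] L) = algebraMap k[X] L := by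
      refine RingHom.ext fun p => ?_
      rw [RingHom.comp_apply, IsScalarTower.algebraMap_apply k[X] (RatFunc k) L]
      exact s.commutes _
    have h1 : (P i).eval₂ (algebraMap k[X] L) (s (x i j)) = 0 := by
      have := congrArg s.toRingEquiv.toRingHom h0
      rw [hom_eval₂, hc, map_zero] at this
      exact this
    rw [← eval_map, hx i, eval_prod, Finset.prod_eq_zero_iff] at h1
    obtain ⟨j', _, h⟩ := h1
    refine ⟨j', ?_⟩
    simpa [sub_eq_zero] using h
  have hst : ∀ s : L ≃ₐ[RatFunc k] L, s τ = τ := by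
    intro s
    rw [hτ, IsScalarTower.algebraMap_apply k[X] (RatFunc k) L]
    exact s.commutes _
  have hsR : ∀ (s : L ≃ₐ[RatFunc k] L), ∀ a ∈ R, s a ∈ R := by
    intro s a ha
    have : R ≤ R.comap ((s.restrictScalars k).toAlgHom) := by
      apply Algebra.adjoin_le
      rintro a (h | ⟨i, j, h⟩)
      · rw [Set.mem_singleton_iff] at h
        subst h
        change s τ ∈ R
        rw [hst]; exact hτR
      · subst h
        obtain ⟨j', h⟩ := hperm s i j
        change s (x i j) ∈ R
        rw [h]; exact hxR i j'
    exact this ha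
  have hres : ∀ s : L ≃ₐ[RatFunc k] L, ∃ g : R ≃ₐ[k] R, ∀ a : R, ((g a : R) : L) = s a := by
    intro s
    exact restrict_aut R (s.restrictScalars k) (hsR s) (hsR s.symm)
  choose Φ hΦ using hres
  let ΦH : (L ≃ₐ[RatFunc k] L) →* (R ≃ₐ[k] R) := MonoidHom.mk' Φ (by
    intro a b
    ext c
    rw [hΦ, AlgEquiv.mul_apply, AlgEquiv.mul_apply, hΦ, hΦ])
  have hinj : Function.Injective ΦH := by
    rw [injective_iff_map_eq_one]
    intro s hs
    have h1 : ∀ i j, s (x i j) = x i j := by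
      intro i j
      have := hΦ s ⟨x i j, hxR i j⟩
      change ((ΦH s _ : R) : L) = _ at this
      rw [hs] at this
      exact this.symm
    ext a
    have ha : a ∈ Algebra.adjoin (RatFunc k) {a | ∃ i j, a = x i j} := by rw [hgen]; trivial
    have : Algebra.adjoin (RatFunc k) {a | ∃ i j, a = x i j} ≤ AlgHom.equalizer s.toAlgHom (AlgHom.id _ _) := by
      apply Algebra.adjoin_le
      rintro _ ⟨i, j, rfl⟩
      exact h1 i j
    exact this ha
  have hcard : Nat.card ΦH.range = Module.finrank (RatFunc k) L := by
    rw [← IsGalois.card_aut_eq_finrank, Nat.card_congr (ΦH.ofInjective hinj).toEquiv]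
  let t : R := ⟨τ, hτR⟩
  let y : Fin r → Fin n → R := fun i j => ⟨x i j, hxR i j⟩
  have haet : ∀ p : k[X], ((aeval t p : R) : L) = algebraMap k[X] L p := by
    intro p
    rw [← hae]
    exact (aeval_algHom_apply R.val t p).symm
  have hfin : Finite ΦH.range := Finite.of_surjective ΦH.rangeRestrict ΦH.rangeRestrict_surjective
  -- image of R under Λ
  have hΛ : ∀ a : R, Λ a ∈ J.range := by
    have : R ≤ J.range.comap Λ := by
      apply Algebra.adjoin_le
      rintro a (h | ⟨i, j, h⟩)
      · rw [Set.mem_singleton_iff] at h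
        subst h
        exact ⟨_, ht.symm⟩
      · subst h
        exact hξ i j
    exact fun a => this a.2
  let ι : R →ₐ[k] PowerSeries k := ((AlgEquiv.ofInjective J hJ).symm.toAlgHom).comp ((Λ.comp R.val).codRestrict J.range hΛ)
  have hι : ∀ a : R, J (ι a) = Λ a := by
    intro a
    have := (AlgEquiv.ofInjective J hJ).apply_symm_apply ((Λ.comp R.val).codRestrict J.range hΛ a)
    exact congrArg Subtype.val this
  have hW : ∀ D (a : R), WMon t y e D a → WMon τ x e D (a : L) := fun D a h => h.map (R.val : R →+* L)
  have hW' : ∀ D (a : L), WMon τ x e D a → ∃ b : R, (b : L) = a ∧ WMon t y e D b := by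
    intro D a h
    induction h with
    | one => exact ⟨1, rfl, .one⟩
    | tmul D a _ ih => obtain ⟨b, rfl, hb⟩ := ih; exact ⟨t * b, rfl, .tmul _ _ hb⟩
    | xmul D a i j _ ih => obtain ⟨b, rfl, hb⟩ := ih; exact ⟨y i j * b, rfl, .xmul _ _ _ _ hb⟩
    | mono D D' a h _ ih => obtain ⟨b, rfl, hb⟩ := ih; exact ⟨b, rfl, .mono _ _ _ h hb⟩
  refine ⟨R, inferInstance, inferInstance, inferInstance, ⟨{
    t := t
    x := y
    G := ΦH.range
    fin := hfin
    fix := ?_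
    gen := ?_
    factor := ?_
    inv := ?_
    deg := ?_
    t0 := t0
    iota := ι
    iota_inj := ?_
    iota_t := ?_
    basis := ?_ }⟩⟩
  · rintro _ ⟨s, rfl⟩
    apply Subtype.ext
    exact (hΦ s t).trans (hst s)
  · have h1 := Algebra.adjoin_adjoin_coe_preimage (R := k) (s := S)
    rw [← h1]
    congr 1
    ext a
    constructor
    · rintro (h | ⟨i, j, h⟩)
      · rw [Set.mem_singleton_iff] at h; subst h; exact Or.inl rfl
      · subst h; exact Or.inr ⟨i, j, rfl⟩
    · rintro (h | ⟨i, j, h⟩)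
      · left; exact Subtype.ext h
      · right; exact ⟨i, j, Subtype.ext h⟩
  · intro i
    apply Polynomial.map_injective (R.val : R →+* L) Subtype.val_injective
    rw [Polynomial.map_map, Polynomial.map_prod]
    have : (R.val : R →+* L).comp (aeval t : k[X] →ₐ[k] R).toRingHom = algebraMap k[X] L := by
      exact RingHom.ext haet
    rw [this, hx i]
    refine Finset.prod_congr rfl fun j _ => ?_
    simp [y]
  · intro a ha
    have h1 : ∀ s : L ≃ₐ[RatFunc k] L, s (a : L) = a := by
      intro s
      rw [← hΦ s a]
      exact congrArg Subtype.val (ha (ΦH s) ⟨s, rfl⟩)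
    obtain ⟨z, hz⟩ := (IsGalois.mem_range_algebraMap_iff_fixed (F := RatFunc k) (a : L)).2 h1
    have hint : IsIntegral k[X] (a : L) := by
      have : R ≤ (integralClosure k[X] L).restrictScalars k := by
        apply Algebra.adjoin_le
        rintro a (h | ⟨i, j, h⟩)
        · rw [Set.mem_singleton_iff] at h
          subst h
          exact isIntegral_algebraMap
        · subst h
          refine ⟨P i, hP i, ?_⟩
          rw [← eval_map, hx i, eval_prod]
          exact Finset.prod_eq_zero (mem_univ j) (by simp)
      exact this a.2
    rw [← hz] at hint
    have h2 : IsIntegral k[X] z := (isIntegral_algebraMap_iff (algebraMap (RatFunc k) L).injective).1 hint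
    obtain ⟨p, hp⟩ := IsIntegrallyClosed.isIntegral_iff.1 h2
    refine ⟨p, Subtype.ext ?_⟩
    rw [haet, ← hz, ← hp, ← IsScalarTower.algebraMap_apply]
  · intro p j hp
    apply cover_deg P hP hn he x hx p j
    have h0 := haet p
    change R.val.toLinearMap (aeval t p) = _ at h0
    rw [← h0]
    have := Submodule.mem_map_of_mem (f := R.val.toLinearMap) hp
    rw [Submodule.map_span] at this
    refine Submodule.span_mono ?_ this
    rintro _ ⟨a, ha, rfl⟩
    exact hW _ _ ha
  · intro a b hab
    apply Subtype.ext
    apply Λ.toRingHom.injective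
    have := congrArg J hab
    rw [hι, hι] at this
    exact this
  · apply hJ
    rw [hι]; exact ht
  · have hspan := cover_span (e := e) P hP hn x hx hgen
    rw [hcard]
    obtain ⟨f, hf1, hf2, hf3⟩ := Submodule.exists_fun_fin_finrank_span_eq (RatFunc k) {a : L | WMon τ x e ((r * n) * (n * e)) a}
    have hd : Module.finrank (RatFunc k) L = Module.finrank (RatFunc k)
        (Submodule.span (RatFunc k) {a : L | WMon τ x e ((r * n) * (n * e)) a}) := by
      rw [hspan, finrank_top]
    have hb : ∀ j : Fin (Module.finrank (RatFunc k) L), ∃ b : R, (b : L) = f (Fin.cast hd j) ∧ WMon t y e ((r * n) * (n * e)) b :=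
      fun j => hW' _ _ (hf1 _)
    choose b hb1 hb2 using hb
    refine ⟨b, hb2, fun p hp => ?_⟩
    have hli := hf3.comp (Fin.cast hd) (Fin.cast_injective hd)
    rw [Fintype.linearIndependent_iff] at hli
    have hz := hli (fun j => algebraMap k[X] (RatFunc k) (p j)) (by
      have := congrArg (Subtype.val : R → L) hp
      rw [AddSubmonoidClass.coe_finset_sum] at this
      rw [← ZeroMemClass.coe_zero R, ← this]
      refine Finset.sum_congr rfl fun j _ => ?_
      rw [Algebra.smul_def, ← IsScalarTower.algebraMap_apply, Function.comp_apply, ← hb1, ← haet]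
      rfl)
    funext j
    exact (map_eq_zero_iff _ (IsFractionRing.injective k[X] (RatFunc k))).1 (hz j)
end

section
variable {k : Type} [Field k]

lemma exists_cover_aux {r n e : ℕ} (P : Fin r → k[X][X]) (hP : ∀ i, (P i).Monic) (hn : ∀ i, (P i).natDegree = n)
    (he : ∀ i l, ((P i).coeff l).natDegree ≤ e) (t0 : k) (ξ : Fin r → Fin n → PowerSeries k)
    (hξi : ∀ i, Function.Injective (ξ i))
    (hξ : ∀ i, (P i).map (psExp t0).toRingHom = ∏ j, (X - C (ξ i j)))
    {Ω : Type} [Field Ω] [Algebra k Ω] (J : PowerSeries k →ₐ[k] Ω) (hJ : Function.Injective J) :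
    ∃ (R : Type) (_ : CommRing R) (_ : IsDomain R) (_ : Algebra k R), Nonempty (Cover (n := n) e P R) := by
  classical
  let ψ0 : k[X] →ₐ[k] Ω := J.comp (psExp t0)
  have hψ0 : Function.Injective ψ0 := hJ.comp (psExp_inj t0)
  let ψ : RatFunc k →+* Ω := IsFractionRing.lift (A := k[X]) (g := ψ0.toRingHom) hψ0
  have hψ : ∀ p : k[X], ψ (algebraMap k[X] (RatFunc k) p) = ψ0 p := fun p => IsFractionRing.lift_algebraMap hψ0 p
  letI : Algebra (RatFunc k) Ω := ψ.toAlgebra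
  let f : (RatFunc k)[X] := ∏ i, (P i).map (algebraMap k[X] (RatFunc k))
  have hmap : ∀ i, ((P i).map (algebraMap k[X] (RatFunc k))).map (algebraMap (RatFunc k) Ω) = ∏ j, (X - C (J (ξ i j))) := by
    intro i
    have h1 : (algebraMap (RatFunc k) Ω).comp (algebraMap k[X] (RatFunc k)) = (J.toRingHom).comp (psExp t0).toRingHom :=
      RingHom.ext hψ
    rw [Polynomial.map_map, h1, ← Polynomial.map_map, hξ, Polynomial.map_prod]
    refine Finset.prod_congr rfl fun j _ => ?_
    simp
  have hsepi : ∀ i, ((P i).map (algebraMap k[X] (RatFunc k))).Separable := by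
    intro i
    rw [← separable_map (algebraMap (RatFunc k) Ω), hmap, separable_prod_X_sub_C_iff]
    exact hJ.comp (hξi i)
  have hfs : (f.map (algebraMap (RatFunc k) Ω)).Splits := by
    rw [Polynomial.map_prod]
    apply Splits.prod
    intro i _
    rw [hmap]
    exact Splits.prod fun j _ => Splits.X_sub_C _
  have hf0 : f ≠ 0 := Finset.prod_ne_zero_iff.2 fun i _ => ((hP i).map _).ne_zero
  have hroots : f.rootSet Ω = {a | ∃ i j, a = J (ξ i j)} := by
    ext a
    rw [mem_rootSet_of_ne hf0, aeval_def, ← eval_map, Polynomial.map_prod, eval_prod, Finset.prod_eq_zero_iff]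
    simp only [hmap, eval_prod, Finset.prod_eq_zero_iff, mem_univ, true_and, eval_sub, eval_X, eval_C, sub_eq_zero]
    rfl
  let L := IntermediateField.adjoin (RatFunc k) (f.rootSet Ω)
  have hsplit : f.IsSplittingField (RatFunc k) L := IntermediateField.adjoin_rootSet_isSplittingField hfs
  have hnorm : Normal (RatFunc k) L := Normal.of_isSplittingField f
  have hsep : Algebra.IsSeparable (RatFunc k) L := by
    rw [IntermediateField.isSeparable_adjoin_iff_isSeparable]
    intro a ha
    rw [hroots] at ha
    obtain ⟨i, j, rfl⟩ := ha
    apply (hsepi i).of_dvd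
    apply minpoly.dvd
    rw [aeval_def, ← eval_map, hmap, eval_prod]
    exact Finset.prod_eq_zero (mem_univ j) (by simp)
  have hgal : IsGalois (RatFunc k) L := ⟨⟩
  have hfd : FiniteDimensional (RatFunc k) L := IsSplittingField.finiteDimensional L f
  letI : Algebra k[X] L := ((algebraMap (RatFunc k) L).comp (algebraMap k[X] (RatFunc k))).toAlgebra
  have i1 : IsScalarTower k[X] (RatFunc k) L := IsScalarTower.of_algebraMap_eq' rfl
  letI ak : Algebra k L := ((algebraMap k[X] L).comp (algebraMap k k[X])).toAlgebra
  have i2 : IsScalarTower k k[X] L := IsScalarTower.of_algebraMap_eq' rfl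
  have hmem : ∀ i j, J (ξ i j) ∈ L := by
    intro i j
    apply IntermediateField.subset_adjoin
    rw [hroots]
    exact ⟨i, j, rfl⟩
  let x : Fin r → Fin n → L := fun i j => ⟨J (ξ i j), hmem i j⟩
  have hval : ∀ p : k[X], ((algebraMap k[X] L p : L) : Ω) = ψ0 p := fun p => hψ p
  let Λ : L →ₐ[k] Ω := { L.val.toRingHom with
    commutes' := by
      intro c
      change ((algebraMap k[X] L (C c) : L) : Ω) = _
      rw [hval]
      exact ψ0.commutes c }
  refine cover_of_field (L := L) P hP hn he x ?_ ?_ t0 Λ J hJ ?_ ?_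
  · intro i
    apply Polynomial.map_injective L.val.toRingHom Subtype.val_injective
    have := hmap i
    rw [Polynomial.map_map] at this ⊢
    refine (Eq.trans ?_ this).trans ?_
    · rfl
    · rw [Polynomial.map_prod]
      refine Finset.prod_congr rfl fun j _ => ?_
      rw [Polynomial.map_sub, map_X, map_C]
      rfl
  · have h1 := hsplit.adjoin_rootSet
    rw [← h1]
    congr 1
    ext a
    rw [mem_rootSet_of_ne hf0]
    have h2 : aeval a f = 0 ↔ (a : Ω) ∈ f.rootSet Ω := by
      have h3 : aeval (a : Ω) f = ((aeval a f : L) : Ω) := aeval_algHom_apply L.val a f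
      rw [mem_rootSet_of_ne hf0, h3]
      exact ⟨fun h => by rw [h]; rfl, fun h => Subtype.ext h⟩
    rw [h2, hroots]
    constructor
    · rintro ⟨i, j, rfl⟩; exact ⟨i, j, rfl⟩
    · rintro ⟨i, j, h⟩; exact ⟨i, j, Subtype.ext h⟩
  · change ((algebraMap k[X] L X : L) : Ω) = _
    rw [hval]
    simp [ψ0, psExp]
  · intro i j
    exact ⟨ξ i j, rfl⟩

theorem exists_cover [IsAlgClosed k] {r n e : ℕ} (P : Fin r → k[X][X]) (hP : ∀ i, (P i).Monic) (hn : ∀ i, (P i).natDegree = n)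
    (he : ∀ i l, ((P i).coeff l).natDegree ≤ e) (t0 : k) (hs : ∀ i, ((P i).map (evalRingHom t0)).Separable) :
    ∃ (R : Type) (_ : CommRing R) (_ : IsDomain R) (_ : Algebra k R), Nonempty (Cover (n := n) e P R) := by
  choose ξ h1 h2 using fun i => hensel_roots (P i) (hP i) (hn i) t0 (hs i)
  exact exists_cover_aux P hP hn he t0 ξ h1 h2 (Algebra.algHom k (PowerSeries k) (FractionRing (PowerSeries k)))
    (IsFractionRing.injective (PowerSeries k) (FractionRing (PowerSeries k)))
end

end

section
open Finset Polynomial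

namespace Cover
variable {k R : Type} [Field k] [CommRing R] [IsDomain R] [Algebra k R] {r n e : ℕ} {P : Fin r → k[X][X]}
  (A : Cover (n := n) e P R)

/-- filtration -/
def V (i : ℕ) : Submodule k R := Submodule.span k {a | WMon A.t A.x e i a}

lemma V_of {i : ℕ} {a : R} (h : WMon A.t A.x e i a) : a ∈ A.V i := Submodule.subset_span h

lemma V_mono {i j : ℕ} (h : i ≤ j) : A.V i ≤ A.V j :=
  Submodule.span_mono fun _ ha => WMon.mono _ _ _ h ha

lemma V_mul {i j : ℕ} {a b : R} (ha : a ∈ A.V i) (hb : b ∈ A.V j) : a * b ∈ A.V (i + j) := by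
  induction ha using Submodule.span_induction with
  | zero => simp
  | add a c _ _ h1 h2 => rw [add_mul]; exact add_mem h1 h2
  | smul c a _ h => rw [smul_mul_assoc]; exact Submodule.smul_mem _ _ h
  | mem a ha =>
    induction hb using Submodule.span_induction with
    | zero => simp
    | add a c _ _ h1 h2 => rw [mul_add]; exact add_mem h1 h2
    | smul c a _ h => rw [mul_smul_comm]; exact Submodule.smul_mem _ _ h
    | mem b hb => exact A.V_of (WMon.mul ha hb)

lemma V_one : (1 : R) ∈ A.V 0 := A.V_of .one

lemma V_prod {ι : Type} (s : Finset ι) (f : ι → R) (D : ℕ) (h : ∀ i ∈ s, f i ∈ A.V D) :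
    (∏ i ∈ s, f i) ∈ A.V (#s * D) := by
  classical
  induction s using Finset.induction_on with
  | empty => simpa using A.V_one
  | insert a s ha ih =>
    rw [prod_insert ha, card_insert_of_notMem ha, Nat.succ_mul, Nat.add_comm]
    exact A.V_mul (h a (mem_insert_self _ _)) (ih fun i hi => h i (mem_insert_of_mem hi))

lemma V_t (p : k[X]) : aeval A.t p ∈ A.V p.natDegree := by
  rw [aeval_eq_sum_range]
  refine Submodule.sum_mem _ fun i hi => Submodule.smul_mem _ _ ?_
  have h1 := (WMon.t_mem (t := A.t) (x := A.x) (e := e)).pow i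
  rw [mul_one] at h1
  exact A.V_mono (by rw [mem_range] at hi; omega) (A.V_of h1)

lemma V_x (i : Fin r) (j : Fin n) (m : ℕ) : A.x i j ^ m ∈ A.V (m * e) := A.V_of ((WMon.x_mem i j).pow m)

lemma root (i : Fin r) (j : Fin n) : ((P i).map (aeval A.t : k[X] →ₐ[k] R).toRingHom).eval (A.x i j) = 0 := by
  rw [A.factor, eval_prod]
  exact Finset.prod_eq_zero (mem_univ j) (by simp)

lemma perm (g : R ≃ₐ[k] R) (hg : g ∈ A.G) (i : Fin r) (j : Fin n) : ∃ j', g (A.x i j) = A.x i j' := by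
  have h0 := A.root i j
  rw [eval_map] at h0
  have hc : (g : R →+* R).comp (aeval A.t : k[X] →ₐ[k] R).toRingHom = (aeval A.t : k[X] →ₐ[k] R).toRingHom := by
    refine RingHom.ext fun p => ?_
    change g (aeval A.t p) = aeval A.t p
    have h3 := aeval_algHom_apply g.toAlgHom A.t p
    change aeval (g A.t) p = g (aeval A.t p) at h3
    rw [← h3, A.fix g hg]
  have h1 := congrArg (g : R →+* R) h0
  rw [hom_eval₂, hc, map_zero, ← eval_map, A.factor, eval_prod, Finset.prod_eq_zero_iff] at h1
  obtain ⟨j', _, h⟩ := h1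
  exact ⟨j', by simpa [sub_eq_zero] using h⟩

lemma fix_aeval (g : R ≃ₐ[k] R) (hg : g ∈ A.G) (p : k[X]) : g (aeval A.t p) = aeval A.t p := by
  have := aeval_algHom_apply g.toAlgHom A.t p
  change aeval (g A.t) p = g (aeval A.t p) at this
  rw [← this, A.fix g hg]

lemma WMon_map (g : R ≃ₐ[k] R) (hg : g ∈ A.G) {i : ℕ} {a : R} (h : WMon A.t A.x e i a) : WMon A.t A.x e i (g a) := by
  induction h with
  | one => rw [map_one]; exact .one
  | tmul D a _ ih => rw [map_mul, A.fix g hg]; exact .tmul _ _ ih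
  | xmul D a i j _ ih => obtain ⟨j', h⟩ := A.perm g hg i j; rw [map_mul, h]; exact .xmul _ _ i j' ih
  | mono D D1 a h _ ih => exact .mono _ _ _ h ih

lemma V_map (g : R ≃ₐ[k] R) (hg : g ∈ A.G) {i : ℕ} {a : R} (h : a ∈ A.V i) : g a ∈ A.V i := by
  have := Submodule.mem_map_of_mem (f := g.toAlgHom.toLinearMap) h
  rw [V, Submodule.map_span] at this
  refine Submodule.span_mono ?_ this
  rintro _ ⟨a, ha, rfl⟩
  exact A.WMon_map g hg ha

lemma iota_aeval (p : k[X]) : A.iota (aeval A.t p) = psExp A.t0 p := by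
  rw [← aeval_algHom_apply, A.iota_t]
  rfl

lemma t_inj (p : k[X]) (h : aeval A.t p = 0) : p = 0 := by
  apply (map_eq_zero_iff _ (psExp_inj A.t0)).1
  rw [← A.iota_aeval, h, map_zero]

/-- the norm -/
lemma norm_exists (a : R) : ∃ p : k[X], aeval A.t p = ∏ᶠ g : A.G, g.1 a := by
  have := A.fin
  obtain ⟨p, hp⟩ := A.inv (∏ᶠ g : A.G, g.1 a) (by
    intro h hh
    cases nonempty_fintype A.G
    rw [finprod_eq_prod_of_fintype, map_prod]
    exact Fintype.prod_equiv (Equiv.mulLeft (⟨h, hh⟩ : A.G)) _ _ (fun g => rfl))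
  exact ⟨p, hp.symm⟩

lemma iota_order (i : ℕ) (a : R) (ha : a ∈ A.V i) (h0 : a ≠ 0) :
    ∃ o ≤ Nat.card A.G * i, PowerSeries.coeff o (A.iota a) ≠ 0 := by
  classical
  have := A.fin
  cases nonempty_fintype A.G
  obtain ⟨p, hp⟩ := A.norm_exists a
  rw [finprod_eq_prod_of_fintype] at hp
  have hne : p ≠ 0 := by
    rintro rfl
    rw [map_zero] at hp
    obtain ⟨g, _, hg⟩ := Finset.prod_eq_zero_iff.1 hp.symm
    exact h0 ((map_eq_zero_iff _ g.1.injective).1 hg)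
  have hdeg : p.natDegree ≤ Nat.card A.G * i := by
    apply A.deg
    rw [hp, Nat.card_eq_fintype_card, ← Finset.card_univ]
    exact A.V_prod _ _ _ fun g _ => A.V_map g.1 g.2 ha
  obtain ⟨o, ho, hco⟩ := psExp_coeff_ne A.t0 p hne
  rw [← A.iota_aeval, hp, ← Finset.mul_prod_erase univ _ (mem_univ 1), map_mul, PowerSeries.coeff_mul] at hco
  obtain ⟨⟨u, v⟩, huv, hne2⟩ := Finset.exists_ne_zero_of_sum_ne_zero hco
  rw [HasAntidiagonal.mem_antidiagonal] at huv
  refine ⟨u, ?_, left_ne_zero_of_mul hne2⟩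
  simp only at huv
  omega

lemma V_fin (i : ℕ) : FiniteDimensional k (A.V i) := by
  let φ : A.V i →ₗ[k] (Fin (Nat.card A.G * i + 1) → k) :=
    LinearMap.pi fun o => (PowerSeries.coeff (R := k) o.1).comp (A.iota.toLinearMap.comp (A.V i).subtype)
  refine FiniteDimensional.of_injective φ ?_
  rw [injective_iff_map_eq_zero]
  intro a ha
  by_contra hne
  obtain ⟨o, ho, hc⟩ := A.iota_order i a a.2 (fun h => hne (Subtype.ext h))
  exact hc (congrFun ha ⟨o, by omega⟩)

lemma lower (i : ℕ) : Nat.card A.G * i ≤ Module.finrank k (A.V (i + (r * n) * (n * e))) := by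
  have := A.V_fin (i + (r * n) * (n * e))
  obtain ⟨b, hb, hli⟩ := A.basis
  let f : Fin (Nat.card A.G) × Fin i → A.V (i + (r * n) * (n * e)) := fun l =>
    ⟨A.t ^ l.2.1 * b l.1, by
      have h1 := (WMon.t_mem (t := A.t) (x := A.x) (e := e)).pow l.2.1
      rw [mul_one] at h1
      exact A.V_mono (by have := l.2.2; omega) (A.V_of (h1.mul (hb l.1)))⟩
  have hf : LinearIndependent k f := by
    rw [Fintype.linearIndependent_iff]
    intro c hc
    have h1 := congrArg Subtype.val hc
    rw [AddSubmonoidClass.coe_finset_sum, Fintype.sum_prod_type] at h1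
    have h2 := hli (fun j => ∑ a : Fin i, C (c (j, a)) * X ^ a.1) (by
      rw [← ZeroMemClass.coe_zero (A.V (i + (r * n) * (n * e))), ← h1]
      refine Finset.sum_congr rfl fun j _ => ?_
      rw [map_sum, Finset.sum_mul]
      refine Finset.sum_congr rfl fun a _ => ?_
      simp [f, Algebra.smul_def, mul_assoc])
    rintro ⟨j, a⟩
    have h3 := congrArg (fun p : k[X] => p.coeff a.1) (congrFun h2 j)
    simp only [finset_sum_coeff, coeff_C_mul, coeff_X_pow] at h3
    rw [Finset.sum_eq_single a] at h3
    · simpa using h3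
    · intro b _ hb
      rw [if_neg (fun h => hb (Fin.ext h.symm)), mul_zero]
    · simp
  have := hf.fintype_card_le_finrank
  rwa [Fintype.card_prod, Fintype.card_fin, Fintype.card_fin] at this

lemma exh (a : R) : ∃ i, a ∈ A.V i := by
  have ha : a ∈ Algebra.adjoin k ({A.t} ∪ {a | ∃ i j, a = A.x i j}) := by rw [A.gen]; trivial
  induction ha using Algebra.adjoin_induction with
  | mem a h =>
    rcases h with h | ⟨i, j, h⟩
    · rw [Set.mem_singleton_iff] at h; subst h; exact ⟨1, A.V_of .t_mem⟩
    · subst h; exact ⟨e, A.V_of (.x_mem i j)⟩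
  | algebraMap c => exact ⟨0, by rw [Algebra.algebraMap_eq_smul_one]; exact Submodule.smul_mem _ _ A.V_one⟩
  | add a b _ _ iha ihb =>
    obtain ⟨i, hi⟩ := iha
    obtain ⟨j, hj⟩ := ihb
    exact ⟨i + j, add_mem (A.V_mono (by omega) hi) (A.V_mono (by omega) hj)⟩
  | mul a b _ _ iha ihb =>
    obtain ⟨i, hi⟩ := iha
    obtain ⟨j, hj⟩ := ihb
    exact ⟨i + j, A.V_mul hi hj⟩

/-- `∂P_i/∂T` at a root -/
noncomputable def dP (l : Fin r × Fin n) : R :=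
  ((P l.1).map (aeval A.t : k[X] →ₐ[k] R).toRingHom).derivative.eval (A.x l.1 l.2)

/-- `∂P_i/∂t` at a root -/
noncomputable def dtP (l : Fin r × Fin n) : R :=
  ∑ m ∈ range (n + 1), aeval A.t (derivative ((P l.1).coeff m)) * A.x l.1 l.2 ^ m

/-- the discriminant -/
noncomputable def Δ : R := ∏ l, A.dP l

lemma dP_mem (hn : ∀ i, (P i).natDegree = n) (he : ∀ i l, ((P i).coeff l).natDegree ≤ e) (l : Fin r × Fin n) :
    A.dP l ∈ A.V (e + e * n) := by
  rw [dP, derivative_map, eval_map, eval₂_eq_sum_range' _ (n := n + 1) (by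
    have := natDegree_derivative_le (P l.1); rw [hn] at this; omega)]
  refine Submodule.sum_mem _ fun m hm => ?_
  rw [mem_range] at hm
  have h1 : (derivative (P l.1)).coeff m = (m + 1 : ℕ) • (P l.1).coeff (m + 1) := by
    rw [coeff_derivative, nsmul_eq_mul, mul_comm]; push_cast; ring
  rw [h1, map_nsmul, smul_mul_assoc]
  refine nsmul_mem ?_ _
  refine A.V_mono ?_ (A.V_mul (A.V_t _) (A.V_x l.1 l.2 m))
  have := he l.1 (m + 1)
  nlinarith

lemma dtP_mem (he : ∀ i l, ((P i).coeff l).natDegree ≤ e) (l : Fin r × Fin n) :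
    A.dtP l ∈ A.V (e + e * n) := by
  refine Submodule.sum_mem _ fun m hm => ?_
  rw [mem_range] at hm
  refine A.V_mono ?_ (A.V_mul (A.V_t _) (A.V_x l.1 l.2 m))
  have := he l.1 m
  have := natDegree_derivative_le ((P l.1).coeff m)
  have : (derivative ((P l.1).coeff m)).natDegree ≤ e := by omega
  nlinarith

lemma Δ_mem (hn : ∀ i, (P i).natDegree = n) (he : ∀ i l, ((P i).coeff l).natDegree ≤ e) :
    A.Δ ∈ A.V ((r * n) * (e + e * n)) := by
  have := A.V_prod univ A.dP _ fun l _ => A.dP_mem hn he l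
  rw [card_univ, Fintype.card_prod, Fintype.card_fin, Fintype.card_fin] at this
  exact this

lemma dx_mem (hn : ∀ i, (P i).natDegree = n) (he : ∀ i l, ((P i).coeff l).natDegree ≤ e) (l : Fin r × Fin n) :
    -(A.dtP l * ∏ l' ∈ univ.erase l, A.dP l') ∈ A.V ((r * n) * (e + e * n)) := by
  apply neg_mem
  have := A.V_mul (A.dtP_mem he l) (A.V_prod (univ.erase l) A.dP _ fun l _ => A.dP_mem hn he l)
  refine A.V_mono (le_of_eq ?_) this
  rw [card_erase_of_mem (mem_univ _)]
  simp only [card_univ, Fintype.card_prod, Fintype.card_fin]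
  have h1 : 0 < r * n := Nat.mul_pos l.1.pos l.2.pos
  conv_rhs => rw [← Nat.sub_add_cancel h1]
  ring

lemma psExp_deriv (t0 : k) (p : k[X]) : PowerSeries.derivative k (psExp t0 p) = psExp t0 (derivative p) := by
  induction p using Polynomial.induction_on' with
  | add p q hp hq => rw [map_add, map_add, map_add, map_add, hp, hq]
  | monomial m c =>
    have h1 : psExp t0 (monomial m c) = c • (PowerSeries.C t0 + PowerSeries.X) ^ m := by
      rw [psExp, aeval_monomial, Algebra.smul_def]
    have h2 : psExp t0 (derivative (monomial m c)) = (c * m) • (PowerSeries.C t0 + PowerSeries.X) ^ (m - 1) := by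
      rw [psExp, derivative_monomial, aeval_monomial, Algebra.smul_def]
    have h3 : PowerSeries.derivative k (PowerSeries.C t0 + PowerSeries.X) = 1 := by
      rw [map_add, PowerSeries.derivative_C, PowerSeries.derivative_X, zero_add]
    rw [h1, h2, Derivation.map_smul, Derivation.leibniz_pow, h3, smul_eq_mul, mul_one, mul_smul]
    congr 1
    rw [Nat.cast_smul_eq_nsmul]

lemma deriv_x (hn : ∀ i, (P i).natDegree = n) (l : Fin r × Fin n) :
    A.iota (A.dP l) * PowerSeries.derivative k (A.iota (A.x l.1 l.2)) = - A.iota (A.dtP l) := by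
  have h0 := A.root l.1 l.2
  rw [eval_map, eval₂_eq_sum_range, hn] at h0
  have h1 := congrArg (fun a => PowerSeries.derivative k (A.iota a)) h0
  have h2 : ∀ p : k[X], A.iota ((aeval A.t : k[X] →ₐ[k] R).toRingHom p) = psExp A.t0 p := A.iota_aeval
  simp only [map_sum, map_mul, h2, map_pow, map_zero, Derivation.leibniz, psExp_deriv, Derivation.leibniz_pow, smul_eq_mul,
    Finset.sum_add_distrib] at h1
  have h3 : A.iota (A.dP l) = ∑ m ∈ range (n + 1), psExp A.t0 ((P l.1).coeff m) * (m • A.iota (A.x l.1 l.2) ^ (m - 1)) := by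
    rw [dP, derivative_eval, Polynomial.sum_over_range' _ _ (n + 1) (Nat.lt_succ_of_le (natDegree_map_le.trans (hn l.1).le))]
    · rw [map_sum]
      refine Finset.sum_congr rfl fun m _ => ?_
      rw [coeff_map, map_mul, map_mul, h2, map_natCast, map_pow, nsmul_eq_mul]
      ring
    · simp
  have h4 : A.iota (A.dtP l) = ∑ m ∈ range (n + 1), A.iota (A.x l.1 l.2) ^ m * psExp A.t0 (derivative ((P l.1).coeff m)) := by
    rw [dtP, map_sum]
    refine Finset.sum_congr rfl fun m _ => ?_
    rw [map_mul, map_pow, A.iota_aeval, mul_comm]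
  rw [← h4] at h1
  rw [h3, Finset.sum_mul, eq_neg_iff_add_eq_zero, ← h1]
  congr 1
  refine Finset.sum_congr rfl fun m _ => ?_
  rw [nsmul_eq_mul, nsmul_eq_mul]; ring

lemma deriv_x' (hn : ∀ i, (P i).natDegree = n) (l : Fin r × Fin n) :
    A.iota (-(A.dtP l * ∏ l' ∈ univ.erase l, A.dP l')) = A.iota A.Δ * PowerSeries.derivative k (A.iota (A.x l.1 l.2)) := by
  rw [Δ, ← Finset.mul_prod_erase univ _ (mem_univ l), map_neg, map_mul, map_mul,
    mul_right_comm, A.deriv_x hn l]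
  ring

lemma deriv_exists (hn : ∀ i, (P i).natDegree = n) (a : R) : ∃ b, A.iota b = A.iota A.Δ * PowerSeries.derivative k (A.iota a) := by
  have ha : a ∈ Algebra.adjoin k ({A.t} ∪ {a | ∃ i j, a = A.x i j}) := by rw [A.gen]; trivial
  induction ha using Algebra.adjoin_induction with
  | mem a h =>
    rcases h with h | ⟨i, j, h⟩
    · rw [Set.mem_singleton_iff] at h; subst h
      refine ⟨A.Δ, ?_⟩
      rw [A.iota_t, map_add, PowerSeries.derivative_C, PowerSeries.derivative_X, zero_add, mul_one]
    · subst h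
      exact ⟨_, A.deriv_x' hn (i, j)⟩
  | algebraMap c => exact ⟨0, by rw [AlgHom.commutes, Derivation.map_algebraMap, map_zero, mul_zero]⟩
  | add a b _ _ iha ihb =>
    obtain ⟨i, hi⟩ := iha
    obtain ⟨j, hj⟩ := ihb
    exact ⟨i + j, by rw [map_add, hi, hj, map_add, map_add, mul_add]⟩
  | mul a b _ _ iha ihb =>
    obtain ⟨i, hi⟩ := iha
    obtain ⟨j, hj⟩ := ihb
    exact ⟨a * j + b * i, by rw [map_add, map_mul, map_mul, hi, hj, map_mul, Derivation.leibniz, smul_eq_mul, smul_eq_mul]; ring⟩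

lemma exists_step (hn : ∀ i, (P i).natDegree = n) (he : ∀ i l, ((P i).coeff l).natDegree ≤ e) :
    ∃ S : StepData k R (Nat.card A.G) ((r * n) * (n * e)) ((r * n) * (e + e * n)),
      (∀ i, S.Mon i = {a | WMon A.t A.x e i a}) ∧ S.D S.t = A.Δ := by
  choose D hD using A.deriv_exists hn
  have hDu : ∀ a b, A.iota b = A.iota A.Δ * PowerSeries.derivative k (A.iota a) → D a = b := fun a b h =>
    A.iota_inj ((hD a).trans h.symm)
  let DL : R →ₗ[k] R := 
    { toFun := D
      map_add' := fun a b => hDu _ _ (by rw [map_add, hD, hD, map_add, map_add, mul_add])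
      map_smul' := fun c a => hDu _ _ (by rw [map_smul, RingHom.id_apply, hD, map_smul, Derivation.map_smul, mul_smul_comm]) }
  let DD : Derivation k R R := Derivation.mk' DL (fun a b => hDu _ _ (by
    change A.iota (a * D b + b * D a) = _
    rw [map_add, map_mul, map_mul, hD, hD, map_mul, Derivation.leibniz, smul_eq_mul, smul_eq_mul]; ring))
  have hDt : DD A.t = A.Δ := hDu _ _ (by
    rw [A.iota_t, map_add, PowerSeries.derivative_C, PowerSeries.derivative_X, zero_add, mul_one])
  have hDx : ∀ i j, DD (A.x i j) ∈ A.V ((r * n) * (e + e * n)) := by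
    intro i j
    have : DD (A.x i j) = _ := hDu _ _ (A.deriv_x' hn (i, j))
    rw [this]
    exact A.dx_mem hn he (i, j)
  refine ⟨{
    Mon := fun i => {a | WMon A.t A.x e i a}
    mono := fun i j h a ha => WMon.mono _ _ _ h ha
    one_mem := .one
    mul_mem := fun i j a b ha hb => ha.mul hb
    exh := A.exh
    iota := A.iota
    iota_order := A.iota_order
    lower := A.lower
    D := DD
    D_mem := ?_
    t := A.t }, fun _ => rfl, hDt⟩
  intro i a ha
  change DD a ∈ A.V _
  induction ha with
  | one => simp
  | tmul D a h ih =>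
    rw [Derivation.leibniz, hDt, smul_eq_mul, smul_eq_mul]
    refine add_mem (A.V_mono (by omega) (A.V_mul (A.V_of .t_mem) ih)) ?_
    exact A.V_mono (by omega) (A.V_mul (A.V_of h) (A.Δ_mem hn he))
  | xmul D a i j h ih =>
    rw [Derivation.leibniz, smul_eq_mul, smul_eq_mul]
    refine add_mem (A.V_mono (by omega) (A.V_mul (A.V_of (.x_mem i j)) ih)) ?_
    exact A.V_mono (by omega) (A.V_mul (A.V_of h) (hDx i j))
  | mono D D' a h _ ih => exact A.V_mono (by omega) ih

end Cover

end

section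
open Finset Polynomial

namespace Cover
variable {k R : Type} [Field k] [CommRing R] [IsDomain R] [Algebra k R] {r n e : ℕ} {P : Fin r → k[X][X]}

lemma finiteType (A : Cover (n := n) e P R) : Algebra.FiniteType k R := by
  classical
  refine ⟨⟨{A.t} ∪ (univ : Finset (Fin r × Fin n)).image (fun l => A.x l.1 l.2), ?_⟩⟩
  rw [← A.gen]
  congr 1
  ext a
  simp [eq_comm]

lemma exists_point [IsAlgClosed k] (A : Cover (n := n) e P R) (ts : k) : ∃ y : R →ₐ[k] k, y A.t = ts := by
  have hnu : ¬ IsUnit (A.t - algebraMap k R ts) := by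
    intro hu
    obtain ⟨b, hb⟩ := hu.exists_right_inv
    obtain ⟨p, hp⟩ := A.inv b (by
      intro g hg
      have h1 := congrArg g hb
      rw [map_mul, map_sub, A.fix g hg, AlgEquiv.commutes, map_one, ← hb] at h1
      exact mul_left_cancel₀ hu.ne_zero h1)
    have h2 : aeval A.t ((X - C ts) * p - 1) = 0 := by
      rw [map_sub, map_mul, map_sub, aeval_X, aeval_C, ← hp, hb, map_one, sub_self]
    have h3 := A.t_inj _ h2
    have h4 := congrArg (eval ts) h3
    simp at h4
  obtain ⟨M, hM, hmem⟩ := exists_max_ideal_of_mem_nonunits hnu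
  have hft := A.finiteType
  letI : Field (R ⧸ M) := Ideal.Quotient.field M
  have hft2 : Algebra.FiniteType k (R ⧸ M) := Algebra.FiniteType.of_surjective (Ideal.Quotient.mkₐ k M) (Ideal.Quotient.mkₐ_surjective k M)
  have hfin : Module.Finite k (R ⧸ M) := finite_of_finite_type_of_isJacobsonRing k (R ⧸ M)
  have hbij : Function.Bijective (algebraMap k (R ⧸ M)) := IsAlgClosed.algebraMap_bijective_of_isIntegral
  let φ : (R ⧸ M) ≃ₐ[k] k := (AlgEquiv.ofBijective (Algebra.ofId k (R ⧸ M)) hbij).symm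
  refine ⟨φ.toAlgHom.comp (Ideal.Quotient.mkₐ k M), ?_⟩
  have h1 : Ideal.Quotient.mkₐ k M A.t = algebraMap k (R ⧸ M) ts := by
    have : Ideal.Quotient.mk M (A.t - algebraMap k R ts) = 0 := Ideal.Quotient.eq_zero_iff_mem.2 hmem
    rw [map_sub, sub_eq_zero] at this
    exact this
  rw [AlgHom.comp_apply, h1]
  exact φ.commutes ts

variable (A : Cover (n := n) e P R)

lemma point_aeval (y : R →ₐ[k] k) (p : k[X]) : y (aeval A.t p) = p.eval (y A.t) := by
  rw [← aeval_algHom_apply]; simp [aeval_def, eval₂_eq_eval_map]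

lemma point_factor (y : R →ₐ[k] k) (i : Fin r) :
    (P i).map (evalRingHom (y A.t)) = ∏ j, (X - C (y (A.x i j))) := by
  have h1 : (y : R →+* k).comp (aeval A.t : k[X] →ₐ[k] R).toRingHom = evalRingHom (y A.t) :=
    RingHom.ext (A.point_aeval y)
  rw [← h1, ← Polynomial.map_map, A.factor, Polynomial.map_prod]
  refine Finset.prod_congr rfl fun j _ => ?_
  simp

lemma point_inj (y : R →ₐ[k] k) (i : Fin r) (hs : ((P i).map (evalRingHom (y A.t))).Separable) :
    Function.Injective (fun j => y (A.x i j)) := by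
  rw [A.point_factor, separable_prod_X_sub_C_iff] at hs
  exact hs

lemma point_dP (y : R →ₐ[k] k) (l : Fin r × Fin n) :
    y (A.dP l) = ((P l.1).map (evalRingHom (y A.t))).derivative.eval (y (A.x l.1 l.2)) := by
  have h1 : (y : R →+* k).comp (aeval A.t : k[X] →ₐ[k] R).toRingHom = evalRingHom (y A.t) :=
    RingHom.ext (A.point_aeval y)
  rw [dP, ← h1, ← Polynomial.map_map, derivative_map _ (y : R →+* k), eval_map]
  exact (Polynomial.eval₂_at_apply (y : R →+* k) _).symm

lemma point_Δ (y : R →ₐ[k] k) : y A.Δ ≠ 0 ↔ ∀ i, ((P i).map (evalRingHom (y A.t))).Separable := by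
  rw [Δ, map_prod, Finset.prod_ne_zero_iff]
  constructor
  · intro h i
    rw [A.point_factor, separable_prod_X_sub_C_iff]
    intro a b hab
    by_contra hne
    apply h (i, a) (mem_univ _)
    rw [A.point_dP, A.point_factor]
    obtain ⟨c, hc⟩ : ∃ c, ∏ j, (X - C (y (A.x i j))) = (X - C (y (A.x i a))) * ((X - C (y (A.x i a))) * c) := by
      classical
      refine ⟨∏ j ∈ (univ.erase a).erase b, (X - C (y (A.x i j))), ?_⟩
      rw [← Finset.mul_prod_erase univ _ (mem_univ a), ← Finset.mul_prod_erase (univ.erase a) _ (mem_erase.2 ⟨Ne.symm hne, mem_univ b⟩)]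
      simp only at hab
      rw [hab]
    simp only
    rw [hc]
    simp [derivative_mul]
  · intro h l _
    rw [A.point_dP]
    have := (h l.1).eval₂_derivative_ne_zero (RingHom.id k) (x := y (A.x l.1 l.2)) (by
      rw [eval₂_id, A.point_factor, eval_prod]
      exact Finset.prod_eq_zero (mem_univ l.2) (by simp))
    simpa [eval₂_id] using this

lemma Δ_inv (hx : ∀ i, Function.Injective (A.x i)) (g : R ≃ₐ[k] R) (hg : g ∈ A.G) : g A.Δ = A.Δ := by
  choose π hπ using A.perm g hg
  have hinj : Function.Injective (fun l : Fin r × Fin n => (l.1, π l.1 l.2)) := by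
    rintro ⟨i, j⟩ ⟨i', j'⟩ h
    simp only [Prod.mk.injEq] at h
    obtain ⟨rfl, h⟩ := h
    have : g (A.x i j) = g (A.x i j') := by rw [hπ, hπ, h]
    rw [hx i (g.injective this)]
  have hc : (g : R →+* R).comp (aeval A.t : k[X] →ₐ[k] R).toRingHom = (aeval A.t : k[X] →ₐ[k] R).toRingHom :=
    RingHom.ext (A.fix_aeval g hg)
  rw [Δ, map_prod]
  refine Fintype.prod_bijective _ (Finite.injective_iff_bijective.1 hinj) _ _ fun l => ?_
  rw [dP, dP]
  simp only
  rw [← hπ]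
  conv_rhs => rw [← hc, ← Polynomial.map_map, derivative_map _ (g : R →+* R), eval_map]
  exact (Polynomial.eval₂_at_apply (g : R →+* R) _).symm

lemma x_inj (y : R →ₐ[k] k) (hs : ∀ i, ((P i).map (evalRingHom (y A.t))).Separable) (i : Fin r) : Function.Injective (A.x i) := by
  intro a b h
  exact A.point_inj y i (hs i) (congrArg y h)

lemma exists_disc [IsAlgClosed k] (A : Cover (n := n) e P R) (hn : ∀ i, (P i).natDegree = n) (he : ∀ i l, ((P i).coeff l).natDegree ≤ e)
    (t0 : k) (hs : ∀ i, ((P i).map (evalRingHom t0)).Separable) :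
    ∃ D : k[X], D ≠ 0 ∧ D.natDegree ≤ (r * n) * (e + e * n) ∧ ∀ t, D.eval t ≠ 0 ↔ ∀ i, ((P i).map (evalRingHom t)).Separable := by
  obtain ⟨y0, hy0⟩ := A.exists_point t0
  have hs' : ∀ i, ((P i).map (evalRingHom (y0 A.t))).Separable := by rw [hy0]; exact hs
  obtain ⟨D, hD⟩ := A.inv A.Δ (A.Δ_inv (A.x_inj y0 hs'))
  have hev : ∀ t, D.eval t ≠ 0 ↔ ∀ i, ((P i).map (evalRingHom t)).Separable := by
    intro t
    obtain ⟨y, hy⟩ := A.exists_point t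
    rw [← hy, ← A.point_Δ y, hD, A.point_aeval]
  refine ⟨D, ?_, ?_, hev⟩
  · rintro rfl
    exact (hev t0).2 hs (by simp)
  · apply A.deg
    rw [← hD]
    exact A.Δ_mem hn he

/-- a group element is determined by its action on the roots -/
lemma eq_of_x (g g' : R ≃ₐ[k] R) (hg : g ∈ A.G) (hg' : g' ∈ A.G) (h : ∀ i j, g (A.x i j) = g' (A.x i j)) : g = g' := by
  have h1 : Algebra.adjoin k ({A.t} ∪ {a | ∃ i j, a = A.x i j}) ≤ AlgHom.equalizer g.toAlgHom g'.toAlgHom := by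
    apply Algebra.adjoin_le
    rintro a (h1 | ⟨i, j, h1⟩)
    · rw [Set.mem_singleton_iff] at h1; subst h1
      exact (A.fix g hg).trans (A.fix g' hg').symm
    · subst h1; exact h i j
  rw [A.gen] at h1
  ext a
  exact h1 (Algebra.mem_top (x := a))

end Cover

end

section
open Finset Polynomial

lemma dvd_one_sub_pow_aux {R : Type} [CommRing R] (a : R) (N : ℕ) : ∃ z, 1 - (1 - a) ^ N = a * z := by
  have := sub_dvd_pow_sub_pow (1 : R) (1 - a) N
  rw [one_pow, sub_sub_cancel] at this
  exact this

namespace Cover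
variable {k R : Type} [Field k] [CommRing R] [IsDomain R] [Algebra k R] {r n e : ℕ} {P : Fin r → k[X][X]}
  (A : Cover (n := n) e P R)

/-- decomposition group of a point -/
def stab (y : R →ₐ[k] k) : Subgroup A.G where
  carrier := {g | ∀ a, y (g.1 a) = y a}
  mul_mem' := fun {g h} hg hh a => (hg _).trans (hh a)
  one_mem' := fun a => rfl
  inv_mem' := fun {g} hg a => by
    have h := hg (g.1⁻¹ a)
    have h2 : g.1 (g.1⁻¹ a) = a := AlgEquiv.apply_symm_apply g.1 a
    rw [h2] at h
    exact h.symm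

lemma exists_s1 (y : R →ₐ[k] k) : ∃ s : R, y s = 1 ∧ (∀ h ∈ A.stab y, h.1 s = s) ∧ ∀ g : A.G, g ∉ A.stab y → y (g.1 s) = 0 := by
  classical
  have := A.fin
  cases nonempty_fintype A.G
  obtain ⟨s0, h1, h2⟩ := StepData.sep_elt ((univ : Finset A.G).image fun g => y.comp (g.1 : R →ₐ[k] R)) y
  have h3 : ∀ g : A.G, g ∉ A.stab y → y (g.1 s0) = 0 := by
    intro g hg
    refine h2 (y.comp (g.1 : R →ₐ[k] R)) (mem_image.2 ⟨g, mem_univ _, rfl⟩) fun h => hg ?_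
    intro a
    exact congrArg (fun f : R →ₐ[k] k => f a) h
  refine ⟨∏ h : A.stab y, h.1.1 s0, ?_, ?_, ?_⟩
  · rw [map_prod]
    exact Finset.prod_eq_one fun h _ => (h.2 s0).trans h1
  · intro h hh
    rw [map_prod]
    exact Fintype.prod_equiv (Equiv.mulLeft (⟨h, hh⟩ : A.stab y)) _ _ fun _ => rfl
  · intro g hg
    rw [map_prod, map_prod]
    refine Finset.prod_eq_zero (mem_univ 1) ?_
    exact h3 g hg

lemma exists_s (y : R →ₐ[k] k) (N : ℕ) : ∃ s : R, s - 1 ∈ (RingHom.ker y) ^ N ∧ (∀ h ∈ A.stab y, h.1 s = s) ∧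
    ∀ g : A.G, g ∉ A.stab y → g.1 s ∈ (RingHom.ker y) ^ N := by
  obtain ⟨s, h1, h2, h3⟩ := A.exists_s1 y
  refine ⟨1 - (1 - s ^ N) ^ N, ?_, ?_, ?_⟩
  · rw [sub_sub_cancel_left]
    refine neg_mem (Ideal.pow_mem_pow ?_ N)
    rw [RingHom.mem_ker, map_sub, map_one, map_pow, h1, one_pow, sub_self]
  · intro h hh
    simp [h2 h hh]
  · intro g hg
    obtain ⟨z, hz⟩ := dvd_one_sub_pow_aux (s ^ N) N
    rw [hz, map_mul, map_pow]
    exact Ideal.mul_mem_right _ _ (Ideal.pow_mem_pow (h3 g hg) N)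

/-- a function invariant under the decomposition group is locally a function of `t` -/
lemma descend (y : R →ₐ[k] k) (w : R) (hw : ∀ h ∈ A.stab y, h.1 w = w) (N : ℕ) :
    ∃ p : k[X], aeval A.t p - w ∈ (RingHom.ker y) ^ N := by
  classical
  have := A.fin
  obtain ⟨s, h1, h2, h3⟩ := A.exists_s y N
  let F : A.G ⧸ A.stab y → R := fun c => Quotient.liftOn' c (fun g : A.G => g.1 (s * w)) (by
    intro a b hab
    rw [QuotientGroup.leftRel_apply] at hab
    have h4 : (a⁻¹ * b).1 (s * w) = s * w := by rw [map_mul, h2 _ hab, hw _ hab]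
    have h5 : b = a * (a⁻¹ * b) := by group
    change a.1 (s * w) = b.1 (s * w)
    rw [h5]
    change _ = a.1 ((a⁻¹ * b).1 (s * w))
    rw [h4])
  have hF : ∀ g : A.G, F (g : A.G ⧸ A.stab y) = g.1 (s * w) := fun g => rfl
  cases nonempty_fintype (A.G ⧸ A.stab y)
  obtain ⟨p, hp⟩ := A.inv (∑ c, F c) (by
    intro g hg
    rw [map_sum]
    refine Fintype.sum_equiv (MulAction.toPerm (⟨g, hg⟩ : A.G)) _ _ fun c => ?_
    obtain ⟨h, rfl⟩ := QuotientGroup.mk_surjective c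
    rw [hF]
    rfl)
  refine ⟨p, ?_⟩
  rw [← hp, ← Finset.add_sum_erase univ _ (mem_univ ((1 : A.G) : A.G ⧸ A.stab y)), hF, add_sub_right_comm]
  refine add_mem ?_ (sum_mem fun c hc => ?_)
  · have : (1 : A.G).1 (s * w) - w = (s - 1) * w := by
      change s * w - w = _
      ring
    rw [this]
    exact Ideal.mul_mem_right _ _ h1
  · obtain ⟨g, rfl⟩ := QuotientGroup.mk_surjective c
    rw [hF, map_mul]
    refine Ideal.mul_mem_right _ _ (h3 g fun hg => ?_)
    apply (mem_erase.1 hc).1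
    rw [QuotientGroup.eq]
    simpa using inv_mem hg

lemma primary (y : R →ₐ[k] k) (N : ℕ) (v w : R) (hv : y v ≠ 0) (h : v * w ∈ (RingHom.ker y) ^ N) : w ∈ (RingHom.ker y) ^ N := by
  set a := v * algebraMap k R (y v)⁻¹ with ha
  obtain ⟨z, hz⟩ := dvd_one_sub_pow_aux a N
  have h1 : w = (1 - a) ^ N * w + (v * w) * (algebraMap k R (y v)⁻¹ * z) := by
    have : v * w * (algebraMap k R (y v)⁻¹ * z) = (a * z) * w := by rw [ha]; ring
    rw [this, ← hz]; ring
  rw [h1]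
  refine add_mem (Ideal.mul_mem_right _ _ (Ideal.pow_mem_pow ?_ N)) (Ideal.mul_mem_right _ _ h)
  rw [RingHom.mem_ker, map_sub, map_one, ha, map_mul, AlgHom.commutes]
  simp [hv]

lemma eval_alpha (i : Fin r) (α : k) : aeval A.t ((P i).eval (C α)) = ∏ j, (algebraMap k R α - A.x i j) := by
  have h1 : (aeval A.t : k[X] →ₐ[k] R).toRingHom (C α) = algebraMap k R α := by simp
  have h2 := Polynomial.eval₂_at_apply (p := P i) (aeval A.t : k[X] →ₐ[k] R).toRingHom (C α)
  rw [h1, ← eval_map, A.factor, eval_prod] at h2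
  simpa using h2.symm

theorem stab_transitive (y : R →ₐ[k] k) (i : Fin r) (α : k) (hx : Function.Injective (A.x i))
    (hq0 : ((P i).eval (C α)).eval (y A.t) = 0) (hq1 : (derivative ((P i).eval (C α))).eval (y A.t) ≠ 0)
    (j1 j2 : Fin n) (hj1 : y (A.x i j1) = α) (hj2 : y (A.x i j2) = α) :
    ∃ g ∈ A.G, (∀ a, y (g a) = y a) ∧ g (A.x i j1) = A.x i j2 := by
  classical
  by_contra hcon
  push Not at hcon
  set β := algebraMap k R α with hβ
  let O : Finset (Fin n) := univ.filter fun j => ∃ h ∈ A.stab y, h.1 (A.x i j1) = A.x i j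
  have hO1 : j1 ∈ O := mem_filter.2 ⟨mem_univ _, 1, one_mem _, rfl⟩
  have hO2 : j2 ∉ O := by
    intro h
    obtain ⟨_, g, hg, hh⟩ := mem_filter.1 h
    exact hcon g.1 g.2 hg hh
  let w1 := ∏ j ∈ O, (β - A.x i j)
  let w2 := ∏ j ∈ univ \ O, (β - A.x i j)
  have hw12 : w1 * w2 = aeval A.t ((P i).eval (C α)) := by
    rw [A.eval_alpha, mul_comm]
    exact Finset.prod_sdiff (subset_univ O)
  have hyβ : y β = α := y.commutes α
  have hyw1 : y w1 = 0 := by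
    rw [map_prod]
    exact Finset.prod_eq_zero hO1 (by rw [map_sub, hyβ, hj1, sub_self])
  have hyw2 : y w2 = 0 := by
    rw [map_prod]
    exact Finset.prod_eq_zero (mem_sdiff.2 ⟨mem_univ j2, hO2⟩) (by rw [map_sub, hyβ, hj2, sub_self])
  obtain ⟨u, hu⟩ := Polynomial.dvd_iff_isRoot.2 hq0
  have hu1 : u.eval (y A.t) ≠ 0 := by
    rw [hu] at hq1
    simpa [derivative_mul] using hq1
  have hq : (P i).eval (C α) ≠ 0 := by
    intro h; rw [h] at hq1; simp at hq1
  have hw1inv : ∀ h ∈ A.stab y, h.1 w1 = w1 := by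
    intro h hh
    have key : ∀ j ∈ O, ∃ j' ∈ O, h.1 (A.x i j) = A.x i j' := by
      intro j hj
      obtain ⟨_, g, hg, hgj⟩ := mem_filter.1 hj
      obtain ⟨j', hj'⟩ := A.perm h.1 h.2 i j
      refine ⟨j', mem_filter.2 ⟨mem_univ _, h * g, mul_mem hh hg, ?_⟩, hj'⟩
      change h.1 (g.1 (A.x i j1)) = _
      rw [hgj, hj']
    choose! π hπO hπ using key
    have hinj : Set.InjOn π O := by
      intro a ha b hb hab
      apply hx
      apply h.1.injective
      rw [hπ a ha, hπ b hb, hab]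
    rw [map_prod]
    have himg : O.image π = O := Finset.eq_of_subset_of_card_le (by
      intro j hj
      obtain ⟨a, ha, rfl⟩ := mem_image.1 hj
      exact hπO a ha) (by rw [card_image_of_injOn hinj])
    conv_rhs => rw [show w1 = ∏ j ∈ O.image π, (β - A.x i j) by rw [himg]]
    rw [Finset.prod_image hinj]
    refine Finset.prod_congr rfl fun j hj => ?_
    rw [map_sub, AlgEquiv.commutes, hπ j hj]
  -- all powers
  have hall : ∀ N, w1 ∈ (RingHom.ker y) ^ N := by
    intro N
    rcases Nat.eq_zero_or_pos N with rfl | hN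
    · simp
    obtain ⟨p, hp⟩ := A.descend y w1 hw1inv N
    have hp0 : p.eval (y A.t) = 0 := by
      have h1 : aeval A.t p - w1 ∈ RingHom.ker y := Ideal.pow_le_self (by omega) hp
      rw [RingHom.mem_ker, map_sub, hyw1, sub_zero, A.point_aeval] at h1
      exact h1
    obtain ⟨p2, hp2⟩ := Polynomial.dvd_iff_isRoot.2 hp0
    refine primary y N (aeval A.t u - w2 * aeval A.t p2) w1 ?_ ?_
    · rw [map_sub, map_mul, hyw2, zero_mul, sub_zero, A.point_aeval]
      exact hu1
    · have h1 : (aeval A.t u - w2 * aeval A.t p2) * w1 = - (aeval A.t u * (aeval A.t p - w1)) := by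
        have h2 : w1 * w2 = aeval A.t (X - C (y A.t)) * aeval A.t u := by rw [hw12, hu, map_mul]
        have h3 : aeval A.t p = aeval A.t (X - C (y A.t)) * aeval A.t p2 := by rw [← map_mul, ← hp2]
        rw [h3]
        linear_combination (- aeval A.t p2) * h2
      rw [h1]
      exact neg_mem (Ideal.mul_mem_left _ _ hp)
  have hft := A.finiteType
  have hnoeth : IsNoetherianRing R := Algebra.FiniteType.isNoetherianRing k R
  have hbot := Ideal.iInf_pow_eq_bot_of_isDomain (RingHom.ker y) (RingHom.ker_ne_top y)
  have hw10 : w1 = 0 := by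
    have : w1 ∈ (⨅ N : ℕ, (RingHom.ker y) ^ N) := by
      rw [Ideal.mem_iInf]; exact hall
    rw [hbot] at this
    exact this
  apply hq
  apply A.t_inj
  rw [← hw12, hw10, zero_mul]

end Cover

end

section
open Finset Polynomial

open Classical in
lemma card_fiber_roots {k : Type} [Field k] {n : ℕ} (f : k[X]) (ρ : Fin n → k) (hf : f = ∏ j, (X - C (ρ j))) (a : k) :
    #(univ.filter fun j => ρ j = a) = f.roots.count a := by
  have h1 : f.roots = univ.val.map ρ := by
    rw [hf, Polynomial.roots_prod _ _ (Finset.prod_ne_zero_iff.2 fun j _ => X_sub_C_ne_zero _)]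
    simp [roots_X_sub_C]
  rw [h1, Multiset.count_map]
  rw [Finset.card_def, Finset.filter_val]
  congr 1
  exact Multiset.filter_congr fun x _ => eq_comm

namespace Cover
variable {k R : Type} [Field k] [CommRing R] [IsDomain R] [Algebra k R] {r n e : ℕ} {P : Fin r → k[X][X]}
  (A : Cover (n := n) e P R)

/-- the group, as permutations of the roots -/
def permGroup : Subgroup (Fin r → Equiv.Perm (Fin n)) where
  carrier := {τ | ∃ g ∈ A.G, ∀ i j, g (A.x i j) = A.x i (τ i j)}
  mul_mem' := by
    rintro τ τ' ⟨g, hg, h⟩ ⟨g', hg', h'⟩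
    refine ⟨g * g', mul_mem hg hg', fun i j => ?_⟩
    rw [AlgEquiv.mul_apply, h', h]; rfl
  one_mem' := ⟨1, one_mem _, fun i j => rfl⟩
  inv_mem' := by
    rintro τ ⟨g, hg, h⟩
    refine ⟨g⁻¹, inv_mem hg, fun i j => ?_⟩
    apply g.injective
    rw [h]
    change g (g.symm _) = _
    rw [AlgEquiv.apply_symm_apply]
    congr 1
    exact ((τ i).apply_symm_apply j).symm

lemma exists_perm (hx : ∀ i, Function.Injective (A.x i)) (g : R ≃ₐ[k] R) (hg : g ∈ A.G) :
    ∃ τ ∈ A.permGroup, ∀ i j, g (A.x i j) = A.x i (τ i j) := by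
  choose π hπ using A.perm g hg
  have hinj : ∀ i, Function.Injective (π i) := by
    intro i a b hab
    apply hx i
    apply g.injective
    rw [hπ, hπ, hab]
  refine ⟨fun i => Equiv.ofBijective (π i) (Finite.injective_iff_bijective.1 (hinj i)), ⟨g, hg, hπ⟩, hπ⟩

theorem full [IsAlgClosed k] (hx : ∀ i, Function.Injective (A.x i))
    (hA : ∀ i, ∃ (ts α : k) (h : k[X]), (P i).map (evalRingHom ts) = (X - C α) ^ 2 * h ∧ h.Separable ∧ h.eval α ≠ 0 ∧
      (∀ i', i' ≠ i → ((P i').map (evalRingHom ts)).Separable) ∧ (derivative ((P i).eval (C α))).eval ts ≠ 0)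
    (hB : ∀ i, ∃ (ts α γ : k), γ ≠ α ∧ (P i).map (evalRingHom ts) = (X - C α) ^ (n - 1) * (X - C γ) ∧
      (derivative ((P i).eval (C α))).eval ts ≠ 0)
    (hC : ∀ i, ∃ (ts α : k), (P i).map (evalRingHom ts) = (X - C α) ^ n ∧ (derivative ((P i).eval (C α))).eval ts ≠ 0) :
    A.permGroup = ⊤ := by
  classical
  have hev : ∀ i (ts α : k), ((P i).map (evalRingHom ts)).eval α = ((P i).eval (C α)).eval ts := by
    intro i ts α
    have := Polynomial.eval₂_at_apply (p := P i) (evalRingHom ts) (C α)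
    simpa [eval_map] using this
  -- transitivity
  have h1 : ∀ i j1 j2, ∃ τ ∈ A.permGroup, τ i j1 = j2 := by
    intro i j1 j2
    obtain ⟨ts, α, hf, hq⟩ := hC i
    obtain ⟨y, hy⟩ := A.exists_point ts
    have hall : ∀ j, y (A.x i j) = α := by
      intro j
      have h2 := A.point_factor y i
      rw [hy, hf] at h2
      have h3 := congrArg (eval (y (A.x i j))) h2
      rw [eval_prod, Finset.prod_eq_zero (mem_univ j) (by simp), eval_pow] at h3
      have := eq_zero_of_pow_eq_zero h3
      simpa [sub_eq_zero] using this
    have h0 : n ≠ 0 := fun h => by subst h; exact j1.elim0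
    obtain ⟨g, hg, _, hg2⟩ := A.stab_transitive y i α (hx i) (by rw [hy, ← hev, hf]; simp [h0]) (by rw [hy]; exact hq) j1 j2 (hall _) (hall _)
    obtain ⟨τ, hτ, h⟩ := A.exists_perm hx g hg
    exact ⟨τ, hτ, hx i (by rw [← h, hg2])⟩
  -- double transitivity
  have h2 : ∀ i, ∃ j0, ∀ j1 j2, j1 ≠ j0 → j2 ≠ j0 → ∃ τ ∈ A.permGroup, τ i j0 = j0 ∧ τ i j1 = j2 := by
    intro i
    obtain ⟨ts, α, γ, hne, hf, hq⟩ := hB i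
    obtain ⟨y, hy⟩ := A.exists_point ts
    have h2 := A.point_factor y i
    have hcγ := card_fiber_roots _ _ h2 γ
    rw [hy] at h2 hcγ
    rw [hf, roots_mul (mul_ne_zero (pow_ne_zero _ (X_sub_C_ne_zero _)) (X_sub_C_ne_zero _)), Multiset.count_add, roots_pow,
      roots_X_sub_C, roots_X_sub_C, Multiset.count_nsmul, Multiset.count_singleton, Multiset.count_singleton,
      if_neg hne, if_pos rfl, mul_zero, zero_add] at hcγ
    obtain ⟨j0, hj0⟩ := Finset.card_eq_one.1 hcγ
    have hj0' : ∀ j, y (A.x i j) = γ ↔ j = j0 := by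
      intro j
      have := Finset.ext_iff.1 hj0 j
      simpa using this
    have hall : ∀ j, j ≠ j0 → y (A.x i j) = α := by
      intro j hj
      have h3 := congrArg (eval (y (A.x i j))) (hf.symm.trans h2)
      rw [eval_prod, Finset.prod_eq_zero (mem_univ j) (by simp), eval_mul, eval_pow] at h3
      rcases mul_eq_zero.1 h3 with h3 | h3
      · have := eq_zero_of_pow_eq_zero h3
        simpa [sub_eq_zero] using this
      · exact absurd ((hj0' j).1 (by simpa [sub_eq_zero] using h3)) hj
    refine ⟨j0, fun j1 j2 hj1 hj2 => ?_⟩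
    have h0 : n - 1 ≠ 0 := by
      have := j1.2
      have := j0.2
      have : j1.1 ≠ j0.1 := fun h => hj1 (Fin.ext h)
      omega
    obtain ⟨g, hg, hg1, hg2⟩ := A.stab_transitive y i α (hx i) (by rw [hy, ← hev, hf]; simp [h0]) (by rw [hy]; exact hq) j1 j2 (hall _ hj1) (hall _ hj2)
    obtain ⟨τ, hτ, h⟩ := A.exists_perm hx g hg
    refine ⟨τ, hτ, ?_, hx i (by rw [← h, hg2])⟩
    rw [← hj0', ← h, hg1, hj0']
  -- a transposition
  have h3 : ∀ i : Fin r, ∃ j1 j2 : Fin n, j1 ≠ j2 ∧ (Pi.mulSingle i (Equiv.swap j1 j2) : Fin r → Equiv.Perm (Fin n)) ∈ A.permGroup := by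
    intro i
    obtain ⟨ts, α, h, hf, hsep, hα, hoth, hq⟩ := hA i
    obtain ⟨y, hy⟩ := A.exists_point ts
    have h2 := A.point_factor y i
    have hc := card_fiber_roots _ _ h2
    rw [hy] at h2 hc
    have hr : ∀ a, (((P i).map (evalRingHom ts)).roots).count a = 2 * (if a = α then 1 else 0) + h.roots.count a := by
      intro a
      rw [hf, roots_mul (mul_ne_zero (pow_ne_zero _ (X_sub_C_ne_zero _)) hsep.ne_zero), Multiset.count_add, roots_pow,
        roots_X_sub_C, Multiset.count_nsmul, Multiset.count_singleton]
    have hcα := (hc α).trans (hr α)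
    rw [if_pos rfl, Multiset.count_eq_zero_of_notMem (by
      intro hmem; exact hα (isRoot_of_mem_roots hmem))] at hcα
    obtain ⟨j1, j2, hne, hj⟩ := Finset.card_eq_two.1 hcα
    have hj' : ∀ j, y (A.x i j) = α ↔ j = j1 ∨ j = j2 := by
      intro j
      have := Finset.ext_iff.1 hj j
      simpa using this
    have huniq : ∀ j j', y (A.x i j) ≠ α → y (A.x i j') = y (A.x i j) → j' = j := by
      intro j j' h3 h4
      have h5 := (hc (y (A.x i j))).trans (hr _)
      rw [if_neg h3, mul_zero, zero_add] at h5
      have h6 : #(univ.filter fun l => y (A.x i l) = y (A.x i j)) ≤ 1 := by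
        rw [h5]
        exact Multiset.nodup_iff_count_le_one.1 (nodup_roots hsep) _
      exact Finset.card_le_one.1 h6 j' (by simp [h4]) j (by simp)
    obtain ⟨g, hg, hg1, hg2⟩ := A.stab_transitive y i α (hx i) (by rw [hy, ← hev, hf]; simp) (by rw [hy]; exact hq) j1 j2
      ((hj' _).2 (Or.inl rfl)) ((hj' _).2 (Or.inr rfl))
    obtain ⟨τ, hτ, hh⟩ := A.exists_perm hx g hg
    refine ⟨j1, j2, hne, ?_⟩
    convert hτ using 1
    funext i'
    by_cases hi : i' = i
    · subst hi
      rw [Pi.mulSingle_eq_same]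
      have t1 : τ i' j1 = j2 := hx i' (by rw [← hh, hg2])
      have tfix : ∀ j, j ≠ j1 → j ≠ j2 → τ i' j = j := by
        intro j n1 n2
        refine huniq j _ (fun hc => ?_) (by rw [← hh, hg1])
        rcases (hj' j).1 hc with h | h
        · exact n1 h
        · exact n2 h
      have t2 : τ i' j2 = j1 := by
        by_contra hcon
        have h5 : τ i' j2 ≠ j2 := fun h => hne ((τ i').injective (t1.trans h.symm))
        exact h5 ((τ i').injective (tfix _ hcon h5))
      ext j
      congr 1
      by_cases n1 : j = j1
      · subst n1; rw [Equiv.swap_apply_left, t1]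
      by_cases n2 : j = j2
      · subst n2; rw [Equiv.swap_apply_right, t2]
      rw [Equiv.swap_apply_of_ne_of_ne n1 n2, tfix j n1 n2]
    · rw [Pi.mulSingle_eq_of_ne hi]
      ext j
      congr 1
      apply A.point_inj y i' (by rw [hy]; exact hoth i' hi)
      change y (A.x i' j) = y (A.x i' (τ i' j))
      rw [← hh, hg1]
  -- all transpositions
  have h5 : ∀ i a b a' b', a ≠ b → a' ≠ b' → ∃ τ ∈ A.permGroup, τ i a = a' ∧ τ i b = b' := by
    intro i a b a' b' hab hab'
    obtain ⟨j0, hj0⟩ := h2 i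
    obtain ⟨τ1, m1, e1⟩ := h1 i a j0
    obtain ⟨τ2, m2, e2⟩ := h1 i a' j0
    obtain ⟨τ3, m3, e3, e4⟩ := hj0 (τ1 i b) (τ2 i b') (fun h => hab ((τ1 i).injective (by rw [e1, h])))
      (fun h => hab' ((τ2 i).injective (by rw [e2, h])))
    refine ⟨τ2⁻¹ * (τ3 * τ1), mul_mem (inv_mem m2) (mul_mem m3 m1), ?_, ?_⟩
    · change (τ2 i).symm (τ3 i (τ1 i a)) = a'
      rw [e1, e3, Equiv.symm_apply_eq, e2]
    · change (τ2 i).symm (τ3 i (τ1 i b)) = b'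
      rw [e4, Equiv.symm_apply_apply]
  have h6 : ∀ (i : Fin r) (a b : Fin n), a ≠ b → (Pi.mulSingle i (Equiv.swap a b) : Fin r → Equiv.Perm (Fin n)) ∈ A.permGroup := by
    intro i a b hab
    obtain ⟨j1, j2, hne, hm⟩ := h3 i
    obtain ⟨τ, hτ, e1, e2⟩ := h5 i j1 j2 a b hne hab
    have := mul_mem (mul_mem hτ hm) (inv_mem hτ)
    convert this using 1
    funext i'
    by_cases hi : i' = i
    · subst hi
      simp only [Pi.mul_apply, Pi.inv_apply, Pi.mulSingle_eq_same]
      rw [← e1, ← e2]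
      exact Equiv.swap_apply_apply _ _ _
    · simp [Pi.mulSingle_eq_of_ne hi]
  rw [eq_top_iff]
  intro τ _
  apply Subgroup.pi_mem_of_mulSingle_mem
  intro i
  have h7 : Subgroup.closure {σ : Equiv.Perm (Fin n) | σ.IsSwap} ≤ A.permGroup.comap (MonoidHom.mulSingle (fun _ => Equiv.Perm (Fin n)) i) := by
    rw [Subgroup.closure_le]
    rintro _ ⟨a, b, hab, rfl⟩
    exact h6 i a b hab
  rw [Equiv.Perm.closure_isSwap] at h7
  exact h7 (Subgroup.mem_top (τ i))

end Cover

end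

section
open Finset Polynomial

namespace Cover

open Classical in
theorem count (r n e : ℕ) (δ : ℝ) (hδ : 0 < δ) : ∃ Q : ℕ, ∀ (k R : Type) [Field k] [IsAlgClosed k] [CommRing R] [IsDomain R] [Algebra k R]
    (P : Fin r → k[X][X]) (A : Cover (n := n) e P R) (_ : ∀ i, (P i).natDegree = n) (_ : ∀ i l, ((P i).coeff l).natDegree ≤ e)
    (_ : ∀ i, Function.Injective (A.x i)) (_ : A.permGroup = ⊤) (p a : ℕ) [Fact p.Prime] [CharP k p], 0 < a → Q < p ^ a →
    ∀ (𝒮 : Finset (Fin r → Equiv.Perm (Fin n))) (_ : ∀ τ ∈ 𝒮, ∀ π, π * τ * π⁻¹ ∈ 𝒮) (T : Finset k),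
      (∀ t ∈ T, t ^ (p ^ a) = t ∧ ∃ τ ∈ 𝒮, ∀ i, ∃ ρ : Fin n → k, Function.Injective ρ ∧
        (P i).map (evalRingHom t) = ∏ j, (X - C (ρ j)) ∧ ∀ j, ρ j ^ (p ^ a) = ρ (τ i j)) →
      (#T : ℝ) * (n.factorial : ℝ) ^ r ≤ #𝒮 * ((1 + δ) * (p : ℝ) ^ a) := by
  obtain ⟨Q, hQ⟩ := step_bound (n.factorial ^ r) ((r*n)*(n*e)) ((r*n)*(e+e*n)) (Nat.one_le_iff_ne_zero.2 (pow_ne_zero _ (Nat.factorial_ne_zero _))) δ hδ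
  refine ⟨Q, ?_⟩
  intro k R _ _ _ _ _ P A hn he hx hfull p a _ _ ha hq 𝒮 h𝒮 T hT
  have hg : ∀ π : Fin r → Equiv.Perm (Fin n), ∃ g ∈ A.G, ∀ i j, g (A.x i j) = A.x i (π i j) := by
    intro π
    have : π ∈ A.permGroup := by rw [hfull]; trivial
    exact this
  choose g hgG hgx using hg
  have hcard : Nat.card A.G = n.factorial ^ r := by
    have h1 : Function.Bijective (fun π : Fin r → Equiv.Perm (Fin n) => (⟨g π, hgG π⟩ : A.G)) := by
      constructor
      · intro π π' h
        have h' : g π = g π' := congrArg Subtype.val h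
        funext i
        ext j
        congr 1
        apply hx i
        rw [← hgx, ← hgx, h']
      · rintro ⟨g', hg'⟩
        obtain ⟨τ, _, hτ⟩ := A.exists_perm hx g' hg'
        refine ⟨τ, Subtype.ext ?_⟩
        exact A.eq_of_x _ _ (hgG τ) hg' fun i j => by rw [hgx, hτ]
    rw [← Nat.card_congr (Equiv.ofBijective _ h1), Nat.card_eq_fintype_card, Fintype.card_pi]
    simp [Fintype.card_perm]
  have hstep := A.exists_step hn he
  rw [hcard] at hstep
  obtain ⟨S, hSM, hSD⟩ := hstep
  have hsep : ∀ t ∈ T, ∀ i, ((P i).map (evalRingHom t)).Separable := by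
    intro t ht i
    obtain ⟨_, τ, _, h⟩ := hT t ht
    obtain ⟨ρ, hρ, hf, _⟩ := h i
    rw [hf, separable_prod_X_sub_C_iff]; exact hρ
  choose y hy using A.exists_point
  -- type of a point
  let typ (z : R →ₐ[k] k) (τ : Fin r → Equiv.Perm (Fin n)) : Prop := ∀ i j, z (A.x i j) ^ (p ^ a) = z (A.x i (τ i j))
  let pt (u : k × (Fin r → Equiv.Perm (Fin n))) : R →ₐ[k] k := (y u.1).comp (g u.2).toAlgHom
  have hptt : ∀ u, pt u A.t = u.1 := by
    intro u
    change y u.1 (g u.2 A.t) = u.1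
    rw [A.fix _ (hgG _), hy]
  have hptx : ∀ u i j, pt u (A.x i j) = y u.1 (A.x i (u.2 i j)) := by
    intro u i j
    change y u.1 (g u.2 (A.x i j)) = _
    rw [hgx]
  have hyinj : ∀ t ∈ T, ∀ i, Function.Injective fun j => y t (A.x i j) := fun t ht i =>
    A.point_inj (y t) i (by rw [hy]; exact hsep t ht i)
  have hinj : Set.InjOn pt (T ×ˢ (univ : Finset (Fin r → Equiv.Perm (Fin n))) : Finset _) := by
    rintro ⟨t, π⟩ hu ⟨t', π'⟩ _ h
    have htt : t = t' := by
      have := congrArg (fun z => z A.t) h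
      simpa only [hptt] using this
    subst htt
    have ht : t ∈ T := by simpa using hu
    congr 1
    funext i
    ext j
    congr 1
    apply hyinj t ht i
    have := congrArg (fun z => z (A.x i j)) h
    simpa only [hptx] using this
  have htyp : ∀ u ∈ T ×ˢ (univ : Finset (Fin r → Equiv.Perm (Fin n))), ∃ τ ∈ 𝒮, typ (pt u) τ := by
    rintro ⟨t, π⟩ hu
    have ht : t ∈ T := by simpa using hu
    obtain ⟨htq, τ, hτ, h⟩ := hT t ht
    choose ρ hρ hf hfr using h
    have hκ : ∀ i, ∃ κ : Equiv.Perm (Fin n), ∀ j, y t (A.x i j) = ρ i (κ j) := by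
      intro i
      have h1 : ∀ j, ∃ j', y t (A.x i j) = ρ i j' := by
        intro j
        have h2 := A.point_factor (y t) i
        rw [hy, hf i] at h2
        have h3 := congrArg (eval (y t (A.x i j))) h2
        rw [eval_prod, eval_prod, Finset.prod_eq_zero (i := j) (s := univ) (f := fun j' => eval (y t (A.x i j)) (X - C (y t (A.x i j')))) (mem_univ j) (by simp)] at h3
        obtain ⟨j', _, hj'⟩ := Finset.prod_eq_zero_iff.1 h3
        exact ⟨j', by simpa [sub_eq_zero] using hj'⟩
      choose κ hκ using h1
      have hki : Function.Injective κ := by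
        intro a b hab
        apply hyinj t ht i
        change y t (A.x i a) = y t (A.x i b)
        rw [hκ, hκ, hab]
      exact ⟨Equiv.ofBijective κ (Finite.injective_iff_bijective.1 hki), hκ⟩
    choose κ hκ using hκ
    refine ⟨(κ * π)⁻¹ * τ * ((κ * π)⁻¹)⁻¹, h𝒮 τ hτ _, ?_⟩
    intro i j
    rw [hptx, hptx, hκ, hκ, hfr]
    congr 1
    simp
  have hfix : ∀ τ ∈ 𝒮, (#((T ×ˢ (univ : Finset (Fin r → Equiv.Perm (Fin n)))).image pt |>.filter fun z => typ z τ) : ℝ) ≤ (1 + δ) * (p : ℝ) ^ a := by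
    intro τ hτ
    refine hQ k R S p a ha hq (g τ⁻¹) ?_ _ ?_ ?_
    · intro i s hs
      rw [hSM] at hs
      apply Submodule.subset_span
      rw [hSM]
      exact A.WMon_map _ (hgG _) hs
    · intro z hz
      obtain ⟨hz1, hz2⟩ := mem_filter.1 hz
      obtain ⟨u, hu, rfl⟩ := mem_image.1 hz1
      rw [hSD, A.point_Δ, hptt]
      exact hsep u.1 (mem_product.1 hu).1
    · intro z hz i s hs
      obtain ⟨hz1, hz2⟩ := mem_filter.1 hz
      obtain ⟨u, hu, rfl⟩ := mem_image.1 hz1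
      rw [hSM] at hs
      have htq := (hT u.1 (mem_product.1 hu).1).1
      induction hs with
      | one => simp
      | tmul D b _ ih => rw [map_mul, map_mul, map_mul, mul_pow, ih, A.fix _ (hgG _), hptt, htq]
      | xmul D b i j _ ih =>
        rw [map_mul, map_mul, map_mul, mul_pow, ih, hgx, hz2]
        congr 3
        simp
      | mono D D' b h _ ih => exact ih
  have hle : #((T ×ˢ (univ : Finset (Fin r → Equiv.Perm (Fin n)))).image pt) ≤
      ∑ τ ∈ 𝒮, #((T ×ˢ (univ : Finset (Fin r → Equiv.Perm (Fin n)))).image pt |>.filter fun z => typ z τ) := by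
    refine le_trans (card_le_card ?_) card_biUnion_le
    intro z hz
    obtain ⟨u, hu, rfl⟩ := mem_image.1 hz
    obtain ⟨τ, hτ, h⟩ := htyp u hu
    exact mem_biUnion.2 ⟨τ, hτ, mem_filter.2 ⟨hz, h⟩⟩
  rw [card_image_of_injOn hinj, card_product, card_univ, Fintype.card_pi] at hle
  simp only [Fintype.card_perm, Fintype.card_fin, prod_const, card_univ] at hle
  calc (#T : ℝ) * (n.factorial : ℝ) ^ r = ((#T * n.factorial ^ r : ℕ) : ℝ) := by push_cast; rfl
    _ ≤ ((∑ τ ∈ 𝒮, #((T ×ˢ (univ : Finset (Fin r → Equiv.Perm (Fin n)))).image pt |>.filter fun z => typ z τ) : ℕ) : ℝ) := by exact_mod_cast hle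
    _ ≤ ∑ τ ∈ 𝒮, (1 + δ) * (p : ℝ) ^ a := by push_cast; exact sum_le_sum hfix
    _ = _ := by simp

end Cover

end

section
open Finset Polynomial

lemma exists_frobPerm {F k : Type} [Field F] [Fintype F] [Field k] [Algebra F k] [IsAlgClosed k] {n : ℕ} (g : F[X]) (hg : g.Monic)
    (hn : g.natDegree = n) (hs : g.Separable) : ∃ σ : Equiv.Perm (Fin n), FrobPerm k g σ := by
  obtain ⟨ρ, hρ, hf⟩ := fiber_roots (k := k) (n := n) (g.map (algebraMap F k)) (hg.map _) (by rw [hg.natDegree_map, hn]) hs.map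
  have hroot : ∀ x : k, aeval x g = 0 ↔ ∃ j, x = ρ j := by
    intro x
    rw [← eval_map_algebraMap, hf, eval_prod, Finset.prod_eq_zero_iff]
    simp [sub_eq_zero]
  have h1 : ∀ j, ∃ j', ρ j ^ Fintype.card F = ρ j' := by
    intro j
    rw [← hroot, aeval_pow_card', (hroot _).2 ⟨j, rfl⟩, zero_pow Fintype.card_ne_zero]
  choose σ hσ using h1
  have hinj : Function.Injective σ := by
    intro a b hab
    apply hρ
    apply (frobq F k).injective
    rw [frobq_apply, frobq_apply, hσ, hσ, hab]
  exact ⟨Equiv.ofBijective σ (Finite.injective_iff_bijective.1 hinj), ρ, hρ, hf, hσ⟩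

open Classical in
theorem curve (r n e : ℕ) (δ : ℝ) (hδ : 0 < δ) : ∃ Q : ℕ, ∀ (F k : Type) [Field F] [Fintype F] [Field k] [Algebra F k] [IsAlgClosed k],
    Q < Fintype.card F → ∀ (P : Fin r → F[X][X]), (∀ i, (P i).Monic) → (∀ i, (P i).natDegree = n) →
    (∀ i l, ((P i).coeff l).natDegree ≤ e) →
    (∃ t0 : F, ∀ i, ((P i).map (evalRingHom t0)).Separable) →
    (∀ i, ∃ (ts α : F) (h : F[X]), (P i).map (evalRingHom ts) = (X - C α) ^ 2 * h ∧ h.Separable ∧ h.eval α ≠ 0 ∧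
      (∀ i', i' ≠ i → ((P i').map (evalRingHom ts)).Separable) ∧ (derivative ((P i).eval (C α))).eval ts ≠ 0) →
    (∀ i, ∃ (ts α γ : F), γ ≠ α ∧ (P i).map (evalRingHom ts) = (X - C α) ^ (n - 1) * (X - C γ) ∧
      (derivative ((P i).eval (C α))).eval ts ≠ 0) →
    (∀ i, ∃ (ts α : F), (P i).map (evalRingHom ts) = (X - C α) ^ n ∧ (derivative ((P i).eval (C α))).eval ts ≠ 0) →
    #(univ.filter fun t : F => ¬ ∀ i, ((P i).map (evalRingHom t)).Separable) ≤ (r * n) * (e + e * n) ∧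
    ∀ (𝒮 : Finset (Fin r → Equiv.Perm (Fin n))) (_ : ∀ τ ∈ 𝒮, ∀ π, π * τ * π⁻¹ ∈ 𝒮),
      (#(univ.filter fun t : F => ∃ τ ∈ 𝒮, ∀ i, FrobPerm k ((P i).map (evalRingHom t)) (τ i)) : ℝ) * (n.factorial : ℝ) ^ r
        ≤ #𝒮 * ((1 + δ) * Fintype.card F) := by
  obtain ⟨Q, hQ⟩ := Cover.count r n e δ hδ
  refine ⟨Q, ?_⟩
  intro F k _ _ _ _ _ hq P hP hn he ht0 hA hB hC
  obtain ⟨t0, hs⟩ := ht0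
  set φ := algebraMap F k with hφ
  let Pk : Fin r → k[X][X] := fun i => (P i).map (mapRingHom φ)
  have hfib : ∀ i t, (Pk i).map (evalRingHom (φ t)) = ((P i).map (evalRingHom t)).map φ := by
    intro i t
    simp only [Pk]
    rw [Polynomial.map_map, Polynomial.map_map]
    congr 1
    ext x <;> simp
  have hder : ∀ i t α, (derivative ((Pk i).eval (C (φ α)))).eval (φ t) = φ ((derivative ((P i).eval (C α))).eval t) := by
    intro i t α
    have h1 : (Pk i).eval (C (φ α)) = ((P i).eval (C α)).map φ := by
      simp only [Pk]
      rw [eval_map]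
      have := Polynomial.eval₂_at_apply (p := P i) (mapRingHom φ) (C α)
      simpa using this
    rw [h1, derivative_map, eval_map, eval₂_at_apply]
  have hPm : ∀ i, (Pk i).Monic := fun i => (hP i).map _
  have hPn : ∀ i, (Pk i).natDegree = n := fun i => by rw [(hP i).natDegree_map, hn]
  have hPe : ∀ i l, ((Pk i).coeff l).natDegree ≤ e := by
    intro i l
    simp only [Pk, coeff_map]
    exact (natDegree_map_le).trans (he i l)
  have hsk : ∀ t, (∀ i, ((Pk i).map (evalRingHom (φ t))).Separable) ↔ ∀ i, ((P i).map (evalRingHom t)).Separable := by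
    intro t
    refine forall_congr' fun i => ?_
    rw [hfib]
    exact separable_map φ
  obtain ⟨R, _, _, _, ⟨A⟩⟩ := exists_cover Pk hPm hPn hPe (φ t0) ((hsk t0).2 hs)
  obtain ⟨y0, hy0⟩ := A.exists_point (φ t0)
  have hx := A.x_inj y0 (by rw [hy0]; exact (hsk t0).2 hs)
  have hfull : A.permGroup = ⊤ := by
    apply A.full hx
    · intro i
      obtain ⟨ts, α, h, h1, h2, h3, h4, h5⟩ := hA i
      refine ⟨φ ts, φ α, h.map φ, ?_, h2.map, ?_, ?_, ?_⟩
      · rw [hfib, h1]; simp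
      · rw [eval_map, eval₂_at_apply]; exact (map_ne_zero φ).2 h3
      · intro i' hi
        rw [hfib]; exact (h4 i' hi).map
      · rw [hder]; exact (map_ne_zero φ).2 h5
    · intro i
      obtain ⟨ts, α, γ, h1, h2, h3⟩ := hB i
      refine ⟨φ ts, φ α, φ γ, fun h => h1 (φ.injective h), ?_, ?_⟩
      · rw [hfib, h2]; simp
      · rw [hder]; exact (map_ne_zero φ).2 h3
    · intro i
      obtain ⟨ts, α, h2, h3⟩ := hC i
      refine ⟨φ ts, φ α, ?_, ?_⟩
      · rw [hfib, h2]; simp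
      · rw [hder]; exact (map_ne_zero φ).2 h3
  constructor
  · obtain ⟨D, hD0, hDd, hDe⟩ := A.exists_disc hPn hPe (φ t0) ((hsk t0).2 hs)
    calc _ = #((univ.filter fun t : F => ¬ ∀ i, ((P i).map (evalRingHom t)).Separable).image φ) :=
          (card_image_of_injective _ φ.injective).symm
      _ ≤ #D.roots.toFinset := by
          apply card_le_card
          intro z hz
          obtain ⟨t, ht, rfl⟩ := mem_image.1 hz
          rw [Multiset.mem_toFinset, mem_roots hD0, IsRoot]
          by_contra h
          exact (mem_filter.1 ht).2 ((hsk t).1 ((hDe _).1 h))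
      _ ≤ Multiset.card D.roots := Multiset.toFinset_card_le _
      _ ≤ D.natDegree := card_roots' D
      _ ≤ _ := hDd
  · intro 𝒮 h𝒮
    obtain ⟨p, a, hp, hk, _, ha, hc⟩ := charP_aux (F := F) (k := k)
    haveI : Fact p.Prime := ⟨hp⟩
    have := hQ k R Pk A hPn hPe hx hfull p a ha (by rw [← hc]; exact hq) 𝒮 h𝒮
      ((univ.filter fun t : F => ∃ τ ∈ 𝒮, ∀ i, FrobPerm k ((P i).map (evalRingHom t)) (τ i)).image φ) (by
        intro z hz
        obtain ⟨t, ht, rfl⟩ := mem_image.1 hz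
        obtain ⟨τ, hτ, h⟩ := (mem_filter.1 ht).2
        refine ⟨by rw [← hc, ← map_pow, FiniteField.pow_card], τ, hτ, fun i => ?_⟩
        obtain ⟨ρ, h1, h2, h3⟩ := h i
        exact ⟨ρ, h1, by rw [hfib]; exact h2, by rw [← hc]; exact h3⟩)
    rw [card_image_of_injective _ φ.injective] at this
    rw [hc]
    exact_mod_cast this

end

section
open Finset Polynomial

open Classical in
lemma sep_line {F : Type} [Field F] [Fintype F] (u v : F[X]) (hc : IsCoprime u v) (hv : derivative v ≠ 0) :
    #(univ.filter fun s : F => ¬ (u + C s * v).Separable) ≤ u.natDegree + v.natDegree := by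
  let k := AlgebraicClosure F
  set w := derivative u * v - u * derivative v with hw
  have hw0 : w ≠ 0 := by
    intro h
    have h1 : v ∣ derivative v * u := ⟨derivative u, by rw [hw, sub_eq_zero] at h; rw [mul_comm, ← h, mul_comm]⟩
    have h2 : v ∣ derivative v := hc.symm.dvd_of_dvd_mul_right h1
    have h3 := natDegree_le_of_dvd h2 hv
    have h4 : v.natDegree ≠ 0 := by
      intro h0
      rw [natDegree_eq_zero] at h0
      obtain ⟨c, rfl⟩ := h0
      simp at hv
    have := natDegree_derivative_lt h4
    omega
  have hwd : w.natDegree ≤ u.natDegree + v.natDegree := by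
    refine (natDegree_sub_le _ _).trans (max_le ?_ ?_)
    · exact natDegree_mul_le.trans (Nat.add_le_add_right ((natDegree_derivative_le u).trans (Nat.sub_le _ _)) _)
    · exact natDegree_mul_le.trans (Nat.add_le_add_left ((natDegree_derivative_le v).trans (Nat.sub_le _ _)) _)
  have hroot : ∀ s ∈ (univ.filter fun s : F => ¬ (u + C s * v).Separable), ∃ x : k, aeval x u + algebraMap F k s * aeval x v = 0 ∧ aeval x w = 0 := by
    intro s hs
    have h1 := (mem_filter.1 hs).2
    rw [Polynomial.Separable, isCoprime_iff_aeval_ne_zero_of_isAlgClosed F k] at h1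
    push Not at h1
    obtain ⟨x, h2, h3⟩ := h1
    refine ⟨x, by simpa using h2, ?_⟩
    simp only [map_add, map_mul, derivative_add, derivative_mul, derivative_C, zero_mul, zero_add, aeval_C] at h2 h3
    rw [hw, map_sub, map_mul, map_mul]
    linear_combination (aeval x v) * h3 - (aeval x (derivative v)) * h2
  choose! x hx1 hx2 using hroot
  have hvx : ∀ s ∈ (univ.filter fun s : F => ¬ (u + C s * v).Separable), aeval (x s) v ≠ 0 := by
    intro s hs h
    have h1 := hx1 s hs
    rw [h, mul_zero, add_zero] at h1
    rcases (isCoprime_iff_aeval_ne_zero_of_isAlgClosed F k u v).1 hc (x s) with h' | h'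
    · exact h' h1
    · exact h' h
  have hinj : Set.InjOn x (univ.filter fun s : F => ¬ (u + C s * v).Separable : Finset F) := by
    intro s hs s' hs' h
    have h1 := hx1 s hs
    have h2 := hx1 s' hs'
    rw [← h] at h2
    apply (algebraMap F k).injective
    apply mul_right_cancel₀ (hvx s hs)
    linear_combination h1 - h2
  calc _ = #((univ.filter fun s : F => ¬ (u + C s * v).Separable).image x) := (card_image_of_injOn hinj).symm
    _ ≤ #((w.map (algebraMap F k)).roots.toFinset) := by
        apply card_le_card
        intro z hz
        obtain ⟨s, hs, rfl⟩ := mem_image.1 hz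
        rw [Multiset.mem_toFinset, mem_roots (by rwa [Ne, Polynomial.map_eq_zero]), IsRoot, eval_map_algebraMap]
        exact hx2 s hs
    _ ≤ Multiset.card (w.map (algebraMap F k)).roots := Multiset.toFinset_card_le _
    _ ≤ (w.map (algebraMap F k)).natDegree := card_roots' _
    _ ≤ _ := natDegree_map_le.trans hwd

lemma exists_notMem_of_card {F : Type} [Fintype F] (S : Finset F) (h : #S < Fintype.card F) : ∃ s, s ∉ S := by
  by_contra hc
  push Not at hc
  rw [eq_univ_of_forall hc, card_univ] at h
  omega

lemma coprime_X_sub_C {F : Type} [Field F] (u : F[X]) (α : F) (h : u.eval α ≠ 0) : IsCoprime u (X - C α) := by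
  rw [isCoprime_comm]
  refine (irreducible_X_sub_C α).coprime_iff_not_dvd.2 ?_
  rwa [dvd_iff_isRoot]

lemma monic_sub_low {F : Type} [Field F] {n : ℕ} (f b : F[X]) (hf : f.Monic) (hn : f.natDegree = n) (hb : b.degree < (n : WithBot ℕ)) :
    (f + b).Monic ∧ (f + b).natDegree = n := by
  have hd : b.degree < f.degree := by rw [degree_eq_natDegree hf.ne_zero, hn]; exact hb
  refine ⟨hf.add_of_left hd, ?_⟩
  rw [natDegree_add_eq_left_of_degree_lt hd, hn]

lemma target_D {F : Type} [Field F] [Fintype F] {r n : ℕ} (hn : 4 ≤ n) (hq : 10 * (r + 1) * (n + 1) < Fintype.card F) (a : Fin r → F[X])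
    (ha : ∀ i, (a i).degree < (n : WithBot ℕ)) :
    ∃ f : F[X], f.Monic ∧ f.natDegree = n ∧ ∀ i, (f + a i).Separable := by
  classical
  obtain ⟨κ, hκ⟩ := exists_notMem_of_card (univ.image fun i => - (a i).eval 0 : Finset F) (by
    refine lt_of_le_of_lt card_image_le ?_
    simp only [card_univ, Fintype.card_fin]; nlinarith)
  have hm : (X ^ n + C κ : F[X]).Monic ∧ (X ^ n + C κ : F[X]).natDegree = n :=
    ⟨monic_X_pow_add_C _ (by omega), natDegree_X_pow_add_C⟩
  have hmi := fun i => monic_sub_low _ _ hm.1 hm.2 (ha i)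
  obtain ⟨s, hs⟩ := exists_notMem_of_card ((univ : Finset (Fin r)).biUnion fun i => univ.filter fun s : F => ¬ (X ^ n + C κ + a i + C s * X : F[X]).Separable) (by
    refine lt_of_le_of_lt (b := r * (n + 1)) ?_ (by nlinarith)
    refine (card_biUnion_le_card_mul _ _ (n + 1) fun i _ => ?_).trans_eq (by simp)
    refine (sep_line _ _ ?_ (by simp)).trans ?_
    · have := coprime_X_sub_C (X ^ n + C κ + a i) 0 (by
        intro h
        apply hκ
        rw [mem_image]
        refine ⟨i, mem_univ _, ?_⟩
        simp [show n ≠ 0 by omega] at h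
        linear_combination -h)
      simpa using this
    · rw [(hmi i).2, natDegree_X])
  have hlow : (C s * X : F[X]).degree < (n : WithBot ℕ) := by
    refine lt_of_le_of_lt (degree_C_mul_X_le s) ?_
    exact_mod_cast (by omega : 1 < n)
  have h2 := monic_sub_low _ _ hm.1 hm.2 hlow
  refine ⟨X ^ n + C κ + C s * X, h2.1, h2.2, fun i => ?_⟩
  by_contra hc
  apply hs
  simp only [mem_biUnion, mem_univ, true_and, mem_filter]
  refine ⟨i, ?_⟩
  rwa [add_right_comm]

lemma target_A {F : Type} [Field F] [Fintype F] {r n : ℕ} (hn : 4 ≤ n) (hq : 10 * (r + 1) * (n + 1) < Fintype.card F) (a : Fin r → F[X])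
    (ha : ∀ i, (a i).degree < (n : WithBot ℕ)) (α : F) (i : Fin r) (hα : ∀ j, j ≠ i → (a j - a i).eval α ≠ 0) :
    ∃ f h : F[X], f.Monic ∧ f.natDegree = n ∧ f + a i = (X - C α) ^ 2 * h ∧ h.Separable ∧ h.eval α ≠ 0 ∧
      ∀ j, j ≠ i → (f + a j).Separable := by
  classical
  obtain ⟨ν, hν⟩ := exists_notMem_of_card (insert 0 (univ.image fun j => - (a j - a i).eval (α - 1)) : Finset F) (by
    refine lt_of_le_of_lt (card_insert_le _ _) ?_
    have := card_image_le (s := (univ : Finset (Fin r))) (f := fun j => - (a j - a i).eval (α - 1))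
    simp only [card_univ, Fintype.card_fin] at this; nlinarith)
  rw [mem_insert, not_or] at hν
  obtain ⟨hν0, hν1⟩ := hν
  set Y : F[X] := X - C α with hY
  set h0 : F[X] := Y ^ (n - 2) + C (ν - (-1) ^ (n - 2)) with hh0
  set Z : F[X] := X - C (α - 1) with hZ
  have hYm : Y.Monic := monic_X_sub_C α
  have hYd : Y.natDegree = 1 := natDegree_X_sub_C α
  have hZd : Z.natDegree = 1 := natDegree_X_sub_C _
  have hh0m : h0.Monic ∧ h0.natDegree = n - 2 := by
    apply monic_sub_low _ _ (hYm.pow _) (by rw [hYm.natDegree_pow, hYd, mul_one])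
    refine lt_of_le_of_lt degree_C_le ?_
    exact_mod_cast (by omega : 0 < n - 2)
  have hh0e : h0.eval (α - 1) = ν := by simp [hh0, hY]
  have hlow : ∀ s, (C s * Z : F[X]).degree < ((n - 2 : ℕ) : WithBot ℕ) := by
    intro s
    refine lt_of_le_of_lt ((degree_mul_le _ _).trans (add_le_add_left degree_C_le _)) ?_
    rw [hZ, degree_X_sub_C, zero_add]
    exact_mod_cast (by omega : 1 < n - 2)
  have hYh : ∀ h : F[X], h.Monic → h.natDegree = n - 2 → (Y ^ 2 * h).Monic ∧ (Y ^ 2 * h).natDegree = n := by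
    intro h h1 h2
    refine ⟨(hYm.pow 2).mul h1, ?_⟩
    rw [(hYm.pow 2).natDegree_mul h1, hYm.natDegree_pow, hYd, h2]; omega
  have hdiff : ∀ j, (a j - a i).degree < (n : WithBot ℕ) := fun j => (degree_sub_le _ _).trans_lt (max_lt (ha j) (ha i))
  have hv : derivative (Y ^ 2 * Z) ≠ 0 := by
    have e1 : derivative (Y ^ 2 * Z) = Y * (C 2 * Z + Y) := by
      rw [derivative_mul, derivative_pow, hY, hZ]
      simp only [derivative_sub, derivative_X, derivative_C, sub_zero]
      simp only [map_ofNat, Nat.cast_ofNat]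
      ring
    rw [e1]
    refine mul_ne_zero hYm.ne_zero fun h => ?_
    have h1 := congrArg (eval α) h
    have h2 := congrArg (eval (α + 1)) h
    simp [hY, hZ] at h1 h2
    have : (1 : F) = 0 := by linear_combination h2 - 2 * h1
    exact one_ne_zero this
  let B1 : Finset F := univ.filter fun s : F => ¬ (h0 + C s * Z).Separable
  let B2 : Finset F := (univ.erase i).biUnion fun j => univ.filter fun s : F => ¬ (Y ^ 2 * h0 + (a j - a i) + C s * (Y ^ 2 * Z)).Separable
  obtain ⟨s, hs⟩ := exists_notMem_of_card (B1 ∪ B2 ∪ {- h0.eval α}) (by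
    have c1 : #B1 ≤ n := by
      refine (sep_line _ _ (coprime_X_sub_C _ _ (by rw [hh0e]; exact hν0)) (by simp [hZ])).trans ?_
      rw [hh0m.2, hZd]; omega
    have c2 : #B2 ≤ r * (n + 3) := by
      refine (card_biUnion_le_card_mul _ _ (n + 3) fun j hj => ?_).trans
        (Nat.mul_le_mul_right _ ((card_le_univ _).trans_eq (by simp)))
      refine (sep_line _ _ ?_ hv).trans ?_
      · refine IsCoprime.mul_right (IsCoprime.pow_right ?_) ?_
        · apply coprime_X_sub_C
          simpa [hY] using hα j (ne_of_mem_erase hj)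
        · apply coprime_X_sub_C
          rw [eval_add, eval_mul, hh0e]
          intro h
          apply hν1
          rw [mem_image]
          refine ⟨j, mem_univ _, ?_⟩
          simp only [hY, eval_pow, eval_sub, eval_X, eval_C] at h ⊢
          linear_combination -h
      · rw [(monic_sub_low _ _ (hYh h0 hh0m.1 hh0m.2).1 (hYh h0 hh0m.1 hh0m.2).2 (hdiff j)).2]
        refine Nat.add_le_add_left (natDegree_mul_le.trans ?_) _
        rw [hYm.natDegree_pow, hYd, hZd]
    have c3 := card_union_le (B1 ∪ B2) {- h0.eval α}
    have c4 := card_union_le B1 B2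
    rw [card_singleton] at c3
    nlinarith)
  simp only [mem_union, not_or, mem_singleton] at hs
  obtain ⟨⟨hs1, hs2⟩, hs3⟩ := hs
  have hhm := monic_sub_low _ _ hh0m.1 hh0m.2 (hlow s)
  have hf := hYh _ hhm.1 hhm.2
  have hfm := monic_sub_low _ (- a i) hf.1 hf.2 (by rw [degree_neg]; exact ha i)
  refine ⟨Y ^ 2 * (h0 + C s * Z) + - a i, h0 + C s * Z, hfm.1, hfm.2, by ring, ?_, ?_, ?_⟩
  · by_contra h; exact hs1 (mem_filter.2 ⟨mem_univ _, h⟩)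
  · intro h
    apply hs3
    simp [hZ] at h
    linear_combination h
  · intro j hj
    by_contra h
    apply hs2
    refine mem_biUnion.2 ⟨j, mem_erase.2 ⟨hj, mem_univ _⟩, mem_filter.2 ⟨mem_univ _, ?_⟩⟩
    convert h using 2
    ring

end

section
open Finset Polynomial

section
variable {F ι : Type} [Field F] [Fintype ι] [DecidableEq ι] {n : ℕ}

/-- one-parameter family through prescribed members -/
noncomputable def fam (n : ℕ) (v : ι → F) (tgt : ι → F[X]) (l : F[X]) : F[X][X] :=
  X ^ n + ∑ i, C (Lagrange.basis univ v i) * (tgt i - X ^ n).map C + C (Lagrange.nodal univ v) * l.map C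

lemma map_C_eval (s : F) (p : F[X]) : (p.map C).map (evalRingHom s) = p := by
  rw [Polynomial.map_map]
  have : (evalRingHom s).comp C = RingHom.id F := by ext; simp
  rw [this, Polynomial.map_id]

lemma fam_fiber (v : ι → F) (tgt : ι → F[X]) (l : F[X]) (s : F) :
    (fam n v tgt l).map (evalRingHom s) =
      X ^ n + ∑ i, C ((Lagrange.basis univ v i).eval s) * (tgt i - X ^ n) + C ((Lagrange.nodal univ v).eval s) * l := by
  rw [fam]
  simp only [Polynomial.map_add, Polynomial.map_mul, Polynomial.map_sum, Polynomial.map_pow, map_X, map_C, map_C_eval, coe_evalRingHom]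

lemma fam_special (v : ι → F) (hv : Function.Injective v) (tgt : ι → F[X]) (l : F[X]) (i : ι) :
    (fam n v tgt l).map (evalRingHom (v i)) = tgt i := by
  rw [fam_fiber, Finset.sum_eq_single i, Lagrange.eval_basis_self hv.injOn (mem_univ i), Lagrange.eval_nodal_at_node (mem_univ i)]
  · simp
  · intro j _ hj
    rw [Lagrange.eval_basis_of_ne hj (mem_univ i)]; simp
  · simp

lemma low_of_monic (f : F[X]) (hf : f.Monic) (hn : f.natDegree = n) : (f - X ^ n).degree < (n : WithBot ℕ) := by
  have h1 : f.degree = n := by rw [degree_eq_natDegree hf.ne_zero, hn]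
  rw [← h1]
  exact degree_sub_lt (by rw [h1, degree_X_pow]) hf.ne_zero (by rw [hf, leadingCoeff_X_pow])

lemma degree_CmapC (p : F[X]) (l : F[X]) (hl : l.degree < (n : WithBot ℕ)) : (C p * l.map C : F[X][X]).degree < (n : WithBot ℕ) := by
  refine lt_of_le_of_lt ((degree_mul_le _ _).trans (add_le_add_left degree_C_le _)) ?_
  rw [zero_add]
  exact lt_of_le_of_lt degree_map_le hl

lemma fam_monic (v : ι → F) (tgt : ι → F[X]) (ht : ∀ i, (tgt i).Monic) (htn : ∀ i, (tgt i).natDegree = n) (l a : F[X])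
    (hl : l.degree < (n : WithBot ℕ)) (ha : a.degree < (n : WithBot ℕ)) :
    (fam n v tgt l + a.map C).Monic ∧ (fam n v tgt l + a.map C).natDegree = n := by
  have hlow : (∑ i, C (Lagrange.basis univ v i) * (tgt i - X ^ n).map C + C (Lagrange.nodal univ v) * l.map C + a.map C : F[X][X]).degree < (n : WithBot ℕ) := by
    refine (degree_add_le _ _).trans_lt (max_lt ((degree_add_le _ _).trans_lt (max_lt ?_ (degree_CmapC _ _ hl))) (lt_of_le_of_lt degree_map_le ha))
    refine (degree_sum_le _ _).trans_lt ((Finset.sup_lt_iff (WithBot.bot_lt_coe n)).2 fun i _ => ?_)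
    exact degree_CmapC _ _ (low_of_monic _ (ht i) (htn i))
  have e1 : fam n v tgt l + a.map C = X ^ n + (∑ i, C (Lagrange.basis univ v i) * (tgt i - X ^ n).map C + C (Lagrange.nodal univ v) * l.map C + a.map C) := by
    rw [fam]; ring
  have hd : (∑ i, C (Lagrange.basis univ v i) * (tgt i - X ^ n).map C + C (Lagrange.nodal univ v) * l.map C + a.map C : F[X][X]).degree < (X ^ n : F[X][X]).degree := by
    rw [degree_X_pow]; exact hlow
  rw [e1]
  refine ⟨(monic_X_pow n).add_of_left hd, ?_⟩
  rw [natDegree_add_eq_left_of_degree_lt hd, natDegree_X_pow]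

lemma fam_coeff (v : ι → F) (hv : Function.Injective v) (tgt : ι → F[X]) (l a : F[X]) (m : ℕ) :
    ((fam n v tgt l + a.map C).coeff m).natDegree ≤ Fintype.card ι := by
  have hC : ∀ (p b : F[X]), p.natDegree ≤ Fintype.card ι → ((C p * b.map C : F[X][X]).coeff m).natDegree ≤ Fintype.card ι := by
    intro p b hp
    rw [coeff_C_mul, coeff_map]
    exact (natDegree_mul_C_le _ _).trans hp
  rw [fam]
  simp only [coeff_add, finset_sum_coeff]
  refine natDegree_add_le_of_degree_le (natDegree_add_le_of_degree_le (natDegree_add_le_of_degree_le ?_ ?_) ?_) ?_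
  · rw [coeff_X_pow]; split_ifs <;> simp
  · refine natDegree_sum_le_of_forall_le _ _ fun i _ => hC _ _ ?_
    have := Lagrange.degree_basis hv.injOn (mem_univ i)
    rw [natDegree_eq_of_degree_eq_some this, card_univ]; omega
  · refine hC _ _ ?_
    rw [Lagrange.natDegree_nodal, card_univ]
  · rw [coeff_map, natDegree_C]; omega

lemma fam_der (v : ι → F) (hv : Function.Injective v) (tgt : ι → F[X]) (a : F[X]) (α : F) (j : ι) :
    ∃ K L : F, L ≠ 0 ∧ ∀ l : F[X], (derivative ((fam n v tgt l + a.map C).eval (C α))).eval (v j) = K + L * l.eval α := by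
  have hm : ∀ p : F[X], (p.map C).eval (C α) = C (p.eval α) := by
    intro p
    rw [eval_map, eval₂_at_apply]
  refine ⟨∑ i, (derivative (Lagrange.basis univ v i)).eval (v j) * (tgt i - X ^ n).eval α, (derivative (Lagrange.nodal univ v)).eval (v j), ?_, ?_⟩
  · rw [Lagrange.eval_nodal_derivative_eval_node_eq (mem_univ j)]
    exact Lagrange.eval_nodal_not_at_node fun i hi h => (ne_of_mem_erase hi) (hv h.symm)
  · intro l
    rw [fam]
    simp only [eval_add, eval_finset_sum, eval_mul, eval_C, eval_pow, eval_X, hm, derivative_add, derivative_sum, derivative_mul,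
      derivative_C, mul_zero, add_zero, ← C_pow, zero_add]
end

end

section
open Finset Polynomial

noncomputable instance fintypeLT {F : Type} [Field F] [Fintype F] (n : ℕ) : Fintype (degreeLT F n) :=
  Fintype.ofEquiv _ (degreeLTEquiv F n).symm.toEquiv

lemma card_LT {F : Type} [Field F] [Fintype F] (n : ℕ) : Fintype.card (degreeLT F n) = Fintype.card F ^ n := by
  rw [Fintype.card_congr (degreeLTEquiv F n).toEquiv]; simp

section
variable {F ι : Type} [Field F] [Fintype F] [Fintype ι] [DecidableEq ι] {n : ℕ}

open Classical in
lemma fam_count (v : ι → F) (hv : Function.Injective v) (tgt : ι → F[X]) (ht : ∀ i, (tgt i).Monic) (htn : ∀ i, (tgt i).natDegree = n)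
    (p : F[X] → Prop) :
    (Fintype.card F - Fintype.card ι) * #(univ.filter fun l : degreeLT F n => p (X ^ n + (l : F[X]))) ≤
      ∑ l : degreeLT F n, #(univ.filter fun s : F => p ((fam n v tgt l).map (evalRingHom s))) := by
  have h1 : ∀ s ∈ univ \ univ.image v, #(univ.filter fun l : degreeLT F n => p ((fam n v tgt l).map (evalRingHom s))) =
      #(univ.filter fun l : degreeLT F n => p (X ^ n + (l : F[X]))) := by
    intro s hs
    have hs' : ∀ i, s ≠ v i := by
      intro i h
      rw [mem_sdiff] at hs
      exact hs.2 (mem_image.2 ⟨i, mem_univ _, h.symm⟩)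
    have hc : (Lagrange.nodal univ v).eval s ≠ 0 := Lagrange.eval_nodal_not_at_node fun i _ => hs' i
    let b : degreeLT F n := ∑ i, (Lagrange.basis univ v i).eval s • (⟨tgt i - X ^ n, mem_degreeLT.2 (low_of_monic _ (ht i) (htn i))⟩ : degreeLT F n)
    let E : degreeLT F n → degreeLT F n := fun l => b + (Lagrange.nodal univ v).eval s • l
    have hE : Function.Bijective E := by
      rw [← Finite.injective_iff_bijective]
      intro l l' h
      exact smul_right_injective _ hc (add_left_cancel h)
    refine Finset.card_bijective E hE fun l => ?_
    simp only [mem_filter, mem_univ, true_and]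
    have : (fam n v tgt l).map (evalRingHom s) = X ^ n + (E l : F[X]) := by
      rw [fam_fiber]
      simp only [E, b, Submodule.coe_add, Submodule.coe_sum, Submodule.coe_smul, smul_eq_C_mul]
      rw [add_assoc]
    rw [this]
  calc (Fintype.card F - Fintype.card ι) * #(univ.filter fun l : degreeLT F n => p (X ^ n + (l : F[X])))
      = ∑ s ∈ univ \ univ.image v, #(univ.filter fun l : degreeLT F n => p ((fam n v tgt l).map (evalRingHom s))) := by
        rw [sum_congr rfl h1, sum_const, card_sdiff_of_subset (subset_univ _), card_image_of_injective _ hv, card_univ, card_univ, smul_eq_mul]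
    _ ≤ ∑ s : F, #(univ.filter fun l : degreeLT F n => p ((fam n v tgt l).map (evalRingHom s))) :=
        sum_le_sum_of_subset (subset_univ _)
    _ = _ := by
        simp only [card_filter]
        exact sum_comm

open Classical in
lemma bad_count (hn : 1 ≤ n) (α : F) (BS : Finset F) :
    #(univ.filter fun l : degreeLT F n => (l : F[X]).eval α ∈ BS) * Fintype.card F ≤ #BS * Fintype.card F ^ n := by
  have hC : ∀ c : F, (C c : F[X]) ∈ degreeLT F n := by
    intro c
    rw [mem_degreeLT]
    refine degree_C_le.trans_lt ?_
    exact_mod_cast hn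
  rw [← card_LT n, ← card_univ, ← card_univ, ← card_product, ← card_product]
  refine Finset.card_le_card_of_injOn (fun u => ((u.1 : F[X]).eval α, u.1 + ⟨C u.2, hC u.2⟩)) ?_ ?_
  · rintro ⟨l, c⟩ h
    simp at h ⊢
    exact h
  · rintro ⟨l, c⟩ _ ⟨l', c'⟩ _ h
    simp only [Prod.mk.injEq] at h
    obtain ⟨h1, h2⟩ := h
    have h3 : (l : F[X]) + C c = l' + C c' := congrArg Subtype.val h2
    have h4 := congrArg (eval α) h3
    simp only [eval_add, eval_C, h1, add_right_inj] at h4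
    subst h4
    have h5 := add_right_cancel h2
    rw [h5]

end

open Classical in
theorem equidist (r n : ℕ) (hn : 4 ≤ n) (δ : ℝ) (hδ : 0 < δ) : ∃ Q : ℕ, ∀ (F k : Type) [Field F] [Fintype F] [Field k] [Algebra F k] [IsAlgClosed k],
    Q < Fintype.card F → ∀ (a : Fin r → F[X]), Function.Injective a → (∀ i, (a i).degree < (n : WithBot ℕ)) →
    ((Fintype.card F : ℝ) - (3 * r + 1)) * #(univ.filter fun l : degreeLT F n => ¬ ∀ i, (X ^ n + (l : F[X]) + a i).Separable) ≤
      (Fintype.card F : ℝ) ^ n * ((r * n : ℝ) * ((3 * r + 1) + (3 * r + 1) * n) + 3 * r) ∧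
    ∀ (𝒮 : Finset (Fin r → Equiv.Perm (Fin n))) (_ : ∀ τ ∈ 𝒮, ∀ π, π * τ * π⁻¹ ∈ 𝒮),
      ((Fintype.card F : ℝ) - (3 * r + 1)) * #(univ.filter fun l : degreeLT F n => ∃ τ ∈ 𝒮, ∀ i, FrobPerm k (X ^ n + (l : F[X]) + a i) (τ i)) ≤
       (Fintype.card F : ℝ) ^ n * (#𝒮 / (n.factorial : ℝ) ^ r * (1 + δ) * Fintype.card F + 3 * r) := by
  obtain ⟨Q, hQ⟩ := curve r n (3 * r + 1) δ hδ
  refine ⟨Q + 10 * (r + 1) * (n + 1) + r * r * n + 3 * r + 1, ?_⟩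
  intro F k _ _ _ _ _ hq a hinj ha
  -- the point α
  obtain ⟨α, hα⟩ := exists_notMem_of_card (((univ : Finset (Fin r × Fin r)).filter fun u => u.1 ≠ u.2).biUnion fun u => (a u.1 - a u.2).roots.toFinset) (by
    refine lt_of_le_of_lt (b := r * r * n) ?_ (by omega)
    refine (card_biUnion_le_card_mul _ _ n fun u hu => ?_).trans (Nat.mul_le_mul_right _ ((card_le_univ _).trans_eq (by simp)))
    refine (Multiset.toFinset_card_le _).trans ((card_roots' _).trans ?_)
    have h1 : (a u.1 - a u.2).degree < (n : WithBot ℕ) := (degree_sub_le _ _).trans_lt (max_lt (ha _) (ha _))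
    exact natDegree_le_of_degree_le h1.le)
  have hα' : ∀ i j, j ≠ i → (a j - a i).eval α ≠ 0 := by
    intro i j hij h
    apply hα
    refine mem_biUnion.2 ⟨(j, i), mem_filter.2 ⟨mem_univ _, hij⟩, ?_⟩
    rw [Multiset.mem_toFinset, mem_roots (sub_ne_zero.2 fun h => hij (hinj h))]
    exact h
  obtain ⟨fD, hD1, hD2, hD3⟩ := target_D hn (by omega) a ha
  choose fA hA hA1 hA2 hA3 hA4 hA5 hA6 using fun i => target_A hn (by omega) a ha α i (hα' i)
  let fB : Fin r → F[X] := fun i => (X - C α) ^ (n - 1) * (X - C (α + 1)) + - a i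
  let fC : Fin r → F[X] := fun i => (X - C α) ^ n + - a i
  have hneg : ∀ i, (- a i).degree < (n : WithBot ℕ) := fun i => by rw [degree_neg]; exact ha i
  have hB : ∀ i, (fB i).Monic ∧ (fB i).natDegree = n := by
    intro i
    refine monic_sub_low _ _ (((monic_X_sub_C α).pow _).mul (monic_X_sub_C _)) ?_ (hneg i)
    rw [((monic_X_sub_C α).pow _).natDegree_mul (monic_X_sub_C _), (monic_X_sub_C α).natDegree_pow, natDegree_X_sub_C, natDegree_X_sub_C]
    omega
  have hC : ∀ i, (fC i).Monic ∧ (fC i).natDegree = n := by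
    intro i
    refine monic_sub_low _ _ ((monic_X_sub_C α).pow _) ?_ (hneg i)
    rw [(monic_X_sub_C α).natDegree_pow, natDegree_X_sub_C, mul_one]
  let ι := Option (Fin r × Fin 3)
  have hι : Fintype.card ι = 3 * r + 1 := by simp [ι, mul_comm]
  obtain ⟨v, hv⟩ : ∃ v : ι → F, Function.Injective v := by
    have : Fintype.card ι ≤ Fintype.card F := by rw [hι]; omega
    obtain ⟨e⟩ := Function.Embedding.nonempty_of_card_le this
    exact ⟨e, e.injective⟩
  let tgt : ι → F[X] := fun u => match u with
    | none => fD
    | some (i, 0) => fA i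
    | some (i, 1) => fB i
    | some (i, 2) => fC i
  have htgt : ∀ u, (tgt u).Monic ∧ (tgt u).natDegree = n := by
    intro u
    match u with
    | none => exact ⟨hD1, hD2⟩
    | some (i, 0) => exact ⟨hA1 i, hA2 i⟩
    | some (i, 1) => exact hB i
    | some (i, 2) => exact hC i
  choose K L hL hKL using fun u : Fin r × Fin 3 => fam_der (n := n) v hv tgt (a u.1) α (some u)
  let BS : Finset F := univ.image fun u : Fin r × Fin 3 => - K u / L u
  have hBS : #BS ≤ 3 * r := card_image_le.trans (by simp [mul_comm])
  have hgood : ∀ l : degreeLT F n, (l : F[X]).eval α ∉ BS → ∀ u : Fin r × Fin 3,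
      (derivative ((fam n v tgt l + (a u.1).map C).eval (C α))).eval (v (some u)) ≠ 0 := by
    intro l hl u h
    rw [hKL] at h
    apply hl
    refine mem_image.2 ⟨u, mem_univ _, ?_⟩
    rw [div_eq_iff (hL u)]
    linear_combination -h
  have hfib : ∀ (l : F[X]) i s, (fam n v tgt l + (a i).map C).map (evalRingHom s) = (fam n v tgt l).map (evalRingHom s) + a i := by
    intro l i s
    rw [Polynomial.map_add, map_C_eval]
  have hcurve : ∀ l : degreeLT F n, (l : F[X]).eval α ∉ BS → _ := fun l hl => hQ F k (by omega) (fun i => fam n v tgt l + (a i).map C)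
    (fun i => (fam_monic v tgt (fun u => (htgt u).1) (fun u => (htgt u).2) l (a i) (mem_degreeLT.1 l.2) (ha i)).1)
    (fun i => (fam_monic v tgt (fun u => (htgt u).1) (fun u => (htgt u).2) l (a i) (mem_degreeLT.1 l.2) (ha i)).2)
    (fun i m => by rw [← hι]; exact fam_coeff v hv tgt l (a i) m)
    ⟨v none, fun i => by rw [hfib, fam_special v hv]; exact hD3 i⟩
    (fun i => ⟨v (some (i, 0)), α, hA i, by rw [hfib, fam_special v hv]; exact hA3 i, hA4 i, hA5 i,
      fun j hj => by rw [hfib, fam_special v hv]; exact hA6 i j hj, hgood l hl (i, 0)⟩)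
    (fun i => ⟨v (some (i, 1)), α, α + 1, by simp, by
      rw [hfib, fam_special v hv]; change fB i + a i = _; simp only [fB]; ring, hgood l hl (i, 1)⟩)
    (fun i => ⟨v (some (i, 2)), α, by
      rw [hfib, fam_special v hv]; change fC i + a i = _; simp only [fC]; ring, hgood l hl (i, 2)⟩)
  set q := Fintype.card F with hqdef
  have hq0 : (0 : ℝ) < q := by exact_mod_cast (by omega : 0 < q)
  -- general averaging
  have havg : ∀ (p : F[X] → Prop) (Bd : ℝ), 0 ≤ Bd → (∀ l : degreeLT F n, (l : F[X]).eval α ∉ BS →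
      (#(univ.filter fun s : F => p ((fam n v tgt l).map (evalRingHom s))) : ℝ) ≤ Bd) →
      ((q : ℝ) - (3 * r + 1)) * #(univ.filter fun l : degreeLT F n => p (X ^ n + (l : F[X]))) ≤ (q : ℝ) ^ n * (Bd + 3 * r) := by
    intro p Bd hBd hp
    have h1 := fam_count v hv tgt (fun u => (htgt u).1) (fun u => (htgt u).2) p
    have h2 := bad_count (n := n) (by omega) α BS
    rw [hι] at h1
    have h3 : ((∑ l : degreeLT F n, #(univ.filter fun s : F => p ((fam n v tgt l).map (evalRingHom s))) : ℕ) : ℝ) ≤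
        ∑ l : degreeLT F n, (Bd + if (l : F[X]).eval α ∈ BS then (q : ℝ) else 0) := by
      push_cast
      refine sum_le_sum fun l _ => ?_
      split_ifs with h
      · have : (#(univ.filter fun s : F => p ((fam n v tgt l).map (evalRingHom s))) : ℝ) ≤ q := by
          exact_mod_cast card_le_univ _
        linarith
      · simpa using hp l h
    rw [sum_add_distrib, sum_const, card_univ, card_LT, nsmul_eq_mul, ← sum_filter, sum_const, nsmul_eq_mul] at h3
    have h4 : (((q - (3 * r + 1)) * #(univ.filter fun l : degreeLT F n => p (X ^ n + (l : F[X]))) : ℕ) : ℝ) ≤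
      ((∑ l : degreeLT F n, #(univ.filter fun s : F => p ((fam n v tgt l).map (evalRingHom s))) : ℕ) : ℝ) := by exact_mod_cast h1
    rw [Nat.cast_mul, Nat.cast_sub (by omega)] at h4
    have h5 : (#(univ.filter fun l : degreeLT F n => (l : F[X]).eval α ∈ BS) : ℝ) * q ≤ #BS * (q : ℝ) ^ n := by exact_mod_cast h2
    have h6 : (#BS : ℝ) * (q : ℝ) ^ n ≤ (3 * r) * (q : ℝ) ^ n := by
      apply mul_le_mul_of_nonneg_right _ (by positivity)
      exact_mod_cast hBS
    push_cast at h3 h4 ⊢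
    linarith
  constructor
  · have h0 := havg (fun f => ¬ ∀ i, (f + a i).Separable) ((r * n : ℝ) * ((3 * r + 1) + (3 * r + 1) * n)) (by positivity) (fun l hl => by
      have h1 := (hcurve l hl).1
      simp only [hfib] at h1
      have h2 : (#(univ.filter fun s : F => ¬ ∀ i, ((fam n v tgt l).map (evalRingHom s) + a i).Separable) : ℝ) ≤
        (((r * n) * ((3 * r + 1) + (3 * r + 1) * n) : ℕ) : ℝ) := by
        exact_mod_cast le_trans (le_of_eq (by congr)) h1
      push_cast at h2
      refine le_trans (le_of_eq ?_) h2
      congr)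
    refine le_trans (le_of_eq ?_) h0
    congr
  · intro 𝒮 h𝒮
    have h0 := havg (fun f => ∃ τ ∈ 𝒮, ∀ i, FrobPerm k (f + a i) (τ i)) (#𝒮 / (n.factorial : ℝ) ^ r * (1 + δ) * q) (by positivity) (fun l hl => by
      have h1 := (hcurve l hl).2 𝒮 h𝒮
      simp only [hfib] at h1
      have hf : (0 : ℝ) < (n.factorial : ℝ) ^ r := by positivity
      rw [← le_div_iff₀ hf] at h1
      refine le_trans (le_of_eq ?_) (h1.trans_eq ?_)
      · congr
      · field_simp)
    refine le_trans (le_of_eq ?_) h0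
    congr

end

section
open Finset Polynomial

lemma cycleStruct_conj {n : ℕ} (π σ : Equiv.Perm (Fin n)) : cycleStruct (π * σ * π⁻¹) = cycleStruct σ := by
  simp only [cycleStruct, Equiv.Perm.cycleType_conj]

open Classical in
lemma W_eq (r n : ℕ) : (#(univ.filter fun v : Fin r → Equiv.Perm (Fin n) => ∀ i j, cycleStruct (v i) = cycleStruct (v j)) : ℝ) / (n.factorial : ℝ) ^ r = W r n := by
  rw [W, Nat.card_eq_fintype_card, Fintype.card_subtype]

open Classical in
lemma W_compl (r n : ℕ) : (#(univ.filter fun v : Fin r → Equiv.Perm (Fin n) => ¬ ∀ i j, cycleStruct (v i) = cycleStruct (v j)) : ℝ) / (n.factorial : ℝ) ^ r = 1 - W r n := by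
  rw [← W_eq]
  have h := card_filter_add_card_filter_not (s := (univ : Finset (Fin r → Equiv.Perm (Fin n)))) (fun v => ∀ i j, cycleStruct (v i) = cycleStruct (v j))
  rw [card_univ, Fintype.card_pi] at h
  simp only [Fintype.card_perm, Fintype.card_fin, prod_const, card_univ] at h
  have hf : (0 : ℝ) < (n.factorial : ℝ) ^ r := by positivity
  have h' : (#(univ.filter fun v : Fin r → Equiv.Perm (Fin n) => ∀ i j, cycleStruct (v i) = cycleStruct (v j)) : ℝ) + 
    #(univ.filter fun v : Fin r → Equiv.Perm (Fin n) => ¬ ∀ i j, cycleStruct (v i) = cycleStruct (v j)) = (n.factorial : ℝ) ^ r := by exact_mod_cast h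
  rw [eq_sub_iff_add_eq, ← add_div, div_eq_one_iff_eq hf.ne', ← h']
  ring

open Classical in
lemma card_monic {F : Type} [Field F] [Fintype F] (n : ℕ) (p : F[X] → Prop) :
    Nat.card {f : F[X] // f.Monic ∧ f.natDegree = n ∧ p f} = #(univ.filter fun l : degreeLT F n => p (X ^ n + (l : F[X]))) := by
  rw [← Fintype.card_subtype, ← Nat.card_eq_fintype_card]
  apply Nat.card_congr
  refine ⟨fun f => ⟨⟨f.1 - X ^ n, mem_degreeLT.2 (low_of_monic _ f.2.1 f.2.2.1)⟩, by simpa using f.2.2.2⟩,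
    fun l => ⟨X ^ n + (l.1 : F[X]), ?_⟩, ?_, ?_⟩
  · have h := monic_sub_low (X ^ n) (l.1 : F[X]) (monic_X_pow n) (natDegree_X_pow n) (mem_degreeLT.1 l.1.2)
    exact ⟨h.1, h.2, l.2⟩
  · intro f; apply Subtype.ext; simp
  · intro l; apply Subtype.ext; apply Subtype.ext; simp

theorem near_W (r n : ℕ) (hr : 2 ≤ r) (hn : 4 ≤ n) (η : ℝ) (hη : 0 < η) : ∃ Q : ℕ,
      ∀ (F : Type) [Field F] [Fintype F], Q < Fintype.card F →
        ∀ a : Fin r → F[X], Function.Injective a →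
          (∀ i, (a i).degree < (n : WithBot ℕ)) →
          |(Fintype.card F : ℝ)⁻¹ ^ n *
                (Nat.card {f : F[X] // f.Monic ∧ f.natDegree = n ∧
                  ∀ i j, phiPoly (f + a i) = phiPoly (f + a j)} : ℝ) - W r n| ≤ η := by
  classical
  set δ : ℝ := min 1 (η / 5) with hδdef
  have hδ : 0 < δ := lt_min one_pos (by positivity)
  have hδ1 : δ ≤ 1 := min_le_left _ _
  have hδη : 5 * δ ≤ η := by have := min_le_right (1 : ℝ) (η / 5); rw [← hδdef] at this; linarith
  obtain ⟨Q1, hQ1⟩ := equidist r n hn δ hδ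
  obtain ⟨Q2, hQ2⟩ := cycleStruct_of_prod n
  set K : ℝ := 3 * r + 1 with hK
  set M : ℝ := (r * n : ℝ) * ((3 * r + 1) + (3 * r + 1) * n) + 3 * r with hM
  have hM0 : 3 * (r : ℝ) ≤ M := by
    have : (0 : ℝ) ≤ (r * n : ℝ) * ((3 * r + 1) + (3 * r + 1) * n) := by positivity
    rw [hM]; linarith
  have hK0 : 0 < K := by positivity
  refine ⟨Q1 + Q2 + ⌈(2 * K + M) / δ + K⌉₊, ?_⟩
  intro F _ _ hq a hinj ha
  obtain ⟨hns, heq⟩ := hQ1 F (AlgebraicClosure F) (by omega) a hinj ha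
  set k := AlgebraicClosure F
  set q := Fintype.card F with hqd
  have hqbig : (2 * K + M) / δ + K ≤ q := (Nat.le_ceil _).trans (by exact_mod_cast (by omega : ⌈(2 * K + M) / δ + K⌉₊ ≤ q))
  have hqd1 : 2 * K + M ≤ δ * (q - K) := by
    have : (2 * K + M) / δ ≤ q - K := by linarith
    rw [div_le_iff₀ hδ] at this
    linarith
  have hqK : 0 < (q : ℝ) - K := by
    have h1 : 0 < δ * (q - K) := by have : (0 : ℝ) ≤ 3 * r := by positivity
                                    linarith
    exact (mul_pos_iff_of_pos_left hδ).1 h1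
  have hq0 : (0 : ℝ) < q := by linarith
  have hqn : (0 : ℝ) < (q : ℝ) ^ n := by positivity
  set Seq := univ.filter fun v : Fin r → Equiv.Perm (Fin n) => ∀ i j, cycleStruct (v i) = cycleStruct (v j) with hSeq
  set Sne := univ.filter fun v : Fin r → Equiv.Perm (Fin n) => ¬ ∀ i j, cycleStruct (v i) = cycleStruct (v j) with hSne
  have hcj : ∀ τ π : Fin r → Equiv.Perm (Fin n), ∀ i, cycleStruct ((π * τ * π⁻¹) i) = cycleStruct (τ i) := fun τ π i => cycleStruct_conj _ _
  have h1 := heq Seq (by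
    intro τ hτ π
    rw [hSeq, mem_filter] at hτ ⊢
    refine ⟨mem_univ _, fun i j => ?_⟩
    rw [hcj, hcj]; exact hτ.2 i j)
  have h2 := heq Sne (by
    intro τ hτ π
    rw [hSne, mem_filter] at hτ ⊢
    refine ⟨mem_univ _, fun h => hτ.2 fun i j => ?_⟩
    have := h i j
    rwa [hcj, hcj] at this)
  rw [W_eq] at h1
  rw [W_compl] at h2
  have hw0 : 0 ≤ W r n := by rw [W]; positivity
  have hw1 : W r n ≤ 1 := by
    have := W_compl r n
    have h : (0 : ℝ) ≤ 1 - W r n := by rw [← this]; positivity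
    linarith
  set w := W r n
  rw [card_monic n (fun f => ∀ i j, phiPoly (f + a i) = phiPoly (f + a j))]
  set Ens := univ.filter fun l : degreeLT F n => ¬ ∀ i, (X ^ n + (l : F[X]) + a i).Separable with hEns
  set Eeq := univ.filter fun l : degreeLT F n => ∃ τ ∈ Seq, ∀ i, FrobPerm k (X ^ n + (l : F[X]) + a i) (τ i) with hEeq
  set Ene := univ.filter fun l : degreeLT F n => ∃ τ ∈ Sne, ∀ i, FrobPerm k (X ^ n + (l : F[X]) + a i) (τ i) with hEne
  set E := univ.filter fun l : degreeLT F n => ∀ i j, phiPoly (X ^ n + (l : F[X]) + a i) = phiPoly (X ^ n + (l : F[X]) + a j) with hE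
  have htype : ∀ l : degreeLT F n, l ∉ Ens → ∃ τ : Fin r → Equiv.Perm (Fin n), ∀ i, FrobPerm k (X ^ n + (l : F[X]) + a i) (τ i) := by
    intro l hl
    have hs : ∀ i, (X ^ n + (l : F[X]) + a i).Separable := by
      by_contra h; exact hl (mem_filter.2 ⟨mem_univ _, h⟩)
    choose τ hτ using fun i => by
      have h3 := monic_sub_low (X ^ n) (l : F[X]) (monic_X_pow n) (natDegree_X_pow n) (mem_degreeLT.1 l.2)
      have h4 := monic_sub_low _ _ h3.1 h3.2 (ha i)
      exact exists_frobPerm (k := k) _ h4.1 h4.2 (hs i)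
    exact ⟨τ, hτ⟩
  have hsub1 : Eeq ⊆ E := by
    intro l hl
    obtain ⟨τ, hτ, h⟩ := (mem_filter.1 hl).2
    refine mem_filter.2 ⟨mem_univ _, fun i j => ?_⟩
    rw [phiPoly_formula _ _ (h i), phiPoly_formula _ _ (h j), (mem_filter.1 hτ).2 i j]
  have hsub2 : E ⊆ Eeq ∪ Ens := by
    intro l hl
    by_cases hn' : l ∈ Ens
    · exact mem_union_right _ hn'
    obtain ⟨τ, h⟩ := htype l hn'
    refine mem_union_left _ (mem_filter.2 ⟨mem_univ _, τ, mem_filter.2 ⟨mem_univ _, fun i j => ?_⟩, h⟩)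
    apply hQ2 q (by omega)
    rw [← phiPoly_formula _ _ (h i), ← phiPoly_formula _ _ (h j)]
    exact (mem_filter.1 hl).2 i j
  have hsub3 : (univ : Finset (degreeLT F n)) ⊆ Eeq ∪ Ene ∪ Ens := by
    intro l _
    by_cases hn' : l ∈ Ens
    · exact mem_union_right _ hn'
    obtain ⟨τ, h⟩ := htype l hn'
    apply mem_union_left
    by_cases hτ : ∀ i j, cycleStruct (τ i) = cycleStruct (τ j)
    · exact mem_union_left _ (mem_filter.2 ⟨mem_univ _, τ, mem_filter.2 ⟨mem_univ _, hτ⟩, h⟩)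
    · exact mem_union_right _ (mem_filter.2 ⟨mem_univ _, τ, mem_filter.2 ⟨mem_univ _, hτ⟩, h⟩)
  have c1 : (#Eeq : ℝ) ≤ #E := by exact_mod_cast card_le_card hsub1
  have c2 : (#E : ℝ) ≤ #Eeq + #Ens := by exact_mod_cast (card_le_card hsub2).trans (card_union_le _ _)
  have c3 : (q : ℝ) ^ n ≤ #Eeq + #Ene + #Ens := by
    have h3 := (card_le_card hsub3).trans (card_union_le _ _)
    have h4 := card_union_le Eeq Ene
    rw [card_univ, card_LT] at h3
    change q ^ n ≤ _ at h3
    have : q ^ n ≤ #Eeq + #Ene + #Ens := by omega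
    exact_mod_cast this
  -- normalisation
  have key : ∀ (N u : ℝ), 0 ≤ u → u ≤ 1 → (q - K) * N ≤ (q : ℝ) ^ n * (u * (1 + δ) * q + 3 * r) → N / (q : ℝ) ^ n ≤ u + 4 * δ := by
    intro N u hu hu1 h
    rw [div_le_iff₀ hqn]
    refine le_of_mul_le_mul_left (h.trans ?_) hqK
    have e1 : (q : ℝ) ≤ (1 + δ) * (q - K) := by linarith
    have e2 : 3 * (r : ℝ) ≤ δ * (q - K) := by linarith
    have e3 : u * (1 + δ) * q ≤ u * (1 + δ) * ((1 + δ) * (q - K)) := by gcongr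
    have e4 : u * (1 + δ) * (1 + δ) + δ ≤ u + 4 * δ := by nlinarith [mul_nonneg hu hδ.le, mul_nonneg (sub_nonneg.2 hu1) hδ.le, mul_nonneg (sub_nonneg.2 hδ1) hδ.le, mul_nonneg hu (mul_nonneg (sub_nonneg.2 hδ1) hδ.le)]
    calc (q : ℝ) ^ n * (u * (1 + δ) * q + 3 * r) ≤ (q : ℝ) ^ n * ((u * (1 + δ) * (1 + δ) + δ) * (q - K)) := by
          gcongr; linarith
      _ ≤ (q : ℝ) ^ n * ((u + 4 * δ) * (q - K)) := by gcongr
      _ = _ := by ring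
  have k1 := key _ w hw0 hw1 h1
  have k2 := key _ (1 - w) (by linarith) (by linarith) h2
  have k3 : (#Ens : ℝ) / (q : ℝ) ^ n ≤ δ := by
    rw [div_le_iff₀ hqn]
    refine le_of_mul_le_mul_left (hns.trans ?_) hqK
    have e2 : M ≤ δ * (q - K) := by linarith
    calc (q : ℝ) ^ n * M ≤ (q : ℝ) ^ n * (δ * (q - K)) := by gcongr
      _ = _ := by ring
  have d2 : (#E : ℝ) / (q : ℝ) ^ n ≤ #Eeq / (q : ℝ) ^ n + #Ens / (q : ℝ) ^ n := by
    rw [← add_div]; gcongr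
  have d1 : (#Eeq : ℝ) / (q : ℝ) ^ n ≤ #E / (q : ℝ) ^ n := by gcongr
  have d3 : 1 ≤ (#Eeq : ℝ) / (q : ℝ) ^ n + #Ene / (q : ℝ) ^ n + #Ens / (q : ℝ) ^ n := by
    rw [← add_div, ← add_div, le_div_iff₀ hqn, one_mul]; exact c3
  have e0 : (q : ℝ)⁻¹ ^ n * (#E : ℝ) = #E / (q : ℝ) ^ n := by rw [inv_pow, div_eq_inv_mul]
  have hgoal : |(q : ℝ)⁻¹ ^ n * (#E : ℝ) - w| ≤ η := by
    rw [e0, abs_le]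
    constructor <;> linarith
  convert hgoal

end

theorem stmt_5 (r : ℕ) (hr : 2 ≤ r) (Ar : ℝ) (hAr : Ar = ∑' m : ℕ, W r m) :
    ∀ ε : ℝ, 0 < ε → ∃ N : ℕ, ∀ n : ℕ, N ≤ n → ∃ Q : ℕ,
      ∀ (F : Type) [Field F] [Fintype F], Q < Fintype.card F →
        ∀ a : Fin r → F[X], Function.Injective a →
          (∀ i, (a i).degree < (n : WithBot ℕ)) →
          |(Fintype.card F : ℝ)⁻¹ ^ n *
                (Nat.card {f : F[X] // f.Monic ∧ f.natDegree = n ∧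
                  ∀ i j, phiPoly (f + a i) = phiPoly (f + a j)} : ℝ)
              - Ar / (n : ℝ) ^ r|
            ≤ ε / (n : ℝ) ^ r := by
  intro ε hε
  have hW := W_tendsto r hr
  rw [← hAr, Metric.tendsto_atTop] at hW
  obtain ⟨N, hN⟩ := hW (ε / 2) (by positivity)
  refine ⟨N + 4, fun n hn => ?_⟩
  have hn0 : (0 : ℝ) < (n : ℝ) ^ r := by
    have : 0 < n := by omega
    positivity
  obtain ⟨Q, hQ⟩ := near_W r n hr (by omega) (ε / 2 / (n : ℝ) ^ r) (by positivity)
  refine ⟨Q, ?_⟩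
  intro F _ _ hq a hinj ha
  have h1 := hQ F hq a hinj ha
  have h2 := hN n (by omega)
  rw [Real.dist_eq] at h2
  have h3 : |W r n - Ar / (n : ℝ) ^ r| ≤ ε / 2 / (n : ℝ) ^ r := by
    have : W r n - Ar / (n : ℝ) ^ r = ((n : ℝ) ^ r * W r n - Ar) / (n : ℝ) ^ r := by field_simp
    rw [this, abs_div, abs_of_pos hn0]
    gcongr
  calc _ ≤ _ := abs_sub_le _ (W r n) _
    _ ≤ ε / 2 / (n : ℝ) ^ r + ε / 2 / (n : ℝ) ^ r := add_le_add h1 h3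
    _ = _ := by ring
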